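/- Fix an algebraic closure ℚ̄ of ℚ and let E ⊆ F ⊆ ℚ̄ be totally real number fields with E ≠ F. Then the ratio h(M·F)/h(M) tends to infinity as M ranges over CM quadratic extensions of E inside ℚ̄: for every real C > 0 there are only finitely many totally imaginary quadratic extensions M of E inside ℚ̄ satisfying h(M·F) ≤ C · h(M), where M·F ⊆ ℚ̄ denotes the compositum of M and F. -/

import Mathlib

open NumberField Module

/-- A field is totally real if all of its complex embeddings are real. -/
def IsTotallyRealField (K : Type*) [Field K] : Prop :=
  ∀ φ : K →+* ℂ, ComplexEmbedding.IsReal φ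

/-- A field is totally imaginary if none of its complex embeddings is real. -/
def IsTotallyImaginaryField (K : Type*) [Field K] : Prop :=
  ∀ φ : K →+* ℂ, ¬ ComplexEmbedding.IsReal φ

namespace BrauerSiegel

open NumberField.InfinitePlace NumberField.Units NumberField.Units.dirichletUnitTheorem
open MeasureTheory
open scoped ENNReal nonZeroDivisors

section Unfolding

open scoped Classical

variable (K : Type*) [Field K] [NumberField K]

/-- Coordinates at all infinite places of the point with total logarithmic size `y` and
position `l` in the logarithmic space. -/
noncomputable def tau (y : ℝ) (l : logSpace K) (w : InfinitePlace K) : ℝ :=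
  if h : w = w₀ then y / finrank ℚ K - (∑ v, l v) / mult w else y / finrank ℚ K + l ⟨w, h⟩ / mult w

/-- Position in the logarithmic space of a family of logarithmic sizes. -/
noncomputable def logProj (v : InfinitePlace K → ℝ) : logSpace K :=
  fun w ↦ mult w.1 * (v w.1 - (∑ w', mult w' * v w') / finrank ℚ K)

variable {K}

lemma tau_sub (y y' : ℝ) (l l' : logSpace K) (w : InfinitePlace K) :
    tau K (y - y') (l - l') w = tau K y l w - tau K y' l' w := by
  unfold tau
  split_ifs
  · simp only [Pi.sub_apply, Finset.sum_sub_distrib]; ring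
  · simp only [Pi.sub_apply]; ring

lemma tau_smul (c y : ℝ) (l : logSpace K) (w : InfinitePlace K) :
    tau K (c * y) (c • l) w = c * tau K y l w := by
  unfold tau
  split_ifs
  · simp only [Pi.smul_apply, smul_eq_mul, ← Finset.mul_sum]; ring
  · simp only [Pi.smul_apply, smul_eq_mul]; ring

lemma mult_real_ne_zero (w : InfinitePlace K) : (mult w : ℝ) ≠ 0 := mult_coe_ne_zero

lemma sum_mult_mul_split (f : InfinitePlace K → ℝ) :
    ∑ w, f w = f w₀ + ∑ w : {w : InfinitePlace K // w ≠ w₀}, f w.1 := by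
  exact Fintype.sum_eq_add_sum_subtype_ne f w₀

lemma sum_mult_tau (y : ℝ) (l : logSpace K) : ∑ w, mult w * tau K y l w = y := by
  have hn : (finrank ℚ K : ℝ) ≠ 0 := by exact_mod_cast (finrank_pos (R := ℚ) (M := K)).ne'
  have key : ∀ w, mult w * tau K y l w = mult w * (y / finrank ℚ K) +
      (if h : w = w₀ then -(∑ v, l v) else l ⟨w, h⟩) := by
    intro w
    have := mult_real_ne_zero w
    unfold tau
    split_ifs <;> field_simp <;> ring
  simp_rw [key, Finset.sum_add_distrib, ← Finset.sum_mul]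
  rw [sum_mult_mul_split (fun w ↦ if h : w = w₀ then -(∑ v, l v) else l ⟨w, h⟩)]
  have h2 : ∑ w : {w : InfinitePlace K // w ≠ w₀},
      (if h : w.1 = w₀ then -(∑ v, l v) else l ⟨w.1, h⟩) = ∑ v, l v :=
    Finset.sum_congr rfl fun w _ ↦ by rw [dif_neg w.2]
  rw [h2, dif_pos rfl]
  have h3 : ∑ w : InfinitePlace K, (mult w : ℝ) = finrank ℚ K := by
    exact_mod_cast InfinitePlace.sum_mult_eq (K := K)
  rw [h3]
  field_simp
  ring

lemma tau_logProj (v : InfinitePlace K → ℝ) (w : InfinitePlace K) :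
    tau K (∑ w', mult w' * v w') (logProj K v) w = v w := by
  have hn : (finrank ℚ K : ℝ) ≠ 0 := by exact_mod_cast (finrank_pos (R := ℚ) (M := K)).ne'
  have hw := mult_real_ne_zero w
  unfold tau
  split_ifs with h
  · subst h
    have h1 := sum_mult_mul_split (fun w' ↦ mult w' * (v w' - (∑ w', mult w' * v w') / finrank ℚ K))
    have h2 : ∑ w' : InfinitePlace K, mult w' * (v w' - (∑ w', mult w' * v w') / finrank ℚ K) =
        0 := by
      simp_rw [mul_sub, Finset.sum_sub_distrib, ← Finset.sum_mul]
      have h3 : ∑ w : InfinitePlace K, (mult w : ℝ) = finrank ℚ K := by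
        exact_mod_cast InfinitePlace.sum_mult_eq (K := K)
      rw [h3]; field_simp; ring
    rw [h2] at h1
    have h4 : ∑ v', logProj K v v' =
      -(mult (w₀ : InfinitePlace K) * (v w₀ - (∑ w', mult w' * v w') / finrank ℚ K)) := by
      unfold logProj; linarith
    rw [h4]; field_simp; ring
  · unfold logProj; field_simp; ring

/-- Logarithmic sizes of an element at the infinite places. -/
noncomputable def logSize (x : K) : InfinitePlace K → ℝ := fun w ↦ Real.log (w x)

lemma sum_mult_logSize {x : K} (hx : x ≠ 0) :
    ∑ w, mult w * logSize x w = Real.log |(Algebra.norm ℚ x : ℝ)| := by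
  have h : ∏ w : InfinitePlace K, w x ^ mult w = |(Algebra.norm ℚ x : ℝ)| := by
    have := InfinitePlace.prod_eq_abs_norm x
    push_cast at this
    exact this
  rw [← h, Real.log_prod fun w _ ↦ pow_ne_zero _ ((map_ne_zero w).2 hx)]
  simp [logSize]

lemma logSize_mul {x y : K} (hx : x ≠ 0) (hy : y ≠ 0) :
    logSize (x * y) = logSize x + logSize y := by
  ext w
  simp [logSize, Real.log_mul ((map_ne_zero w).2 hx) ((map_ne_zero w).2 hy)]

lemma logProj_add (v v' : InfinitePlace K → ℝ) :
    logProj K (v + v') = logProj K v + logProj K v' := by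
  ext w
  simp only [logProj, Pi.add_apply, mul_add, Finset.sum_add_distrib]
  ring

lemma logProj_logSize_unit (u : (𝓞 K)ˣ) :
    logProj K (logSize (u : K)) = logEmbedding K (Additive.ofMul u) := by
  ext w
  have h : ∑ w, mult w * logSize (u : K) w = 0 := Units.sum_mult_mul_log u
  simp only [logProj, h, zero_div, sub_zero, logEmbedding_component]
  rfl

/-- Indicator of the simplex of nonnegative coordinates. -/
noncomputable def simplexInd (y : ℝ) (l : logSpace K) : ℝ≥0∞ :=
  if ∀ w, 0 ≤ tau K y l w then 1 else 0

lemma measurable_tau (w : InfinitePlace K) :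
    Measurable (fun p : ℝ × logSpace K ↦ tau K p.1 p.2 w) := by
  unfold tau
  split_ifs <;> fun_prop

lemma measurable_simplexInd (y : ℝ) : Measurable (simplexInd (K := K) y) := by
  unfold simplexInd
  refine Measurable.ite ?_ measurable_const measurable_const
  have : {l : logSpace K | ∀ w, 0 ≤ tau K y l w} = ⋂ w, {l | 0 ≤ tau K y l w} := by
    ext; simp
  rw [this]
  refine MeasurableSet.iInter fun w ↦ measurableSet_le measurable_const ?_
  exact (measurable_tau w).comp (measurable_const.prodMk measurable_id)

lemma forall_le_exp_tau_iff {x : K} (hx : x ≠ 0) (y : ℝ) (l : logSpace K) :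
    (∀ w : InfinitePlace K, w x ≤ Real.exp (tau K y l w)) ↔
      ∀ w, 0 ≤ tau K (y - Real.log |(Algebra.norm ℚ x : ℝ)|) (l - logProj K (logSize x)) w := by
  refine forall_congr' fun w ↦ ?_
  rw [tau_sub, ← sum_mult_logSize hx, tau_logProj, sub_nonneg]
  have : 0 < w x := by simpa using (InfinitePlace.pos_iff.2 hx)
  exact (Real.log_le_iff_le_exp this).symm

end Unfolding

section Unfolding

open scoped Classical

variable (K : Type*) [Field K] [NumberField K]

instance countable_ringOfIntegers : Countable (𝓞 K) :=
  (RingOfIntegers.basis K).equivFun.toEquiv.countable_iff.2 inferInstance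

instance countable_units : Countable (𝓞 K)ˣ := Units.val_injective.countable

instance countable_ideals : Countable (Ideal (𝓞 K)) := by
  rw [← Set.countable_univ_iff]
  have : (Set.univ : Set (Ideal (𝓞 K))) = ⋃ n : ℕ, {I | Ideal.absNorm I ≤ n} := by
    ext I; simpa using ⟨_, le_rfl⟩
  rw [this]
  exact Set.countable_iUnion fun n ↦ (Ideal.finite_setOfPred_absNorm_le n).countable

lemma tsum_units_logEmbedding (f : logSpace K → ℝ≥0∞) :
    ∑' u : (𝓞 K)ˣ, f (logEmbedding K (Additive.ofMul u)) =
      torsionOrder K * ∑' l : unitLattice K, f l := by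
  let φ : (𝓞 K)ˣ → unitLattice K := fun u ↦
    ⟨logEmbedding K (Additive.ofMul u), ⟨Additive.ofMul u, trivial, rfl⟩⟩
  rw [← (Equiv.sigmaFiberEquiv φ).tsum_eq, ENNReal.tsum_sigma', ← ENNReal.tsum_mul_left]
  refine tsum_congr fun l ↦ ?_
  have h1 : ∀ u : {u : (𝓞 K)ˣ // φ u = l},
      f (logEmbedding K (Additive.ofMul (Equiv.sigmaFiberEquiv φ ⟨l, u⟩))) = f l := by
    rintro ⟨u, rfl⟩; rfl
  rw [tsum_congr h1, ENNReal.tsum_const]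
  congr 1
  obtain ⟨l, ⟨u₀, -, hu₀⟩⟩ := l
  have e : {u : (𝓞 K)ˣ // φ u = ⟨l, ⟨u₀, trivial, hu₀⟩⟩} ≃ torsion K :=
    { toFun := fun u ↦ ⟨(Additive.toMul u₀)⁻¹ * u.1, by
        rw [← logEmbedding_eq_zero_iff, ofMul_mul, map_add, ofMul_inv, map_neg]
        have := congrArg Subtype.val u.2
        change logEmbedding K (Additive.ofMul u.1) = l at this
        rw [this, ← hu₀]; simp⟩
      invFun := fun t ↦ ⟨Additive.toMul u₀ * t.1, by
        refine Subtype.ext ?_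
        change logEmbedding K (Additive.ofMul (Additive.toMul u₀ * t.1)) = l
        rw [ofMul_mul, map_add, logEmbedding_eq_zero_iff.2 t.2, add_zero]
        exact hu₀⟩
      left_inv := fun u ↦ by simp
      right_inv := fun t ↦ by simp }
  rw [ENat.card_congr e, torsionOrder, ENat.card_eq_coe_natCard]
  rfl

/-- Volume of the simplex of nonnegative coordinates of total size `y`. -/
noncomputable def simplexVol (y : ℝ) : ℝ≥0∞ := ∫⁻ l : logSpace K, simplexInd y l

/-- A fundamental domain of the unit lattice in the logarithmic space. -/
noncomputable def unitDomain : Set (logSpace K) :=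
  ZSpan.fundamentalDomain ((basisUnitLattice K).ofZLatticeBasis ℝ (unitLattice K))

lemma isAddFundamentalDomain_unitDomain :
    IsAddFundamentalDomain (unitLattice K) (unitDomain K) :=
  ZLattice.isAddFundamentalDomain (basisUnitLattice K) volume

instance : VAddInvariantMeasure (unitLattice K) (logSpace K) volume :=
  inferInstanceAs <| VAddInvariantMeasure (unitLattice K).toAddSubgroup (logSpace K) volume

lemma lintegral_unitDomain_tsum (y : ℝ) (a : logSpace K) :
    ∫⁻ l in unitDomain K, ∑' u : (𝓞 K)ˣ,
      simplexInd y (l - (a + logEmbedding K (Additive.ofMul u))) =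
      torsionOrder K * simplexVol K y := by
  have h1 : ∀ l : logSpace K, ∑' u : (𝓞 K)ˣ,
      simplexInd y (l - (a + logEmbedding K (Additive.ofMul u))) =
      torsionOrder K * ∑' v : unitLattice K, simplexInd y (l - (a + (v : logSpace K))) := fun l ↦
    tsum_units_logEmbedding K (fun v ↦ simplexInd y (l - (a + v)))
  simp_rw [h1]
  have hm : ∀ v : logSpace K, Measurable fun l ↦ simplexInd (K := K) y (l - v) := fun v ↦
    (measurable_simplexInd y).comp (measurable_id.sub_const v)
  have : Countable (unitLattice K) := by
    exact (basisUnitLattice K).equivFun.toEquiv.countable_iff.2 inferInstance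
  rw [lintegral_const_mul _ (Measurable.ennreal_tsum fun v ↦ hm _), lintegral_tsum
    (fun v ↦ (hm _).aemeasurable)]
  congr 1
  have h2 : simplexVol K y = ∫⁻ l : logSpace K, simplexInd y (l - a) := by
    rw [simplexVol, lintegral_sub_right_eq_self (fun l ↦ simplexInd y l) a]
  rw [h2, (isAddFundamentalDomain_unitDomain K).lintegral_eq_tsum' (fun l ↦ simplexInd y (l - a))]
  refine tsum_congr fun v ↦ lintegral_congr fun l ↦ ?_
  congr 1
  change l - (a + v) = (-(v : logSpace K) + l) - a
  abel

variable {K}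

lemma exists_generator {J : (Ideal (𝓞 K))⁰} {c : ClassGroup (𝓞 K)}
    (hJ : ClassGroup.mk0 J = c⁻¹) (I : {I : (Ideal (𝓞 K))⁰ // ClassGroup.mk0 I = c}) :
    ∃ x : 𝓞 K, x ≠ 0 ∧ Ideal.span {x} = (J : Ideal (𝓞 K)) * I.1 := by
  have h : ClassGroup.mk0 (J * I.1) = 1 := by rw [map_mul, hJ, I.2, inv_mul_cancel]
  obtain ⟨x, hx⟩ := ((ClassGroup.mk0_eq_one_iff (J * I.1).2).1 h).principal
  have h2 : Ideal.span {x} = (J : Ideal (𝓞 K)) * I.1 := hx.symm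
  refine ⟨x, ?_, h2⟩
  rintro rfl
  have h3 := nonZeroDivisors.coe_ne_zero (J * I.1)
  apply h3
  rw [Submonoid.coe_mul, ← h2]
  simp

/-- A generator of `J * I`. -/
noncomputable def generator {J : (Ideal (𝓞 K))⁰} {c : ClassGroup (𝓞 K)}
    (hJ : ClassGroup.mk0 J = c⁻¹) (I : {I : (Ideal (𝓞 K))⁰ // ClassGroup.mk0 I = c}) : 𝓞 K :=
  (exists_generator hJ I).choose

section Generator

variable {J : (Ideal (𝓞 K))⁰} {c : ClassGroup (𝓞 K)} (hJ : ClassGroup.mk0 J = c⁻¹)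

lemma generator_ne_zero (I : {I : (Ideal (𝓞 K))⁰ // ClassGroup.mk0 I = c}) :
    generator hJ I ≠ 0 := (exists_generator hJ I).choose_spec.1

lemma span_generator_mul (I : {I : (Ideal (𝓞 K))⁰ // ClassGroup.mk0 I = c}) (u : (𝓞 K)ˣ) :
    Ideal.span {generator hJ I * (u : 𝓞 K)} = (J : Ideal (𝓞 K)) * (I.1 : Ideal (𝓞 K)) := by
  rw [Ideal.span_singleton_mul_right_unit u.isUnit]
  exact (exists_generator hJ I).choose_spec.2

lemma generator_mul_mem (I : {I : (Ideal (𝓞 K))⁰ // ClassGroup.mk0 I = c}) (u : (𝓞 K)ˣ) :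
    generator hJ I * (u : 𝓞 K) ∈ (J : Ideal (𝓞 K)) := by
  have h := Ideal.mem_span_singleton_self (generator hJ I * (u : 𝓞 K))
  rw [span_generator_mul] at h
  exact Ideal.mul_le_left h

/-- The nonzero elements of an ideal are parametrized by integral ideals in a class and units. -/
noncomputable def toElements (p : {I : (Ideal (𝓞 K))⁰ // ClassGroup.mk0 I = c} × (𝓞 K)ˣ) :
    {x : 𝓞 K // x ∈ (J : Ideal (𝓞 K)) ∧ x ≠ 0} :=
  ⟨generator hJ p.1 * p.2, generator_mul_mem hJ p.1 p.2,
    mul_ne_zero (generator_ne_zero hJ p.1) p.2.ne_zero⟩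

lemma toElements_injective : Function.Injective (toElements hJ) := by
  rintro p q hpq
  have h0 : generator hJ p.1 * (p.2 : 𝓞 K) = generator hJ q.1 * q.2 := congrArg Subtype.val hpq
  have h1 : p.1 = q.1 := by
    refine Subtype.ext (Subtype.ext (mul_left_cancel₀ (nonZeroDivisors.coe_ne_zero J) ?_))
    rw [← span_generator_mul hJ p.1 p.2, ← span_generator_mul hJ q.1 q.2, h0]
  refine Prod.ext h1 ?_
  rw [h1] at h0
  exact Units.ext (mul_left_cancel₀ (generator_ne_zero hJ q.1) h0)

lemma toElements_surjective : Function.Surjective (toElements hJ) := by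
  rintro ⟨x, hxJ, hx0⟩
  obtain ⟨I, hI⟩ := Ideal.dvd_span_singleton.2 hxJ
  have hI0 : I ≠ 0 := by
    rintro rfl
    rw [mul_zero] at hI
    exact hx0 (by simpa using hI)
  let I' : (Ideal (𝓞 K))⁰ := ⟨I, mem_nonZeroDivisors_of_ne_zero hI0⟩
  have hc : ClassGroup.mk0 I' = c := by
    have : ClassGroup.mk0 (J * I') = 1 := by
      rw [ClassGroup.mk0_eq_one_iff]
      exact ⟨x, hI.symm⟩
    rw [map_mul, hJ] at this
    exact (inv_mul_eq_one.1 this).symm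
  have hsp2 := span_generator_mul hJ ⟨I', hc⟩ 1
  have : Associated (generator hJ ⟨I', hc⟩) x := by
    rw [← Ideal.span_singleton_eq_span_singleton, hI]
    simpa using hsp2
  obtain ⟨u, hu⟩ := this
  exact ⟨(⟨I', hc⟩, u), Subtype.ext hu⟩

end Generator

lemma abs_norm_coe_eq (x : 𝓞 K) :
    |(Algebra.norm ℚ (x : K) : ℝ)| = Ideal.absNorm (Ideal.span {x}) := by
  rw [Ideal.absNorm_span_singleton, ← Algebra.coe_norm_int]
  simp [Nat.cast_natAbs]

lemma lintegral_unitDomain_elements {J : (Ideal (𝓞 K))⁰} {c : ClassGroup (𝓞 K)}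
    (hJ : ClassGroup.mk0 J = c⁻¹) (y : ℝ) :
    ∫⁻ l in unitDomain K, ∑' x : {x : 𝓞 K // x ∈ (J : Ideal (𝓞 K)) ∧ x ≠ 0},
      simplexInd (y + Real.log (Ideal.absNorm (J : Ideal (𝓞 K))) -
          Real.log |(Algebra.norm ℚ (x.1 : K) : ℝ)|) (l - logProj K (logSize (x.1 : K))) =
      torsionOrder K * ∑' I : {I : (Ideal (𝓞 K))⁰ // ClassGroup.mk0 I = c},
        simplexVol K (y - Real.log (Ideal.absNorm (I.1 : Ideal (𝓞 K)))) := by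
  have h1 : ∀ l : logSpace K, ∑' x : {x : 𝓞 K // x ∈ (J : Ideal (𝓞 K)) ∧ x ≠ 0},
      simplexInd (y + Real.log (Ideal.absNorm (J : Ideal (𝓞 K))) -
          Real.log |(Algebra.norm ℚ (x.1 : K) : ℝ)|) (l - logProj K (logSize (x.1 : K))) =
      ∑' I : {I : (Ideal (𝓞 K))⁰ // ClassGroup.mk0 I = c}, ∑' u : (𝓞 K)ˣ,
        simplexInd (y - Real.log (Ideal.absNorm (I.1 : Ideal (𝓞 K))))
          (l - (logProj K (logSize ((generator hJ I : 𝓞 K) : K)) +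
            logEmbedding K (Additive.ofMul u))) := by
    intro l
    rw [← (Equiv.ofBijective _ ⟨toElements_injective hJ, toElements_surjective hJ⟩).tsum_eq,
      ENNReal.tsum_prod']
    refine tsum_congr fun I ↦ tsum_congr fun u ↦ ?_
    congr 1
    · rw [abs_norm_coe_eq]
      change y + _ - Real.log (Ideal.absNorm (Ideal.span {generator hJ I * (u : 𝓞 K)})) = _
      rw [span_generator_mul, map_mul, Nat.cast_mul, Real.log_mul]
      · ring
      · exact_mod_cast Ideal.absNorm_ne_zero_of_nonZeroDivisors J
      · exact_mod_cast Ideal.absNorm_ne_zero_of_nonZeroDivisors I.1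
    · congr 1
      rw [← logProj_logSize_unit, ← logProj_add, ← logSize_mul]
      · rfl
      · simpa using generator_ne_zero hJ I
      · simp
  simp_rw [h1]
  have hm : ∀ (y : ℝ) (v : logSpace K),
      Measurable fun l ↦ simplexInd (K := K) y (l - v) := fun y v ↦
    (measurable_simplexInd y).comp (measurable_id.sub_const v)
  rw [lintegral_tsum, ← ENNReal.tsum_mul_left]
  · exact tsum_congr fun I ↦ lintegral_unitDomain_tsum K _ _
  · exact fun I ↦ (Measurable.ennreal_tsum fun u ↦ hm _ _).aemeasurable

end Unfolding

open NumberField.mixedEmbedding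
open scoped NNReal

section LatticeCount

open scoped Classical

lemma lintegral_tsum_indicator {E : Type*} [NormedAddCommGroup E] [NormedSpace ℝ E]
    [FiniteDimensional ℝ E] [MeasureSpace E] [BorelSpace E]
    [(volume : Measure E).IsAddHaarMeasure] {L : Submodule ℤ E} [Countable L] {F : Set E}
    (hF : IsAddFundamentalDomain L F) {A : Set E} (hA : MeasurableSet A) :
    ∫⁻ z in F, ∑' v : L, A.indicator (1 : E → ℝ≥0∞) (v + z) = volume A := by
  have : VAddInvariantMeasure L E volume :=
    inferInstanceAs <| VAddInvariantMeasure L.toAddSubgroup E volume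
  rw [lintegral_tsum, ← lintegral_indicator_one hA,
    hF.lintegral_eq_tsum'' (A.indicator (1 : E → ℝ≥0∞))]
  · rfl
  · exact fun v ↦ ((measurable_one.indicator hA).comp (measurable_const_add _)).aemeasurable

lemma measure_mul_count_le {E : Type*} [NormedAddCommGroup E] [NormedSpace ℝ E]
    [FiniteDimensional ℝ E] [MeasureSpace E] [BorelSpace E]
    [(volume : Measure E).IsAddHaarMeasure] {L : Submodule ℤ E} [Countable L] {F : Set E}
    (hF : IsAddFundamentalDomain L F) {A B : Set E} (hA : MeasurableSet A)
    (h : ∀ z, ∃ u ∈ L, ∀ x ∈ B, x + (z - u) ∈ A) :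
    volume F * ∑' v : L, B.indicator (1 : E → ℝ≥0∞) v ≤ volume A := by
  have : ∫⁻ _ in F, ∑' v : L, B.indicator (1 : E → ℝ≥0∞) v =
    (∑' v : L, B.indicator (1 : E → ℝ≥0∞) v) * volume F := setLIntegral_const _ _
  rw [← lintegral_tsum_indicator hF hA, mul_comm, ← this]
  refine lintegral_mono fun z ↦ ?_
  obtain ⟨u, huL, hu⟩ := h z
  have e := (Equiv.subRight (⟨u, huL⟩ : L)).tsum_eq
    (fun v : L ↦ A.indicator (1 : E → ℝ≥0∞) (v + z))
  rw [← e]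
  refine ENNReal.tsum_le_tsum fun v ↦ ?_
  by_cases hv : (v : E) ∈ B
  · have h1 := hu v hv
    have h2 : ((Equiv.subRight (⟨u, huL⟩ : L) v : L) : E) + z ∈ A := by
      have : ((Equiv.subRight (⟨u, huL⟩ : L) v : L) : E) + z = v + (z - u) := by
        simp; abel
      rwa [this]
    rw [Set.indicator_of_mem hv, Set.indicator_of_mem h2]
    rfl
  · rw [Set.indicator_of_notMem hv]; exact zero_le

lemma measure_le_mul_count {E : Type*} [NormedAddCommGroup E] [NormedSpace ℝ E]
    [FiniteDimensional ℝ E] [MeasureSpace E] [BorelSpace E]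
    [(volume : Measure E).IsAddHaarMeasure] {L : Submodule ℤ E} [Countable L] {F : Set E}
    (hF : IsAddFundamentalDomain L F) {A B : Set E} (hA : MeasurableSet A)
    (h : ∀ z, ∃ u ∈ L, ∀ x, x + (z - u) ∈ A → x ∈ B) :
    volume A ≤ volume F * ∑' v : L, B.indicator (1 : E → ℝ≥0∞) v := by
  have : ∫⁻ _ in F, ∑' v : L, B.indicator (1 : E → ℝ≥0∞) v =
    (∑' v : L, B.indicator (1 : E → ℝ≥0∞) v) * volume F := setLIntegral_const _ _
  rw [← lintegral_tsum_indicator hF hA, mul_comm, ← this]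
  refine lintegral_mono fun z ↦ ?_
  obtain ⟨u, huL, hu⟩ := h z
  have e := (Equiv.subRight (⟨u, huL⟩ : L)).tsum_eq
    (fun v : L ↦ A.indicator (1 : E → ℝ≥0∞) (v + z))
  rw [← e]
  refine ENNReal.tsum_le_tsum fun v ↦ ?_
  by_cases hv : ((Equiv.subRight (⟨u, huL⟩ : L) v : L) : E) + z ∈ A
  · have h2 : (v : E) ∈ B := by
      apply hu
      have : ((Equiv.subRight (⟨u, huL⟩ : L) v : L) : E) + z = v + (z - u) := by
        simp; abel
      rwa [← this]
    rw [Set.indicator_of_mem hv, Set.indicator_of_mem h2]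
    rfl
  · rw [Set.indicator_of_notMem hv]; exact zero_le

variable {K : Type*} [Field K] [NumberField K]

lemma mem_convexBodyLT_iff (f : InfinitePlace K → ℝ≥0) (x : mixedSpace K) :
    x ∈ convexBodyLT K f ↔ ∀ w, normAtPlace w x < f w := by
  simp only [convexBodyLT, Set.mem_prod, Set.mem_pi, Set.mem_univ, forall_true_left,
    mem_ball_zero_iff]
  constructor
  · rintro ⟨h1, h2⟩ w
    rcases isReal_or_isComplex w with hw | hw
    · rw [normAtPlace_apply_of_isReal hw]; exact h1 ⟨w, hw⟩
    · rw [normAtPlace_apply_of_isComplex hw]; exact h2 ⟨w, hw⟩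
  · intro h
    refine ⟨fun w ↦ ?_, fun w ↦ ?_⟩
    · rw [← normAtPlace_apply_of_isReal w.2]; exact h w
    · rw [← normAtPlace_apply_of_isComplex w.2]; exact h w

lemma mem_span_real_of_span_rat {ι : Type*} (v : ι → K) (hv : Submodule.span ℚ (Set.range v) = ⊤) :
    Submodule.span ℝ (Set.range fun i ↦ mixedEmbedding K (v i)) = ⊤ := by
  rw [← top_le_iff, ← (mixedEmbedding.latticeBasis K).span_eq, Submodule.span_le]
  rintro _ ⟨i, rfl⟩
  rw [mixedEmbedding.latticeBasis_apply]
  have h : integralBasis K i ∈ Submodule.span ℚ (Set.range v) := hv ▸ trivial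
  refine Submodule.span_induction (p := fun x _ ↦ mixedEmbedding K x ∈
    Submodule.span ℝ (Set.range fun i ↦ mixedEmbedding K (v i))) ?_ ?_ ?_ ?_ h
  · rintro _ ⟨j, rfl⟩
    exact Submodule.subset_span ⟨j, rfl⟩
  · simp
  · intro x y _ _ hx hy
    rw [map_add]; exact Submodule.add_mem _ hx hy
  · intro q x _ hx
    have : mixedEmbedding K (q • x) = (q : ℝ) • mixedEmbedding K x := by
      rw [map_rat_smul (mixedEmbedding K), Rat.cast_smul_eq_qsmul ℝ]
    rw [this]
    exact Submodule.smul_mem _ _ hx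

lemma span_powers {α θ : K} (hα : α ≠ 0) (hθ : IntermediateField.adjoin ℚ {θ} = ⊤) :
    Submodule.span ℚ (Set.range fun i : Fin (finrank ℚ K) ↦ α * θ ^ (i : ℕ)) = ⊤ := by
  have h_int : IsIntegral ℚ θ := Algebra.IsIntegral.isIntegral θ
  have hdeg : (minpoly ℚ θ).natDegree = finrank ℚ K := by
    rw [← IntermediateField.adjoin.finrank h_int, hθ, IntermediateField.finrank_top']
  have hind : LinearIndependent ℚ fun i : Fin (minpoly ℚ θ).natDegree ↦ θ ^ (i : ℕ) :=
    linearIndependent_pow θ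
  have hind2 : LinearIndependent ℚ fun i : Fin (finrank ℚ K) ↦ α * θ ^ (i : ℕ) := by
    rw [← hdeg]
    exact hind.map' (LinearMap.mulLeft ℚ α)
      (LinearMap.ker_eq_bot.2 (mul_right_injective₀ hα))
  exact hind2.span_eq_top_of_card_eq_finrank' (by simp)

lemma exists_lattice_approx {I : Ideal (𝓞 K)} {α θ : 𝓞 K} (hαI : α ∈ I) (hα : α ≠ 0)
    (hθ : IntermediateField.adjoin ℚ {(θ : K)} = ⊤) {T : ℝ} (hT1 : 1 ≤ T)
    (hT : ∀ w : InfinitePlace K, w (θ : K) ≤ T) (z : mixedSpace K) :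
    ∃ u ∈ I, ∀ w, normAtPlace w (z - mixedEmbedding K (u : K)) ≤
      finrank ℚ K * T ^ finrank ℚ K * w (α : K) := by
  have hspan := mem_span_real_of_span_rat _ (span_powers (α := (α : K)) (by simpa using hα) hθ)
  have hz : z ∈ Submodule.span ℝ (Set.range fun i : Fin (finrank ℚ K) ↦
      mixedEmbedding K ((α : K) * (θ : K) ^ (i : ℕ))) := hspan ▸ trivial
  obtain ⟨c, hc⟩ := (Submodule.mem_span_range_iff_exists_fun ℝ).1 hz
  refine ⟨∑ i : Fin (finrank ℚ K), (⌊c i⌋ : 𝓞 K) * (α * θ ^ (i : ℕ)), ?_, fun w ↦ ?_⟩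
  · exact Ideal.sum_mem _ fun i _ ↦ Ideal.mul_mem_left _ _ (Ideal.mul_mem_right _ _ hαI)
  · have h1 : z - mixedEmbedding K ((∑ i : Fin (finrank ℚ K),
        (⌊c i⌋ : 𝓞 K) * (α * θ ^ (i : ℕ)) : 𝓞 K) : K) =
        ∑ i, Int.fract (c i) • mixedEmbedding K ((α : K) * (θ : K) ^ (i : ℕ)) := by
      rw [← hc]
      have : ∀ i : Fin (finrank ℚ K), mixedEmbedding K (((⌊c i⌋ : 𝓞 K) : K) *
          ((α : K) * (θ : K) ^ (i : ℕ))) =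
          (⌊c i⌋ : ℝ) • mixedEmbedding K ((α : K) * (θ : K) ^ (i : ℕ)) := by
        intro i
        rw [map_mul, Int.cast_smul_eq_zsmul, zsmul_eq_mul]
        simp
      simp only [map_sum, map_mul, map_pow] at this ⊢
      rw [← Finset.sum_sub_distrib]
      refine Finset.sum_congr rfl fun i _ ↦ ?_
      rw [this, ← sub_smul]; rfl
    rw [h1]
    have hsum : ∀ (s : Finset (Fin (finrank ℚ K))) (g : Fin (finrank ℚ K) → mixedSpace K),
        normAtPlace w (∑ i ∈ s, g i) ≤ ∑ i ∈ s, normAtPlace w (g i) := by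
      intro s g
      induction s using Finset.induction_on with
      | empty => simp
      | insert a s ha ih =>
        rw [Finset.sum_insert ha, Finset.sum_insert ha]
        exact (normAtPlace_add_le _ _ _).trans (by gcongr)
    refine (hsum _ _).trans ?_
    calc _ ≤ ∑ i : Fin (finrank ℚ K), T ^ finrank ℚ K * w (α : K) := by
          refine Finset.sum_le_sum fun i _ ↦ ?_
          rw [normAtPlace_smul, normAtPlace_apply, map_mul, map_pow,
            abs_of_nonneg (Int.fract_nonneg _)]
          have h2 : w (θ : K) ^ (i : ℕ) ≤ T ^ finrank ℚ K :=
            (pow_le_pow_left₀ (apply_nonneg _ _) (hT w) _).trans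
              (pow_le_pow_right₀ hT1 i.2.le)
          have h3 : 0 ≤ w (α : K) * w (θ : K) ^ (i : ℕ) := by positivity
          calc _ ≤ 1 * (w (α : K) * w (θ : K) ^ (i : ℕ)) := by
                gcongr; exact (Int.fract_lt_one _).le
            _ ≤ _ := by rw [one_mul, mul_comm]; gcongr
      _ = _ := by simp [mul_assoc]

end LatticeCount

section Bounds

open scoped Classical

variable (K : Type*) [Field K] [NumberField K]

/-- The absolute discriminant as a real number. -/
noncomputable def absDisc : ℝ := |(discr K : ℝ)|

lemma one_le_absDisc : 1 ≤ absDisc K := by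
  unfold absDisc
  exact_mod_cast Int.one_le_abs (discr_ne_zero K)

lemma absDisc_pos : 0 < absDisc K := one_pos.trans_le (one_le_absDisc K)

variable {K}

lemma covolume_frac (J : (Ideal (𝓞 K))⁰) :
    volume (ZSpan.fundamentalDomain (fractionalIdealLatticeBasis K (FractionalIdeal.mk0 K J))) =
      ENNReal.ofReal (Ideal.absNorm (J : Ideal (𝓞 K)) * (2⁻¹) ^ nrComplexPlaces K *
        √(absDisc K)) := by
  rw [volume_fundamentalDomain_fractionalIdealLatticeBasis,
    volume_fundamentalDomain_latticeBasis, FractionalIdeal.coe_mk0,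
    FractionalIdeal.coeIdeal_absNorm, Rat.cast_natCast, mul_assoc,
    ENNReal.ofReal_mul (Nat.cast_nonneg _), ENNReal.ofReal_mul (by positivity)]
  congr 2
  · rw [ENNReal.ofReal_pow (by norm_num), ENNReal.ofReal_inv_of_pos (by norm_num)]
    norm_num
  · rw [← ENNReal.ofReal_coe_nnreal]
    congr 1
    rw [Real.coe_sqrt, coe_nnnorm, Int.norm_eq_abs]; rfl

lemma covol_le (J : (Ideal (𝓞 K))⁰) :
    (Ideal.absNorm (J : Ideal (𝓞 K)) * (2⁻¹) ^ nrComplexPlaces K * √(absDisc K)) ≤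
      Ideal.absNorm (J : Ideal (𝓞 K)) * absDisc K := by
  have h1 := one_le_absDisc K
  have h2 : √(absDisc K) ≤ absDisc K := by
    rw [Real.sqrt_le_left (by linarith)]; nlinarith
  have h3 : ((2 : ℝ)⁻¹) ^ nrComplexPlaces K ≤ 1 := pow_le_one₀ (by norm_num) (by norm_num)
  calc _ ≤ Ideal.absNorm (J : Ideal (𝓞 K)) * (1 : ℝ) * absDisc K := by gcongr
    _ = _ := by ring

lemma absNorm_real_pos (J : (Ideal (𝓞 K))⁰) : (0 : ℝ) < Ideal.absNorm (J : Ideal (𝓞 K)) := by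
  exact_mod_cast Ideal.absNorm_pos_of_nonZeroDivisors J

lemma minkowskiBound_lt (J : (Ideal (𝓞 K))⁰) :
    minkowskiBound K (FractionalIdeal.mk0 K J) <
      ENNReal.ofReal (Ideal.absNorm (J : Ideal (𝓞 K)) * 3 ^ finrank ℚ K * absDisc K) := by
  have h0 := absNorm_real_pos J
  have h1 := absDisc_pos K
  rw [minkowskiBound, covolume_frac, mixedEmbedding.finrank,
    show (2 : ℝ≥0∞) = ENNReal.ofReal 2 by norm_num, ← ENNReal.ofReal_pow (by norm_num),
    ← ENNReal.ofReal_mul (by positivity)]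
  rw [ENNReal.ofReal_lt_ofReal_iff (by positivity)]
  calc _ ≤ Ideal.absNorm (J : Ideal (𝓞 K)) * absDisc K * 2 ^ finrank ℚ K := by
        exact mul_le_mul_of_nonneg_right (covol_le J) (by positivity)
    _ < Ideal.absNorm (J : Ideal (𝓞 K)) * absDisc K * 3 ^ finrank ℚ K := by
        gcongr
        · exact (finrank_pos (R := ℚ) (M := K)).ne'
        · norm_num
    _ = _ := by ring

lemma exists_bounded_primitive_element :
    ∃ θ : 𝓞 K, IntermediateField.adjoin ℚ {(θ : K)} = ⊤ ∧
      ∀ w : InfinitePlace K, w (θ : K) ≤ 4 ^ finrank ℚ K * absDisc K := by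
  have hD := one_le_absDisc K
  set B : ℝ≥0 := Real.toNNReal (3 ^ finrank ℚ K * absDisc K) with hBdef
  have hBr : (B : ℝ) = 3 ^ finrank ℚ K * absDisc K := Real.coe_toNNReal _ (by positivity)
  have hm : minkowskiBound K ↑(1 : (FractionalIdeal (𝓞 K)⁰ K)ˣ) < (B : ℝ≥0∞) := by
    have := minkowskiBound_lt (K := K) 1
    have h1 : FractionalIdeal.mk0 K (1 : (Ideal (𝓞 K))⁰) = 1 := map_one _
    rw [h1] at this
    simpa [hBdef, ENNReal.ofReal] using this
  have hB4 : (1 : ℝ) + B ≤ 4 ^ finrank ℚ K * absDisc K := by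
    rw [hBr]
    have : (1 : ℝ) + 3 ^ finrank ℚ K ≤ 4 ^ finrank ℚ K := by
      have hn : finrank ℚ K ≠ 0 := (finrank_pos (R := ℚ) (M := K)).ne'
      have := pow_lt_pow_left₀ (show (3 : ℕ) < 4 by norm_num) (by norm_num) hn
      have h' : 1 + 3 ^ finrank ℚ K ≤ 4 ^ finrank ℚ K := by omega
      exact_mod_cast h'
    nlinarith
  obtain ⟨w⟩ := (inferInstance : Nonempty (InfinitePlace K))
  rcases isReal_or_isComplex w with hw | hw
  · have : minkowskiBound K ↑(1 : (FractionalIdeal (𝓞 K)⁰ K)ˣ) < convexBodyLTFactor K * B :=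
      hm.trans_le (le_mul_of_one_le_left zero_le
        (by exact_mod_cast one_le_convexBodyLTFactor K))
    obtain ⟨θ, h1, h2⟩ := exists_primitive_element_lt_of_isReal K hw this
    refine ⟨θ, h1, fun v ↦ (h2 v).le.trans (le_trans ?_ hB4)⟩
    rw [NNReal.coe_max, NNReal.coe_one]
    have := B.2
    exact max_le (by linarith) (by linarith [NNReal.coe_nonneg B])
  · have : minkowskiBound K ↑(1 : (FractionalIdeal (𝓞 K)⁰ K)ˣ) < convexBodyLT'Factor K * B :=
      hm.trans_le (le_mul_of_one_le_left zero_le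
        (by exact_mod_cast one_le_convexBodyLT'Factor K))
    obtain ⟨θ, h1, h2⟩ := exists_primitive_element_lt_of_isComplex K hw this
    refine ⟨θ, h1, fun v ↦ (h2 v).le.trans (le_trans ?_ hB4)⟩
    rw [Real.sqrt_le_left (by positivity)]
    nlinarith [B.2]

lemma prod_exp_pow_mult (c : ℝ) (t : InfinitePlace K → ℝ) :
    ∏ w, (c * Real.exp (t w)) ^ mult w = c ^ finrank ℚ K * Real.exp (∑ w, mult w * t w) := by
  simp_rw [mul_pow, Finset.prod_mul_distrib, Finset.prod_pow_eq_pow_sum, sum_mult_eq,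
    Real.exp_sum, ← Real.exp_nat_mul]

/-- The radii `c * exp (t w)`. -/
noncomputable def boxRadius (c : ℝ) (t : InfinitePlace K → ℝ) : InfinitePlace K → ℝ≥0 :=
  fun w ↦ Real.toNNReal (c * Real.exp (t w))

lemma coe_boxRadius {c : ℝ} (hc : 0 ≤ c) (t : InfinitePlace K → ℝ) (w : InfinitePlace K) :
    (boxRadius c t w : ℝ) = c * Real.exp (t w) := Real.coe_toNNReal _ (by positivity)

lemma volume_box {c : ℝ} (hc : 0 ≤ c) (t : InfinitePlace K → ℝ) :
    volume (convexBodyLT K (boxRadius c t)) =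
      ENNReal.ofReal (convexBodyLTFactor K * c ^ finrank ℚ K *
        Real.exp (∑ w, mult w * t w)) := by
  rw [convexBodyLT_volume, mul_assoc, ← prod_exp_pow_mult, ENNReal.ofReal_mul (NNReal.coe_nonneg _),
    ENNReal.ofReal_coe_nnreal]
  congr 1
  rw [ENNReal.ofReal_prod_of_nonneg fun w _ ↦ by positivity]
  push_cast
  exact Finset.prod_congr rfl fun w _ ↦ by
    rw [ENNReal.ofReal_pow (by positivity)]; rfl

lemma measurableSet_box (f : InfinitePlace K → ℝ≥0) : MeasurableSet (convexBodyLT K f) := by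
  have : convexBodyLT K f = ⋂ w, {x | normAtPlace w x < f w} := by
    ext x; rw [mem_convexBodyLT_iff]; simp
  rw [this]
  exact MeasurableSet.iInter fun w ↦
    measurableSet_lt (continuous_normAtPlace w).measurable measurable_const

lemma exists_small_element (J : (Ideal (𝓞 K))⁰) {y : ℝ} {t : InfinitePlace K → ℝ}
    (ht : ∑ w, mult w * t w = y + Real.log (Ideal.absNorm (J : Ideal (𝓞 K)))) :
    ∃ α ∈ (J : Ideal (𝓞 K)), α ≠ 0 ∧ ∀ w : InfinitePlace K, w (α : K) <
      3 * absDisc K * Real.exp (-y / finrank ℚ K) * Real.exp (t w) := by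
  have hD := one_le_absDisc K
  have hn : (finrank ℚ K : ℝ) ≠ 0 := by exact_mod_cast (finrank_pos (R := ℚ) (M := K)).ne'
  have hc : 0 ≤ 3 * absDisc K * Real.exp (-y / finrank ℚ K) := by positivity
  have h0 := absNorm_real_pos J
  have h : minkowskiBound K (FractionalIdeal.mk0 K J) < volume (convexBodyLT K
      (boxRadius (3 * absDisc K * Real.exp (-y / finrank ℚ K)) t)) := by
    refine (minkowskiBound_lt J).trans_le ?_
    rw [volume_box hc, ht, Real.exp_add, Real.exp_log h0, mul_pow, mul_pow, ← Real.exp_nat_mul]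
    refine ENNReal.ofReal_le_ofReal ?_
    have e : (finrank ℚ K : ℝ) * (-y / finrank ℚ K) = -y := by field_simp
    rw [e]
    have h1 : (1 : ℝ) ≤ convexBodyLTFactor K := by exact_mod_cast one_le_convexBodyLTFactor K
    have h2 : absDisc K ≤ absDisc K ^ finrank ℚ K :=
      le_self_pow₀ hD (finrank_pos (R := ℚ) (M := K)).ne'
    calc _ = 1 * (3 ^ finrank ℚ K * absDisc K * 1) * (1 * Ideal.absNorm (J : Ideal (𝓞 K))) :=
          by ring
      _ ≤ convexBodyLTFactor K * (3 ^ finrank ℚ K * absDisc K ^ finrank ℚ K * 1) *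
        (1 * Ideal.absNorm (J : Ideal (𝓞 K))) := by gcongr
      _ = convexBodyLTFactor K * (3 ^ finrank ℚ K * absDisc K ^ finrank ℚ K * 1) *
        ((Real.exp (-y) * Real.exp y) * Ideal.absNorm (J : Ideal (𝓞 K))) := by
          rw [← Real.exp_add]; simp
      _ = _ := by ring
  obtain ⟨a, ha, ha0, hlt⟩ := exists_ne_zero_mem_ideal_lt K _ h
  rw [FractionalIdeal.coe_mk0, FractionalIdeal.mem_coeIdeal] at ha
  obtain ⟨α, hα, rfl⟩ := ha
  refine ⟨α, hα, by simpa using ha0, fun w ↦ ?_⟩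
  have := hlt w
  rwa [coe_boxRadius hc] at this

end Bounds

section Fibre

open scoped Classical

variable {K : Type*} [Field K] [NumberField K]

/-- Number of nonzero elements of `J` in the box of radii `exp (t w)`. -/
noncomputable def boxCount (J : (Ideal (𝓞 K))⁰) (t : InfinitePlace K → ℝ) : ℝ≥0∞ :=
  ∑' x : {x : 𝓞 K // x ∈ (J : Ideal (𝓞 K)) ∧ x ≠ 0},
    if ∀ w : InfinitePlace K, w (x.1 : K) ≤ Real.exp (t w) then 1 else 0

instance countable_idealLattice (J : (Ideal (𝓞 K))⁰) :
    Countable (mixedEmbedding.idealLattice K (FractionalIdeal.mk0 K J)) := by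
  have : Function.Surjective (fun x : {x : 𝓞 K // x ∈ (J : Ideal (𝓞 K))} ↦
      (⟨mixedEmbedding K (x.1 : K), (mem_idealLattice K _).2 ⟨x.1, by simp, rfl⟩⟩ :
        mixedEmbedding.idealLattice K (FractionalIdeal.mk0 K J))) := by
    rintro ⟨_, h⟩
    obtain ⟨y, hy, rfl⟩ := (mem_idealLattice K _).1 h
    rw [FractionalIdeal.coe_mk0, SetLike.mem_coe, FractionalIdeal.mem_coeIdeal] at hy
    obtain ⟨x, hx, rfl⟩ := hy
    exact ⟨⟨x, hx⟩, rfl⟩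
  exact this.countable

lemma tsum_idealLattice (J : (Ideal (𝓞 K))⁰) (t : InfinitePlace K → ℝ) :
    ∑' v : mixedEmbedding.idealLattice K (FractionalIdeal.mk0 K J),
      {x : mixedSpace K | ∀ w, normAtPlace w x ≤ Real.exp (t w)}.indicator
        (1 : mixedSpace K → ℝ≥0∞) v = 1 + boxCount J t := by
  let φ : {x : 𝓞 K // x ∈ (J : Ideal (𝓞 K))} →
      mixedEmbedding.idealLattice K (FractionalIdeal.mk0 K J) :=
    fun x ↦ ⟨mixedEmbedding K (x.1 : K), (mem_idealLattice K _).2 ⟨x.1, by simp, rfl⟩⟩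
  have hφ : Function.Bijective φ := by
    constructor
    · intro x y h
      have := congr_arg Subtype.val h
      exact Subtype.ext (RingOfIntegers.coe_injective (mixedEmbedding_injective K this))
    · rintro ⟨_, h⟩
      obtain ⟨y, hy, rfl⟩ := (mem_idealLattice K _).1 h
      rw [FractionalIdeal.coe_mk0, SetLike.mem_coe, FractionalIdeal.mem_coeIdeal] at hy
      obtain ⟨x, hx, rfl⟩ := hy
      exact ⟨⟨x, hx⟩, rfl⟩
  rw [← (Equiv.ofBijective φ hφ).tsum_eq]
  set f : 𝓞 K → ℝ≥0∞ := fun x ↦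
    if ∀ w : InfinitePlace K, w (x : K) ≤ Real.exp (t w) then 1 else 0 with hf
  have h1 : ∀ x : {x : 𝓞 K // x ∈ (J : Ideal (𝓞 K))}, {x : mixedSpace K | ∀ w, normAtPlace w x ≤
      Real.exp (t w)}.indicator (1 : mixedSpace K → ℝ≥0∞)
        (Equiv.ofBijective φ hφ x : mixedSpace K) = f x := by
    intro x
    simp only [Equiv.ofBijective_apply, φ, Set.indicator_apply, Set.mem_ofPred_eq,
      normAtPlace_apply, hf, Pi.one_apply]
  rw [tsum_congr h1, boxCount]
  have h2 := tsum_subtype {x : 𝓞 K | x ∈ (J : Ideal (𝓞 K))} f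
  have h3 := tsum_subtype {x : 𝓞 K | x ∈ (J : Ideal (𝓞 K)) ∧ x ≠ 0} f
  change ∑' x : {x : 𝓞 K | x ∈ (J : Ideal (𝓞 K))}, f x =
    1 + ∑' x : {x : 𝓞 K | x ∈ (J : Ideal (𝓞 K)) ∧ x ≠ 0}, f x
  rw [h2, h3, ENNReal.tsum_eq_add_tsum_ite 0]
  congr 1
  · simp [hf, Real.exp_nonneg]
  · refine tsum_congr fun x ↦ ?_
    by_cases hx : x = 0 <;> simp [Set.indicator_apply, hx]

/-- The leading constant of the lattice point count. -/
noncomputable def boxConst (K : Type*) [Field K] [NumberField K] : ℝ :=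
  convexBodyLTFactor K * 2 ^ nrComplexPlaces K / √(absDisc K)

/-- The relative diameter of a fundamental cell, normalised. -/
noncomputable def cellConst (K : Type*) [Field K] [NumberField K] : ℝ :=
  finrank ℚ K * (4 ^ finrank ℚ K * absDisc K) ^ finrank ℚ K * (3 * absDisc K)

lemma boxConst_pos : 0 < boxConst K := by
  have := absDisc_pos K
  have h1 : (1 : ℝ) ≤ convexBodyLTFactor K := by exact_mod_cast one_le_convexBodyLTFactor K
  unfold boxConst; positivity

lemma one_le_boxConst_mul : 1 ≤ boxConst K * absDisc K := by
  have h0 := one_le_absDisc K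
  have h1 : (1 : ℝ) ≤ convexBodyLTFactor K := by exact_mod_cast one_le_convexBodyLTFactor K
  have h2 : √(absDisc K) ≤ absDisc K := by
    rw [Real.sqrt_le_left (by linarith)]; nlinarith
  have h3 : (1 : ℝ) ≤ 2 ^ nrComplexPlaces K := one_le_pow₀ (by norm_num)
  unfold boxConst
  rw [div_mul_eq_mul_div, one_le_div (by positivity)]
  calc √(absDisc K) ≤ 1 * 1 * absDisc K := by linarith
    _ ≤ _ := by gcongr

lemma one_le_finrank_real : (1 : ℝ) ≤ finrank ℚ K := by
  exact_mod_cast (finrank_pos (R := ℚ) (M := K))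

lemma absDisc_le_cellConst : absDisc K ≤ cellConst K := by
  have h0 := one_le_absDisc K
  have h1 : (1 : ℝ) ≤ (4 ^ finrank ℚ K * absDisc K) ^ finrank ℚ K :=
    one_le_pow₀ (one_le_mul_of_one_le_of_one_le (one_le_pow₀ (by norm_num)) h0)
  have h2 := one_le_finrank_real (K := K)
  unfold cellConst
  calc absDisc K ≤ 1 * 1 * (3 * absDisc K) := by linarith
    _ ≤ _ := by gcongr

lemma exists_cell_approx (J : (Ideal (𝓞 K))⁰) {y : ℝ} {t : InfinitePlace K → ℝ}
    (ht : ∑ w, mult w * t w = y + Real.log (Ideal.absNorm (J : Ideal (𝓞 K))))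
    (z : mixedSpace K) :
    ∃ u ∈ mixedEmbedding.idealLattice K (FractionalIdeal.mk0 K J), ∀ w, normAtPlace w (z - u) <
      cellConst K * Real.exp (-y / finrank ℚ K) * Real.exp (t w) := by
  obtain ⟨θ, hθ, hθT⟩ := exists_bounded_primitive_element (K := K)
  obtain ⟨α, hα, hα0, hαlt⟩ := exists_small_element J ht
  have h0 := one_le_absDisc K
  have hT : 1 ≤ 4 ^ finrank ℚ K * absDisc K :=
    one_le_mul_of_one_le_of_one_le (one_le_pow₀ (by norm_num)) h0
  obtain ⟨u, hu, h⟩ := exists_lattice_approx hα hα0 hθ hT hθT z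
  refine ⟨mixedEmbedding K (u : K), (mem_idealLattice K _).2 ⟨u, ?_, rfl⟩, fun w ↦ ?_⟩
  · rw [FractionalIdeal.coe_mk0, SetLike.mem_coe, FractionalIdeal.mem_coeIdeal]
    exact ⟨u, hu, rfl⟩
  · refine (h w).trans_lt ?_
    have hn := one_le_finrank_real (K := K)
    calc _ < finrank ℚ K * (4 ^ finrank ℚ K * absDisc K) ^ finrank ℚ K *
          (3 * absDisc K * Real.exp (-y / finrank ℚ K) * Real.exp (t w)) :=
          mul_lt_mul_of_pos_left (hαlt w) (by positivity)
      _ = _ := by unfold cellConst; ring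

lemma volume_box_eq (J : (Ideal (𝓞 K))⁰) {y : ℝ} {t : InfinitePlace K → ℝ}
    (ht : ∑ w, mult w * t w = y + Real.log (Ideal.absNorm (J : Ideal (𝓞 K)))) {c : ℝ}
    (hc : 0 ≤ c) :
    volume (convexBodyLT K (boxRadius c t)) =
      volume (ZSpan.fundamentalDomain (fractionalIdealLatticeBasis K (FractionalIdeal.mk0 K J))) *
        ENNReal.ofReal (boxConst K * c ^ finrank ℚ K * Real.exp y) := by
  have h0 := absNorm_real_pos J
  have h1 := absDisc_pos K
  rw [volume_box hc, covolume_frac, ← ENNReal.ofReal_mul (by positivity), ht, Real.exp_add,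
    Real.exp_log h0]
  congr 1
  unfold boxConst
  have : √(absDisc K) ≠ 0 := by positivity
  rw [inv_pow]
  field_simp

lemma covolume_ne_zero (J : (Ideal (𝓞 K))⁰) :
    volume (ZSpan.fundamentalDomain
      (fractionalIdealLatticeBasis K (FractionalIdeal.mk0 K J))) ≠ 0 := by
  have h0 := absNorm_real_pos J
  have h1 := absDisc_pos K
  rw [covolume_frac]
  simp only [ne_eq, ENNReal.ofReal_eq_zero, not_le]
  positivity

lemma covolume_ne_top (J : (Ideal (𝓞 K))⁰) :
    volume (ZSpan.fundamentalDomain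
      (fractionalIdealLatticeBasis K (FractionalIdeal.mk0 K J))) ≠ ∞ := by
  rw [covolume_frac]; exact ENNReal.ofReal_ne_top

lemma one_add_boxCount_le (J : (Ideal (𝓞 K))⁰) {y : ℝ} {t : InfinitePlace K → ℝ}
    (ht : ∑ w, mult w * t w = y + Real.log (Ideal.absNorm (J : Ideal (𝓞 K)))) :
    1 + boxCount J t ≤ ENNReal.ofReal (boxConst K *
      (1 + cellConst K * Real.exp (-y / finrank ℚ K)) ^ finrank ℚ K * Real.exp y) := by
  have hH : 0 ≤ cellConst K := (absDisc_pos K).le.trans absDisc_le_cellConst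
  have hc : 0 ≤ 1 + cellConst K * Real.exp (-y / finrank ℚ K) := by positivity
  rw [← ENNReal.mul_le_mul_iff_right (covolume_ne_zero J) (covolume_ne_top J),
    ← volume_box_eq J ht hc, ← tsum_idealLattice]
  refine measure_mul_count_le (fundamentalDomain_idealLattice K _) (measurableSet_box _) fun z ↦ ?_
  obtain ⟨u, hu, h⟩ := exists_cell_approx J ht z
  refine ⟨u, hu, fun x hx ↦ ?_⟩
  rw [mem_convexBodyLT_iff]
  intro w
  rw [coe_boxRadius hc]
  calc _ ≤ normAtPlace w x + normAtPlace w (z - u) := normAtPlace_add_le w _ _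
    _ < Real.exp (t w) + cellConst K * Real.exp (-y / finrank ℚ K) * Real.exp (t w) :=
      add_lt_add_of_le_of_lt (hx w) (h w)
    _ = _ := by ring

lemma le_one_add_boxCount (J : (Ideal (𝓞 K))⁰) {y : ℝ} {t : InfinitePlace K → ℝ}
    (ht : ∑ w, mult w * t w = y + Real.log (Ideal.absNorm (J : Ideal (𝓞 K)))) :
    ENNReal.ofReal (boxConst K *
      (max 0 (1 - cellConst K * Real.exp (-y / finrank ℚ K))) ^ finrank ℚ K * Real.exp y) ≤
      1 + boxCount J t := by
  set c := max 0 (1 - cellConst K * Real.exp (-y / finrank ℚ K)) with hcdef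
  have hc : 0 ≤ c := le_max_left _ _
  rw [← ENNReal.mul_le_mul_iff_right (covolume_ne_zero J) (covolume_ne_top J),
    ← volume_box_eq J ht hc, ← tsum_idealLattice]
  refine measure_le_mul_count (fundamentalDomain_idealLattice K _) (measurableSet_box _) fun z ↦ ?_
  obtain ⟨u, hu, h⟩ := exists_cell_approx J ht z
  refine ⟨u, hu, fun x hx w ↦ ?_⟩
  rw [mem_convexBodyLT_iff] at hx
  have hxw := hx w
  rw [coe_boxRadius hc] at hxw
  have hcpos : 0 < c := by
    by_contra hneg
    have : c = 0 := le_antisymm (not_lt.1 hneg) hc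
    rw [this, zero_mul] at hxw
    exact absurd hxw (not_lt.2 (normAtPlace_nonneg w _))
  have hceq : c = 1 - cellConst K * Real.exp (-y / finrank ℚ K) := by
    rcases max_choice 0 (1 - cellConst K * Real.exp (-y / finrank ℚ K)) with h' | h'
    · rw [hcdef, h'] at hcpos; exact absurd hcpos (lt_irrefl _)
    · exact h'
  calc normAtPlace w x = normAtPlace w ((x + (z - u)) + -(z - u)) := by congr 1; abel
    _ ≤ normAtPlace w (x + (z - u)) + normAtPlace w (-(z - u)) := normAtPlace_add_le w _ _
    _ = normAtPlace w (x + (z - u)) + normAtPlace w (z - u) := by rw [normAtPlace_neg]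
    _ ≤ c * Real.exp (t w) +
        cellConst K * Real.exp (-y / finrank ℚ K) * Real.exp (t w) := by
      exact add_le_add hxw.le (h w).le
    _ = _ := by rw [hceq]; ring

/-- The relative error constant. -/
noncomputable def errConst (K : Type*) [Field K] [NumberField K] : ℝ :=
  2 * (1 + cellConst K) ^ finrank ℚ K

lemma one_add_mul_pow_le {H s : ℝ} (hH : 0 ≤ H) (hs0 : 0 ≤ s) (hs1 : s ≤ 1) (n : ℕ) :
    (1 + H * s) ^ n ≤ 1 + s * (1 + H) ^ n := by
  have h1 : (1 : ℝ) ∈ Set.Ici (0 : ℝ) := Set.mem_Ici.2 zero_le_one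
  have h2 : 1 + H ∈ Set.Ici (0 : ℝ) := Set.mem_Ici.2 (by linarith)
  have := (convexOn_pow (𝕜 := ℝ) n).2 h1 h2 (sub_nonneg.2 hs1) hs0 (by ring)
  simp only [smul_eq_mul, one_pow] at this
  calc _ = ((1 - s) * 1 + s * (1 + H)) ^ n := by ring
    _ ≤ _ := this
    _ ≤ _ := by linarith

lemma boxCount_le (J : (Ideal (𝓞 K))⁰) {y : ℝ} (hy : 0 ≤ y) {t : InfinitePlace K → ℝ}
    (ht : ∑ w, mult w * t w = y + Real.log (Ideal.absNorm (J : Ideal (𝓞 K)))) :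
    boxCount J t ≤ ENNReal.ofReal (boxConst K *
      (Real.exp y + errConst K * Real.exp ((1 - 1 / finrank ℚ K) * y))) := by
  refine le_add_self.trans ((one_add_boxCount_le J ht).trans (ENNReal.ofReal_le_ofReal ?_))
  have hH : 0 ≤ cellConst K := (absDisc_pos K).le.trans absDisc_le_cellConst
  have hn := one_le_finrank_real (K := K)
  have hs1 : Real.exp (-y / finrank ℚ K) ≤ 1 := by
    rw [Real.exp_le_one_iff]; exact div_nonpos_of_nonpos_of_nonneg (by linarith) (by linarith)
  have h1 := one_add_mul_pow_le hH (Real.exp_nonneg (-y / finrank ℚ K)) hs1 (finrank ℚ K)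
  have h2 : Real.exp ((1 - 1 / finrank ℚ K) * y) =
      Real.exp (-y / finrank ℚ K) * Real.exp y := by
    rw [← Real.exp_add]; congr 1; field_simp; ring
  rw [h2, mul_assoc]
  refine mul_le_mul_of_nonneg_left ?_ boxConst_pos.le
  unfold errConst
  calc _ ≤ (1 + Real.exp (-y / finrank ℚ K) * (1 + cellConst K) ^ finrank ℚ K) * Real.exp y := by
        gcongr
    _ ≤ (1 + 2 * (Real.exp (-y / finrank ℚ K) * (1 + cellConst K) ^ finrank ℚ K)) *
        Real.exp y := by
        have : 0 ≤ Real.exp (-y / finrank ℚ K) * (1 + cellConst K) ^ finrank ℚ K := by positivity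
        exact mul_le_mul_of_nonneg_right (by linarith) (Real.exp_nonneg _)
    _ = _ := by ring

lemma le_boxCount (J : (Ideal (𝓞 K))⁰) {y : ℝ} (hy : 0 ≤ y) {t : InfinitePlace K → ℝ}
    (ht : ∑ w, mult w * t w = y + Real.log (Ideal.absNorm (J : Ideal (𝓞 K)))) :
    ENNReal.ofReal (boxConst K *
      (Real.exp y - errConst K * Real.exp ((1 - 1 / finrank ℚ K) * y))) ≤ boxCount J t := by
  have hH : 0 ≤ cellConst K := (absDisc_pos K).le.trans absDisc_le_cellConst
  have hn := one_le_finrank_real (K := K)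
  have hb := boxConst_pos (K := K)
  have h3 := le_one_add_boxCount J ht
  rw [add_comm] at h3
  have h4 := tsub_le_iff_right.2 h3
  rw [← ENNReal.ofReal_one, ← ENNReal.ofReal_sub _ zero_le_one] at h4
  refine (ENNReal.ofReal_le_ofReal ?_).trans h4
  set s := Real.exp (-y / finrank ℚ K) with hs
  have hs0 : 0 < s := Real.exp_pos _
  have h2 : Real.exp ((1 - 1 / finrank ℚ K) * y) = s * Real.exp y := by
    rw [hs, ← Real.exp_add]; congr 1; field_simp; ring
  have hexp : 1 ≤ s * Real.exp y := by
    rw [← h2]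
    refine Real.one_le_exp (mul_nonneg ?_ hy)
    rw [sub_nonneg, div_le_one (by linarith)]; exact hn
  have hB : 1 - finrank ℚ K * (cellConst K * s) ≤
      (max 0 (1 - cellConst K * s)) ^ finrank ℚ K := by
    rcases le_total (cellConst K * s) 1 with h | h
    · rw [max_eq_right (by linarith)]
      have := one_add_mul_le_pow (a := -(cellConst K * s)) (by linarith) (finrank ℚ K)
      calc _ = 1 + finrank ℚ K * -(cellConst K * s) := by ring
        _ ≤ _ := this
        _ = _ := by ring
    · calc _ ≤ (0 : ℝ) := by nlinarith
        _ ≤ _ := by positivity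
  have hber : 1 + finrank ℚ K * cellConst K ≤ (1 + cellConst K) ^ finrank ℚ K :=
    one_add_mul_le_pow (by linarith) _
  have hD : absDisc K ≤ (1 + cellConst K) ^ finrank ℚ K := by
    have := absDisc_le_cellConst (K := K)
    nlinarith
  rw [h2]
  calc boxConst K * (Real.exp y - errConst K * (s * Real.exp y))
      ≤ boxConst K * (Real.exp y - (finrank ℚ K * cellConst K + absDisc K) * (s * Real.exp y)) := by
        gcongr
        unfold errConst; linarith
    _ = boxConst K * (1 - finrank ℚ K * (cellConst K * s)) * Real.exp y -
        (boxConst K * absDisc K) * (s * Real.exp y) := by ring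
    _ ≤ boxConst K * (max 0 (1 - cellConst K * s)) ^ finrank ℚ K * Real.exp y - 1 := by
        have := one_le_mul_of_one_le_of_one_le (one_le_boxConst_mul (K := K)) hexp
        gcongr

end Fibre

open scoped Pointwise

section IdealCount

open scoped Classical

/-- The truncated power `t ↦ t ^ r` on `[0, ∞)`. -/
noncomputable def truncPow (r : ℕ) (t : ℝ) : ℝ := if 0 ≤ t then t ^ r else 0

lemma truncPow_nonneg (r : ℕ) (t : ℝ) : 0 ≤ truncPow r t := by
  unfold truncPow; split_ifs <;> positivity

variable (K : Type*) [Field K] [NumberField K]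

/-- The smoothed ideal counting function. -/
noncomputable def idealSum (y : ℝ) : ℝ :=
  ∑' I : (Ideal (𝓞 K))⁰, truncPow (Units.rank K) (y - Real.log (Ideal.absNorm (I : Ideal (𝓞 K))))

lemma finite_support_truncPow (y : ℝ) :
    (Function.support fun I : (Ideal (𝓞 K))⁰ ↦
      truncPow (Units.rank K) (y - Real.log (Ideal.absNorm (I : Ideal (𝓞 K))))).Finite := by
  refine (Ideal.finite_setOfPred_absNorm_le₀ (S := 𝓞 K) ⌊Real.exp y⌋₊).subset fun I hI ↦ ?_
  rw [Function.mem_support, truncPow] at hI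
  have h : 0 ≤ y - Real.log (Ideal.absNorm (I : Ideal (𝓞 K))) := by
    by_contra h; exact hI (if_neg h)
  refine Nat.le_floor ?_
  rw [← Real.log_le_iff_le_exp (absNorm_real_pos I)]
  linarith

lemma summable_truncPow (y : ℝ) : Summable fun I : (Ideal (𝓞 K))⁰ ↦
    truncPow (Units.rank K) (y - Real.log (Ideal.absNorm (I : Ideal (𝓞 K)))) :=
  summable_of_hasFiniteSupport (finite_support_truncPow K y)

/-- The standard simplex in the logarithmic space, scaled by `y`. -/
def logSimplex (y : ℝ) : Set (logSpace K) := {l | ∀ w, 0 ≤ tau K y l w}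

variable {K}

lemma simplexVol_eq_volume (y : ℝ) : simplexVol K y = volume (logSimplex K y) := by
  have hm : MeasurableSet (logSimplex K y) := by
    have : logSimplex K y = ⋂ w, {l | 0 ≤ tau K y l w} := by
      ext; simp [logSimplex]
    rw [this]
    exact MeasurableSet.iInter fun w ↦ measurableSet_le measurable_const
      ((measurable_tau w).comp (measurable_const.prodMk measurable_id))
  rw [← lintegral_indicator_one hm, simplexVol]
  exact lintegral_congr fun l ↦ by simp only [simplexInd, Set.indicator_apply, logSimplex,
    Set.mem_ofPred_eq, Pi.one_apply]

lemma nonempty_interior_logSimplex : ∃ l : logSpace K, ∀ w, 0 < tau K 1 l w := by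
  have hn := one_le_finrank_real (K := K)
  refine ⟨logProj K fun _ ↦ (finrank ℚ K : ℝ)⁻¹, fun w ↦ ?_⟩
  have := tau_logProj (fun _ ↦ (finrank ℚ K : ℝ)⁻¹) w
  rw [← Finset.sum_mul, show ∑ w : InfinitePlace K, (mult w : ℝ) = finrank ℚ K by
    exact_mod_cast sum_mult_eq (K := K), mul_inv_cancel₀ (by linarith)] at this
  rw [this]
  positivity

lemma logSimplex_eq_smul {y : ℝ} (hy : 0 ≤ y) : logSimplex K y = y • logSimplex K 1 := by
  rcases hy.eq_or_lt with rfl | hy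
  · have hne : (logSimplex K 1).Nonempty :=
      nonempty_interior_logSimplex.imp fun l h w ↦ (h w).le
    rw [Set.zero_smul_set hne]
    ext l
    constructor
    · intro h
      have h1 := sum_mult_tau (K := K) 0 l
      have hmul : ∀ w ∈ Finset.univ, 0 ≤ (mult w : ℝ) * tau K 0 l w :=
        fun w _ ↦ mul_nonneg (Nat.cast_nonneg _) (h w)
      have h2 := (Finset.sum_eq_zero_iff_of_nonneg hmul).1 h1
      have : l = 0 := by
        funext w
        have h3 := h2 w.1 (Finset.mem_univ _)
        rw [mul_eq_zero, or_iff_right (mult_real_ne_zero _), tau, dif_neg w.2, zero_div,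
          zero_add, div_eq_zero_iff, or_iff_left (mult_real_ne_zero _)] at h3
        exact h3
      rw [this]; rfl
    · intro h w
      have : l = 0 := h
      subst this
      have := tau_smul (K := K) 0 0 0 w
      rw [zero_smul, zero_mul, zero_mul] at this
      rw [this]
  · ext l
    rw [Set.mem_smul_set_iff_inv_smul_mem₀ hy.ne']
    refine forall_congr' fun w ↦ ?_
    have := tau_smul y 1 (y⁻¹ • l) w
    rw [smul_inv_smul₀ hy.ne', mul_one] at this
    rw [this]
    exact mul_nonneg_iff_of_pos_left hy

lemma logSimplex_of_neg {y : ℝ} (hy : y < 0) : logSimplex K y = ∅ := by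
  ext l
  simp only [Set.mem_empty_iff_false, iff_false]
  intro h
  have h1 := sum_mult_tau (K := K) y l
  have : 0 ≤ ∑ w, (mult w : ℝ) * tau K y l w :=
    Finset.sum_nonneg fun w _ ↦ mul_nonneg (Nat.cast_nonneg _) (h w)
  linarith

lemma simplexVol_eq (y : ℝ) :
    simplexVol K y = simplexVol K 1 * ENNReal.ofReal (truncPow (Units.rank K) y) := by
  rw [simplexVol_eq_volume, simplexVol_eq_volume, truncPow]
  split_ifs with hy
  · rw [logSimplex_eq_smul hy, Measure.addHaar_smul, Units.finrank_eq_rank,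
      abs_of_nonneg (by positivity), mul_comm]
  · rw [logSimplex_of_neg (not_le.1 hy)]; simp

lemma simplexVol_one_ne_zero : simplexVol K 1 ≠ 0 := by
  obtain ⟨l, hl⟩ := nonempty_interior_logSimplex (K := K)
  rw [simplexVol_eq_volume]
  have hopen : IsOpen {l : logSpace K | ∀ w, 0 < tau K 1 l w} := by
    rw [Set.ofPred_forall]
    refine isOpen_iInter_of_finite fun w ↦ isOpen_lt continuous_const ?_
    unfold tau
    split_ifs <;> fun_prop
  have := hopen.measure_pos volume ⟨l, hl⟩
  exact (this.trans_le (measure_mono fun l h w ↦ (h w).le)).ne'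

lemma simplexVol_one_ne_top : simplexVol K 1 ≠ ∞ := by
  rw [simplexVol_eq_volume]
  refine (Bornology.IsBounded.measure_lt_top ?_).ne
  refine (Metric.isBounded_closedBall (x := (0 : logSpace K)) (r := 2)).subset fun l hl ↦ ?_
  rw [mem_closedBall_zero_iff, pi_norm_le_iff_of_nonneg (by norm_num)]
  intro w
  have hn := one_le_finrank_real (K := K)
  have hm2 : (mult w.1 : ℝ) ≤ 2 := by
    have : mult w.1 ≤ 2 := by unfold mult; split_ifs <;> norm_num
    exact_mod_cast this
  have hm0 : 0 < (mult w.1 : ℝ) := by exact_mod_cast mult_pos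
  have h1 := hl w.1
  have h2 : (mult w.1 : ℝ) * tau K 1 l w.1 ≤ 1 := by
    refine le_of_le_of_eq ?_ (sum_mult_tau (K := K) 1 l)
    exact Finset.single_le_sum (f := fun w ↦ (mult w : ℝ) * tau K 1 l w)
      (fun w _ ↦ mul_nonneg (Nat.cast_nonneg _) (hl w)) (Finset.mem_univ _)
  have h3 : (mult w.1 : ℝ) * tau K 1 l w.1 = mult w.1 * (1 / finrank ℚ K) + l w := by
    rw [tau, dif_neg w.2, mul_add, mul_div_cancel₀ _ hm0.ne']
  have h4 : 0 ≤ (mult w.1 : ℝ) * tau K 1 l w.1 := mul_nonneg hm0.le h1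
  have h5 : (mult w.1 : ℝ) * (1 / finrank ℚ K) ≤ 2 := by
    calc _ ≤ (2 : ℝ) * 1 := by
          gcongr
          rw [div_le_one (by linarith)]; exact hn
      _ = 2 := by norm_num
  have h6 : 0 ≤ (mult w.1 : ℝ) * (1 / finrank ℚ K) := by positivity
  rw [Real.norm_eq_abs, abs_le]
  constructor <;> linarith

lemma volume_unitDomain_ne_zero : volume (unitDomain K) ≠ 0 :=
  ZSpan.measure_fundamentalDomain_ne_zero _

lemma volume_unitDomain_ne_top : volume (unitDomain K) ≠ ∞ :=
  (ZSpan.fundamentalDomain_isBounded _).measure_lt_top.ne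

lemma lintegral_boxCount {J : (Ideal (𝓞 K))⁰} {c : ClassGroup (𝓞 K)}
    (hJ : ClassGroup.mk0 J = c⁻¹) (y : ℝ) :
    ∫⁻ l in unitDomain K, boxCount J (tau K (y + Real.log (Ideal.absNorm (J : Ideal (𝓞 K)))) l) =
      torsionOrder K * ∑' I : {I : (Ideal (𝓞 K))⁰ // ClassGroup.mk0 I = c},
        simplexVol K (y - Real.log (Ideal.absNorm (I.1 : Ideal (𝓞 K)))) := by
  rw [← lintegral_unitDomain_elements hJ]
  refine lintegral_congr fun l ↦ tsum_congr fun x ↦ ?_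
  rw [simplexInd]
  have hx : (x.1 : K) ≠ 0 := by simpa using x.2.2
  simp only [forall_le_exp_tau_iff hx]

lemma tsum_simplexVol_le {y : ℝ} (hy : 0 ≤ y) :
    torsionOrder K * ∑' I : (Ideal (𝓞 K))⁰,
      simplexVol K (y - Real.log (Ideal.absNorm (I : Ideal (𝓞 K)))) ≤
    classNumber K * (ENNReal.ofReal (boxConst K *
      (Real.exp y + errConst K * Real.exp ((1 - 1 / finrank ℚ K) * y))) * volume (unitDomain K)) := by
  rw [← (Equiv.sigmaFiberEquiv (ClassGroup.mk0 (R := 𝓞 K))).tsum_eq, ENNReal.tsum_sigma',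
    tsum_fintype, Finset.mul_sum, classNumber, ← Finset.card_univ, ← nsmul_eq_mul]
  refine Finset.sum_le_card_nsmul _ _ _ fun c _ ↦ ?_
  obtain ⟨J, hJ⟩ := ClassGroup.mk0_surjective (c⁻¹)
  refine (lintegral_boxCount hJ y).symm.trans_le ?_
  rw [← setLIntegral_const]
  exact lintegral_mono fun l ↦ boxCount_le J hy (sum_mult_tau _ _)

lemma le_tsum_simplexVol {y : ℝ} (hy : 0 ≤ y) :
    classNumber K * (ENNReal.ofReal (boxConst K *
      (Real.exp y - errConst K * Real.exp ((1 - 1 / finrank ℚ K) * y))) * volume (unitDomain K)) ≤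
    torsionOrder K * ∑' I : (Ideal (𝓞 K))⁰,
      simplexVol K (y - Real.log (Ideal.absNorm (I : Ideal (𝓞 K)))) := by
  rw [← (Equiv.sigmaFiberEquiv (ClassGroup.mk0 (R := 𝓞 K))).tsum_eq, ENNReal.tsum_sigma',
    tsum_fintype, Finset.mul_sum, classNumber, ← Finset.card_univ, ← nsmul_eq_mul]
  refine Finset.card_nsmul_le_sum _ _ _ fun c _ ↦ ?_
  obtain ⟨J, hJ⟩ := ClassGroup.mk0_surjective (c⁻¹)
  refine le_trans ?_ (lintegral_boxCount hJ y).le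
  rw [← setLIntegral_const]
  exact lintegral_mono fun l ↦ le_boxCount J hy (sum_mult_tau _ _)

lemma tsum_simplexVol_eq (y : ℝ) :
    ∑' I : (Ideal (𝓞 K))⁰, simplexVol K (y - Real.log (Ideal.absNorm (I : Ideal (𝓞 K)))) =
      simplexVol K 1 * ENNReal.ofReal (idealSum K y) := by
  rw [idealSum, ENNReal.ofReal_tsum_of_nonneg (fun _ ↦ truncPow_nonneg _ _) (summable_truncPow K y),
    ← ENNReal.tsum_mul_left]
  exact tsum_congr fun I ↦ simplexVol_eq _

/-- The exact density of the smoothed ideal count. -/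
noncomputable def idealDensity (K : Type*) [Field K] [NumberField K] : ℝ :=
  boxConst K * (classNumber K * (volume (unitDomain K)).toReal) /
    (torsionOrder K * (simplexVol K 1).toReal)

lemma idealDensity_pos : 0 < idealDensity K := by
  have h1 := boxConst_pos (K := K)
  have h2 := ENNReal.toReal_pos (volume_unitDomain_ne_zero (K := K)) volume_unitDomain_ne_top
  have h3 := ENNReal.toReal_pos (simplexVol_one_ne_zero (K := K)) simplexVol_one_ne_top
  have h4 : (0 : ℝ) < torsionOrder K := by exact_mod_cast torsionOrder_pos K
  have h5 : (0 : ℝ) < classNumber K := by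
    exact_mod_cast Nat.pos_of_ne_zero (classNumber_ne_zero K)
  unfold idealDensity; positivity

lemma idealSum_nonneg (y : ℝ) : 0 ≤ idealSum K y := tsum_nonneg fun _ ↦ truncPow_nonneg _ _

theorem abs_idealSum_sub_le {y : ℝ} (hy : 0 ≤ y) :
    |idealSum K y - idealDensity K * Real.exp y| ≤
      idealDensity K * errConst K * Real.exp ((1 - 1 / finrank ℚ K) * y) := by
  have h1 := boxConst_pos (K := K)
  have h2 := ENNReal.toReal_pos (volume_unitDomain_ne_zero (K := K)) volume_unitDomain_ne_top
  have h3 := ENNReal.toReal_pos (simplexVol_one_ne_zero (K := K)) simplexVol_one_ne_top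
  have h4 : (0 : ℝ) < torsionOrder K := by exact_mod_cast torsionOrder_pos K
  have hH : 0 ≤ cellConst K := (absDisc_pos K).le.trans absDisc_le_cellConst
  have hE : 0 ≤ errConst K := by unfold errConst; positivity
  have hu := tsum_simplexVol_le (K := K) hy
  have hl := le_tsum_simplexVol (K := K) hy
  rw [tsum_simplexVol_eq] at hu hl
  have hfin1 : (torsionOrder K : ℝ≥0∞) * (simplexVol K 1 * ENNReal.ofReal (idealSum K y)) ≠ ∞ :=
    ENNReal.mul_ne_top (ENNReal.natCast_ne_top _)
      (ENNReal.mul_ne_top simplexVol_one_ne_top ENNReal.ofReal_ne_top)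
  have hu' := ENNReal.toReal_mono (ENNReal.mul_ne_top (ENNReal.natCast_ne_top _)
      (ENNReal.mul_ne_top ENNReal.ofReal_ne_top volume_unitDomain_ne_top)) hu
  have hl' := ENNReal.toReal_mono hfin1 hl
  simp only [ENNReal.toReal_mul, ENNReal.toReal_natCast,
    ENNReal.toReal_ofReal (idealSum_nonneg (K := K) y)] at hu' hl'
  rw [ENNReal.toReal_ofReal (by positivity)] at hu'
  set δ := errConst K * Real.exp ((1 - 1 / finrank ℚ K) * y)
  set R := (volume (unitDomain K)).toReal
  set V := (simplexVol K 1).toReal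
  have hl2 : classNumber K * (boxConst K * (Real.exp y - δ) * R) ≤
      torsionOrder K * (V * idealSum K y) := by
    refine le_trans ?_ hl'
    gcongr
    exact ENNReal.toReal_ofReal' ▸ le_max_left _ _
  have hTV : 0 < (torsionOrder K : ℝ) * V := by positivity
  rw [abs_le, mul_assoc]
  change _ ≤ _ ∧ _ ≤ idealDensity K * δ
  have hd : idealDensity K * (torsionOrder K * V) = boxConst K * (classNumber K * R) := by
    unfold idealDensity; rw [div_mul_cancel₀ _ hTV.ne']
  constructor
  · rw [neg_le_sub_iff_le_add, ← sub_le_iff_le_add, ← mul_sub]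
    refine le_of_mul_le_mul_right ?_ hTV
    calc _ = (idealDensity K * (torsionOrder K * V)) * (Real.exp y - δ) := by ring
      _ = classNumber K * (boxConst K * (Real.exp y - δ) * R) := by rw [hd]; ring
      _ ≤ _ := hl2
      _ = _ := by ring
  · rw [sub_le_iff_le_add, add_comm, ← mul_add]
    refine le_of_mul_le_mul_right ?_ hTV
    calc _ = torsionOrder K * (V * idealSum K y) := by ring
      _ ≤ _ := hu'
      _ = (boxConst K * (classNumber K * R)) * (Real.exp y + δ) := by ring
      _ = (idealDensity K * (torsionOrder K * V)) * (Real.exp y + δ) := by rw [hd]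
      _ = _ := by ring

/-- The dimension dependent constant in the bound of `errConst`. -/
noncomputable def errBase (n : ℕ) : ℝ := 2 * (6 * n * (4 ^ n) ^ n) ^ n

lemma errConst_le : errConst K ≤
    errBase (finrank ℚ K) * absDisc K ^ ((finrank ℚ K + 1) * finrank ℚ K) := by
  have h0 := one_le_absDisc K
  have hn := one_le_finrank_real (K := K)
  have h1 : 1 ≤ cellConst K := h0.trans absDisc_le_cellConst
  have h2 : cellConst K = 3 * finrank ℚ K * (4 ^ finrank ℚ K) ^ finrank ℚ K *
      absDisc K ^ (finrank ℚ K + 1) := by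
    unfold cellConst; rw [mul_pow]; ring
  unfold errConst errBase
  calc _ ≤ 2 * (2 * cellConst K) ^ finrank ℚ K := by gcongr; linarith
    _ = _ := by rw [h2, pow_mul (absDisc K), mul_assoc 2, ← mul_pow]; ring_nf

end IdealCount

open Set

section Laplace

lemma integrableOn_exp_neg_mul {a : ℝ} (ha : 0 < a) :
    IntegrableOn (fun y : ℝ ↦ Real.exp (-a * y)) (Ioi 0) := by
  simpa using! integrableOn_exp_mul_Ioi (neg_lt_zero.2 ha) 0

lemma integral_exp_neg_mul {a : ℝ} (ha : 0 < a) :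
    ∫ y in Ioi (0 : ℝ), Real.exp (-a * y) = a⁻¹ := by
  rw [integral_exp_mul_Ioi (neg_lt_zero.2 ha)]
  simp

lemma integrableOn_laplace {f : ℝ → ℝ} (hf : Measurable f) {C θ : ℝ}
    (hb : ∀ y, 0 < y → |f y| ≤ C * Real.exp (θ * y)) {s : ℝ} (hs : θ < s) :
    IntegrableOn (fun y ↦ Real.exp (-s * y) * f y) (Ioi 0) := by
  have h1 : IntegrableOn (fun y : ℝ ↦ C * Real.exp (-(s - θ) * y)) (Ioi 0) :=
    (integrableOn_exp_neg_mul (sub_pos.2 hs)).const_mul C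
  refine Integrable.mono' h1 (by fun_prop) ?_
  filter_upwards [ae_restrict_mem measurableSet_Ioi] with y hy
  rw [Real.norm_eq_abs, abs_mul, Real.abs_exp]
  calc _ ≤ Real.exp (-s * y) * (C * Real.exp (θ * y)) := by
        gcongr; exact hb y hy
    _ = C * (Real.exp (-s * y) * Real.exp (θ * y)) := by ring
    _ = _ := by rw [← Real.exp_add]; congr 2; ring

/-- The Laplace transform of `f` on the positive half-line. -/
noncomputable def laplace (f : ℝ → ℝ) (s : ℝ) : ℝ := ∫ y in Ioi (0 : ℝ), Real.exp (-s * y) * f y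

lemma analyticOnNhd_laplace_of_nonneg {f : ℝ → ℝ} (hf : Measurable f) (hf0 : ∀ y, 0 ≤ f y) {C θ : ℝ}
    (hb : ∀ y, 0 < y → |f y| ≤ C * Real.exp (θ * y)) :
    AnalyticOnNhd ℝ (laplace f) (Ioi θ) := by
  intro s hs
  let μ : Measure ℝ := (volume.restrict (Ioi 0)).withDensity fun y ↦ ENNReal.ofReal (f y)
  have hm : Measurable fun y ↦ ENNReal.ofReal (f y) := hf.ennreal_ofReal
  have hlt : ∀ᵐ y ∂(volume.restrict (Ioi (0 : ℝ))), ENNReal.ofReal (f y) < ∞ :=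
    ae_of_all _ fun _ ↦ ENNReal.ofReal_lt_top
  have hset : Iio (-θ) ⊆ ProbabilityTheory.integrableExpSet id μ := by
    intro t ht
    change Integrable _ _
    rw [integrable_withDensity_iff_integrable_smul' hm hlt]
    refine (integrableOn_laplace hf hb (s := -t) (by simp at ht; linarith)).congr ?_
    refine ae_of_all _ fun y ↦ ?_
    simp [ENNReal.toReal_ofReal (hf0 y), mul_comm]
  have hmem : -s ∈ interior (ProbabilityTheory.integrableExpSet id μ) :=
    interior_maximal hset isOpen_Iio (by simpa using hs)
  have h1 := ProbabilityTheory.analyticAt_mgf hmem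
  have h2 : laplace f = (ProbabilityTheory.mgf id μ) ∘ (fun s ↦ -s) := by
    funext s
    simp only [Function.comp, ProbabilityTheory.mgf, laplace]
    rw [integral_withDensity_eq_integral_toReal_smul hm hlt]
    refine integral_congr_ae (ae_of_all _ fun y ↦ ?_)
    simp [ENNReal.toReal_ofReal (hf0 y), mul_comm]
  rw [h2]
  exact h1.comp_of_eq (analyticAt_id.neg) rfl

lemma analyticOnNhd_laplace {f : ℝ → ℝ} (hf : Measurable f) {C θ : ℝ}
    (hb : ∀ y, 0 < y → |f y| ≤ C * Real.exp (θ * y)) :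
    AnalyticOnNhd ℝ (laplace f) (Ioi θ) := by
  have hp : ∀ y, 0 < y → |max (f y) 0| ≤ C * Real.exp (θ * y) := fun y hy ↦ by
    rw [abs_of_nonneg (le_max_right _ _)]
    exact max_le ((le_abs_self _).trans (hb y hy)) ((abs_nonneg _).trans (hb y hy))
  have hn : ∀ y, 0 < y → |max (-f y) 0| ≤ C * Real.exp (θ * y) := fun y hy ↦ by
    rw [abs_of_nonneg (le_max_right _ _)]
    exact max_le ((neg_le_abs _).trans (hb y hy)) ((abs_nonneg _).trans (hb y hy))
  have hpm : Measurable fun y ↦ max (f y) 0 := hf.max measurable_const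
  have hnm : Measurable fun y ↦ max (-f y) 0 := hf.neg.max measurable_const
  have h1 := analyticOnNhd_laplace_of_nonneg hpm (fun y ↦ le_max_right _ _) hp
  have h2 := analyticOnNhd_laplace_of_nonneg hnm (fun y ↦ le_max_right _ _) hn
  refine (h1.sub h2).congr isOpen_Ioi fun s hs ↦ ?_
  simp only [Pi.sub_apply, laplace]
  rw [← integral_sub (integrableOn_laplace hpm hp hs) (integrableOn_laplace hnm hn hs)]
  refine integral_congr_ae (ae_of_all _ fun y ↦ ?_)
  simp only
  rw [← mul_sub]
  congr 1
  rcases le_total 0 (f y) with h | h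
  · rw [max_eq_left h, max_eq_right (by linarith)]; ring
  · rw [max_eq_right h, max_eq_left (by linarith)]; ring

lemma lintegral_exp_truncPow (r : ℕ) {s L : ℝ} (hs : 0 < s) (hL : 0 ≤ L) :
    ∫⁻ y in Ioi (0 : ℝ), ENNReal.ofReal (Real.exp (-s * y) * truncPow r (y - L)) =
      ENNReal.ofReal (r.factorial / s ^ (r + 1) * Real.exp (-s * L)) := by
  have h0 : ∀ y, (Ioi (0 : ℝ)).indicator (fun y ↦
      ENNReal.ofReal (Real.exp (-s * y) * truncPow r (y - L))) y = (Ici 0).indicator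
        (fun u ↦ ENNReal.ofReal (Real.exp (-s * (u + L)) * u ^ r)) (y - L) ∨ y = 0 := by
    intro y
    rcases eq_or_ne y 0 with h | h
    · exact Or.inr h
    left
    simp only [indicator_apply, mem_Ioi, mem_Ici, truncPow]
    by_cases hy : 0 ≤ y - L
    · have : 0 < y := lt_of_le_of_ne (by linarith) h.symm
      simp [hy, this]
    · simp [hy]
  rw [← lintegral_indicator measurableSet_Ioi]
  have h1 : ∫⁻ y, (Ioi (0 : ℝ)).indicator (fun y ↦
      ENNReal.ofReal (Real.exp (-s * y) * truncPow r (y - L))) y = ∫⁻ y, (Ici 0).indicator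
        (fun u ↦ ENNReal.ofReal (Real.exp (-s * (u + L)) * u ^ r)) (y - L) := by
    refine lintegral_congr_ae ?_
    have : ∀ᵐ y : ℝ, y ≠ 0 := by simp [ae_iff]
    filter_upwards [this] with y hy
    exact (h0 y).resolve_right hy
  rw [h1, lintegral_sub_right_eq_self (fun y ↦ (Ici (0 : ℝ)).indicator
        (fun u ↦ ENNReal.ofReal (Real.exp (-s * (u + L)) * u ^ r)) y) L,
    lintegral_indicator measurableSet_Ici, setLIntegral_congr Ioi_ae_eq_Ici.symm]
  have h2 : ∫ u in Ioi (0 : ℝ), u ^ r * Real.exp (-s * u) = r.factorial / s ^ (r + 1) := by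
    have := Real.integral_rpow_mul_exp_neg_mul_Ioi (a := r + 1) (by positivity) hs
    rw [Real.Gamma_nat_eq_factorial] at this
    simp only [add_sub_cancel_right, Real.rpow_natCast, neg_mul] at this ⊢
    rw [this, mul_comm, ← Nat.cast_succ, Real.rpow_natCast]
    simp [div_eq_mul_inv]
  have h3 : IntegrableOn (fun u : ℝ ↦ u ^ r * Real.exp (-s * u)) (Ioi 0) := by
    by_contra h
    rw [integral_undef h] at h2
    have : (r.factorial : ℝ) / s ^ (r + 1) ≠ 0 := by positivity
    exact this h2.symm
  have h4 : ∀ u : ℝ, Real.exp (-s * (u + L)) * u ^ r =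
      Real.exp (-s * L) * (u ^ r * Real.exp (-s * u)) := fun u ↦ by
    rw [mul_add, Real.exp_add]; ring
  simp_rw [h4]
  rw [← ofReal_integral_eq_lintegral_ofReal (h3.const_mul _), integral_const_mul, h2, mul_comm]
  filter_upwards [ae_restrict_mem measurableSet_Ioi] with u hu
  have : 0 < u := hu
  positivity

end Laplace

section Continuation

variable (K : Type*) [Field K] [NumberField K]

/-- The Dedekind zeta function at real arguments, as a sum over ideals. -/
noncomputable def zr (s : ℝ) : ℝ :=
  ∑' I : (Ideal (𝓞 K))⁰, (Ideal.absNorm (I : Ideal (𝓞 K)) : ℝ) ^ (-s)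

lemma ofReal_idealSum (y : ℝ) : ENNReal.ofReal (idealSum K y) = ∑' I : (Ideal (𝓞 K))⁰,
    ENNReal.ofReal (truncPow (Units.rank K) (y - Real.log (Ideal.absNorm (I : Ideal (𝓞 K))))) := by
  rw [idealSum, ENNReal.ofReal_tsum_of_nonneg (fun _ ↦ truncPow_nonneg _ _) (summable_truncPow K y)]

lemma measurable_truncPow (r : ℕ) : Measurable (truncPow r) := by
  unfold truncPow
  exact Measurable.ite measurableSet_Ici (by fun_prop) measurable_const

lemma measurable_idealSum : Measurable (idealSum K) := by
  have h : idealSum K = fun y ↦ (∑' I : (Ideal (𝓞 K))⁰, ENNReal.ofReal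
      (truncPow (Units.rank K) (y - Real.log (Ideal.absNorm (I : Ideal (𝓞 K)))))).toReal := by
    funext y
    rw [← ofReal_idealSum, ENNReal.toReal_ofReal (idealSum_nonneg y)]
  rw [h]
  refine (Measurable.ennreal_tsum fun I ↦ ?_).ennreal_toReal
  exact ((measurable_truncPow _).comp (measurable_id.sub_const _)).ennreal_ofReal

/-- The error term of the smoothed ideal count. -/
noncomputable def idealErr (y : ℝ) : ℝ := idealSum K y - idealDensity K * Real.exp y

lemma measurable_idealErr : Measurable (idealErr K) :=
  (measurable_idealSum K).sub (by fun_prop)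

lemma abs_idealErr_le {y : ℝ} (hy : 0 < y) : |idealErr K y| ≤
    idealDensity K * errConst K * Real.exp ((1 - 1 / finrank ℚ K) * y) :=
  abs_idealSum_sub_le hy.le

/-- The analytic continuation of `(s - 1) * zr K s`. -/
noncomputable def zetaW (s : ℝ) : ℝ :=
  s ^ (Units.rank K + 1) * ((s - 1) * laplace (idealErr K) s + idealDensity K) /
    (Units.rank K).factorial

lemma analyticOnNhd_zetaW : AnalyticOnNhd ℝ (zetaW K) (Ioi (1 - 1 / finrank ℚ K : ℝ)) := by
  have h := analyticOnNhd_laplace (measurable_idealErr K) (fun y hy ↦ abs_idealErr_le K hy)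
  have h1 : AnalyticOnNhd ℝ (fun s : ℝ ↦ s) (Ioi (1 - 1 / finrank ℚ K : ℝ)) :=
    fun _ _ ↦ analyticAt_id
  have h2 : AnalyticOnNhd ℝ (fun s ↦ s ^ (Units.rank K + 1) * ((s - 1) *
    laplace (idealErr K) s + idealDensity K) * ((Units.rank K).factorial : ℝ)⁻¹)
      (Ioi (1 - 1 / finrank ℚ K : ℝ)) :=
    ((h1.pow _).mul (((h1.sub analyticOnNhd_const).mul h).add analyticOnNhd_const)).mul
      analyticOnNhd_const
  exact h2

lemma rpow_neg_absNorm (I : (Ideal (𝓞 K))⁰) (s : ℝ) :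
    (Ideal.absNorm (I : Ideal (𝓞 K)) : ℝ) ^ (-s) =
      Real.exp (-s * Real.log (Ideal.absNorm (I : Ideal (𝓞 K)))) := by
  rw [Real.rpow_def_of_pos (absNorm_real_pos I), mul_comm]

lemma log_absNorm_nonneg (I : (Ideal (𝓞 K))⁰) :
    0 ≤ Real.log (Ideal.absNorm (I : Ideal (𝓞 K))) :=
  Real.log_natCast_nonneg _

lemma lintegral_idealSum {s : ℝ} (hs : 0 < s) :
    ∫⁻ y in Ioi (0 : ℝ), ENNReal.ofReal (Real.exp (-s * y) * idealSum K y) =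
      ∑' I : (Ideal (𝓞 K))⁰, ENNReal.ofReal ((Units.rank K).factorial / s ^ (Units.rank K + 1) *
        (Ideal.absNorm (I : Ideal (𝓞 K)) : ℝ) ^ (-s)) := by
  simp_rw [ENNReal.ofReal_mul (Real.exp_nonneg _), ofReal_idealSum, ← ENNReal.tsum_mul_left]
  rw [lintegral_tsum]
  · refine tsum_congr fun I ↦ ?_
    simp_rw [← ENNReal.ofReal_mul (Real.exp_nonneg _)]
    rw [lintegral_exp_truncPow _ hs (log_absNorm_nonneg K I), rpow_neg_absNorm]
  · intro I
    refine Measurable.aemeasurable ?_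
    exact (Measurable.ennreal_ofReal (by fun_prop)).mul
      ((measurable_truncPow _).comp (measurable_id.sub_const _)).ennreal_ofReal

lemma idealSum_eq (y : ℝ) : idealSum K y = idealErr K y + idealDensity K * Real.exp y := by
  rw [idealErr]; ring

lemma sub_finrank_lt_one : (1 - 1 / finrank ℚ K : ℝ) < 1 := by
  have := one_le_finrank_real (K := K)
  have : (0 : ℝ) < 1 / finrank ℚ K := by positivity
  linarith

lemma integrableOn_idealSum {s : ℝ} (hs : 1 < s) :
    IntegrableOn (fun y ↦ Real.exp (-s * y) * idealSum K y) (Ioi 0) := by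
  have h1 := integrableOn_laplace (measurable_idealErr K) (fun y hy ↦ abs_idealErr_le K hy)
    ((sub_finrank_lt_one K).trans hs)
  have h2 := (integrableOn_exp_neg_mul (sub_pos.2 hs)).const_mul (idealDensity K)
  refine (h1.add h2).congr (ae_of_all _ fun y ↦ ?_)
  simp only [Pi.add_apply]
  rw [idealSum_eq, mul_add, add_right_inj, mul_left_comm, ← Real.exp_add]
  congr 2; ring

lemma laplace_idealSum {s : ℝ} (hs : 1 < s) :
    laplace (idealSum K) s = laplace (idealErr K) s + idealDensity K / (s - 1) := by
  have h1 := integrableOn_laplace (measurable_idealErr K) (fun y hy ↦ abs_idealErr_le K hy)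
    ((sub_finrank_lt_one K).trans hs)
  have h2 := (integrableOn_exp_neg_mul (sub_pos.2 hs)).const_mul (idealDensity K)
  rw [div_eq_mul_inv, ← integral_exp_neg_mul (sub_pos.2 hs), ← integral_const_mul, laplace, laplace,
    ← integral_add h1 h2]
  refine integral_congr_ae (ae_of_all _ fun y ↦ ?_)
  simp only
  rw [idealSum_eq, mul_add, add_right_inj, mul_left_comm, ← Real.exp_add]
  congr 2; ring

lemma tsum_ofReal_absNorm {s : ℝ} (hs : 1 < s) :
    ∑' I : (Ideal (𝓞 K))⁰, ENNReal.ofReal ((Units.rank K).factorial / s ^ (Units.rank K + 1) *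
        (Ideal.absNorm (I : Ideal (𝓞 K)) : ℝ) ^ (-s)) =
      ENNReal.ofReal (laplace (idealSum K) s) := by
  rw [← lintegral_idealSum K (by linarith), laplace, ofReal_integral_eq_lintegral_ofReal
    (integrableOn_idealSum K hs)]
  exact ae_of_all _ fun y ↦ mul_nonneg (Real.exp_nonneg _) (idealSum_nonneg y)

lemma summable_zr {s : ℝ} (hs : 1 < s) :
    Summable fun I : (Ideal (𝓞 K))⁰ ↦ (Ideal.absNorm (I : Ideal (𝓞 K)) : ℝ) ^ (-s) := by
  have hc : (0 : ℝ) < (Units.rank K).factorial / s ^ (Units.rank K + 1) := by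
    have : 0 < s := by linarith
    positivity
  have h := ENNReal.summable_toReal
    (ne_of_eq_of_ne (tsum_ofReal_absNorm K hs) ENNReal.ofReal_ne_top)
  rw [← summable_mul_left_iff hc.ne']
  refine h.congr fun I ↦ ?_
  rw [ENNReal.toReal_ofReal (by positivity)]

lemma zetaW_eq {s : ℝ} (hs : 1 < s) : zetaW K s = (s - 1) * zr K s := by
  have hs0 : 0 < s := by linarith
  have h := tsum_ofReal_absNorm K hs
  have hsum := (summable_zr K hs).mul_left ((Units.rank K).factorial / s ^ (Units.rank K + 1) : ℝ)
  rw [← ENNReal.ofReal_tsum_of_nonneg (fun I ↦ by positivity) hsum, tsum_mul_left] at h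
  have hl : 0 ≤ laplace (idealSum K) s :=
    integral_nonneg fun y ↦ mul_nonneg (Real.exp_nonneg _) (idealSum_nonneg y)
  rw [ENNReal.ofReal_eq_ofReal_iff (by positivity) hl, laplace_idealSum K hs] at h
  change _ * zr K s = _ at h
  have h1 : s - 1 ≠ 0 := by linarith
  have h2 : ((s - 1) * laplace (idealErr K) s + idealDensity K) =
    (s - 1) * (laplace (idealErr K) s + idealDensity K / (s - 1)) := by field_simp
  rw [zetaW, h2, ← h]
  field_simp

/-- The residue of the Dedekind zeta function at `1`. -/
noncomputable def zetaRes : ℝ := idealDensity K / (Units.rank K).factorial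

lemma zetaRes_pos : 0 < zetaRes K := div_pos idealDensity_pos (by positivity)

lemma zetaW_one : zetaW K 1 = zetaRes K := by
  simp [zetaW, zetaRes]

end Continuation

open IsDedekindDomain

section EulerProduct

open scoped Classical

variable {K : Type*} [Field K] [NumberField K]

/-- The summand of the Dedekind zeta function at an ideal. -/
noncomputable def normPow (s : ℝ) (I : Ideal (𝓞 K)) : ℝ := (Ideal.absNorm I : ℝ) ^ (-s)

lemma normPow_mul (s : ℝ) (I J : Ideal (𝓞 K)) : normPow s (I * J) = normPow s I * normPow s J := by
  rw [normPow, map_mul, Nat.cast_mul, Real.mul_rpow (Nat.cast_nonneg _) (Nat.cast_nonneg _)]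
  rfl

lemma normPow_pow (s : ℝ) (I : Ideal (𝓞 K)) (k : ℕ) : normPow s (I ^ k) = normPow s I ^ k := by
  induction k with
  | zero => simp [normPow]
  | succ k ih => rw [pow_succ, normPow_mul, ih, pow_succ]

lemma normPow_nonneg (s : ℝ) (I : Ideal (𝓞 K)) : 0 ≤ normPow s I :=
  Real.rpow_nonneg (Nat.cast_nonneg _) _

lemma two_le_absNorm (Q : HeightOneSpectrum (𝓞 K)) : (2 : ℝ) ≤ Ideal.absNorm Q.asIdeal := by
  have h0 : Ideal.absNorm Q.asIdeal ≠ 0 := by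
    rw [ne_eq, Ideal.absNorm_eq_zero_iff]; exact Q.ne_bot
  have h1 : Ideal.absNorm Q.asIdeal ≠ 1 := by
    rw [ne_eq, Ideal.absNorm_eq_one_iff]; exact Q.isPrime.ne_top
  have : 2 ≤ Ideal.absNorm Q.asIdeal := by omega
  exact_mod_cast this

lemma normPow_lt_one {s : ℝ} (hs : 0 < s) (Q : HeightOneSpectrum (𝓞 K)) :
    normPow s Q.asIdeal < 1 :=
  Real.rpow_lt_one_of_one_lt_of_neg (by linarith [two_le_absNorm Q]) (by linarith)

/-- Nonzero ideals all of whose prime divisors lie in `S`. -/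
def supportedIdeals (S : Finset (HeightOneSpectrum (𝓞 K))) : Set (Ideal (𝓞 K))⁰ :=
  {I | ∀ Q : HeightOneSpectrum (𝓞 K), Q.asIdeal ∣ (I : Ideal (𝓞 K)) → Q ∈ S}

lemma HeightOneSpectrum.prime_asIdeal (Q : HeightOneSpectrum (𝓞 K)) : Prime Q.asIdeal :=
  Ideal.prime_of_isPrime Q.ne_bot Q.isPrime

lemma eq_of_asIdeal_dvd {P Q : HeightOneSpectrum (𝓞 K)} (h : P.asIdeal ∣ Q.asIdeal) : P = Q := by
  have := (Ideal.dvd_iff_le.1 h)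
  exact HeightOneSpectrum.ext ((Q.isMaximal.eq_of_le P.isPrime.ne_top this).symm)

lemma supportedIdeals_empty : supportedIdeals (K := K) ∅ = {1} := by
  ext I
  simp only [supportedIdeals, Set.mem_ofPred_eq, Finset.notMem_empty, imp_false,
    Set.mem_singleton_iff]
  constructor
  · intro h
    by_contra hI
    have hI' : (I : Ideal (𝓞 K)) ≠ ⊤ := fun h' ↦ hI (Subtype.ext (h'.trans Ideal.one_eq_top.symm))
    obtain ⟨M, hM, hle⟩ := Ideal.exists_le_maximal _ hI'
    have hI0 : (I : Ideal (𝓞 K)) ≠ ⊥ := nonZeroDivisors.coe_ne_zero I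
    have hM0 : M ≠ ⊥ := fun h' ↦ hI0 (le_bot_iff.1 (h' ▸ hle))
    exact h ⟨M, hM.isPrime, hM0⟩ (Ideal.dvd_iff_le.2 hle)
  · rintro rfl Q hQ
    have := Ideal.dvd_iff_le.1 hQ
    exact Q.isPrime.ne_top (top_le_iff.1 (by simpa using this))

/-- Splitting off the `Q`-part. -/
noncomputable def insertMap (S : Finset (HeightOneSpectrum (𝓞 K))) (Q : HeightOneSpectrum (𝓞 K))
    (p : ℕ × supportedIdeals S) : supportedIdeals (insert Q S) :=
  ⟨⟨Q.asIdeal ^ p.1 * p.2.1, mul_mem (pow_mem (mem_nonZeroDivisors_of_ne_zero Q.ne_bot) _) p.2.1.2⟩,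
    fun P hP ↦ by
      rcases (HeightOneSpectrum.prime_asIdeal P).dvd_or_dvd hP with h | h
      · have := (HeightOneSpectrum.prime_asIdeal P).dvd_of_dvd_pow h
        rw [eq_of_asIdeal_dvd this]; exact Finset.mem_insert_self _ _
      · exact Finset.mem_insert_of_mem (p.2.2 P h)⟩

lemma insertMap_bijective {S : Finset (HeightOneSpectrum (𝓞 K))} {Q : HeightOneSpectrum (𝓞 K)}
    (hQ : Q ∉ S) : Function.Bijective (insertMap S Q) := by
  constructor
  · have key : ∀ (k m : ℕ) (I J : supportedIdeals S), k ≤ m →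
        Q.asIdeal ^ k * (I.1 : Ideal (𝓞 K)) = Q.asIdeal ^ m * (J.1 : Ideal (𝓞 K)) →
        (k, I) = (m, J) := by
      intro k m I J hkm h
      obtain ⟨j, rfl⟩ := Nat.exists_eq_add_of_le hkm
      rw [pow_add, mul_assoc] at h
      have h' := mul_left_cancel₀ (pow_ne_zero k Q.ne_bot) h
      rcases Nat.eq_zero_or_pos j with rfl | hj
      · simp only [pow_zero, one_mul] at h'
        have : I = J := Subtype.ext (Subtype.ext h')
        rw [this]; rfl
      · exact absurd (I.2 Q (h' ▸ (dvd_pow_self _ hj.ne').mul_right _)) hQ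
    rintro ⟨k, I⟩ ⟨m, J⟩ h
    have h' : Q.asIdeal ^ k * (I.1 : Ideal (𝓞 K)) = Q.asIdeal ^ m * (J.1 : Ideal (𝓞 K)) :=
      congr_arg (fun x ↦ ((x.1 : (Ideal (𝓞 K))⁰) : Ideal (𝓞 K))) h
    rcases le_total k m with hkm | hkm
    · exact key k m I J hkm h'
    · exact (key m k J I hkm h'.symm).symm
  · rintro ⟨I, hI⟩
    have hI0 : (I : Ideal (𝓞 K)) ≠ 0 := nonZeroDivisors.coe_ne_zero I
    have hfin : FiniteMultiplicity Q.asIdeal (I : Ideal (𝓞 K)) :=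
      FiniteMultiplicity.of_prime_left (HeightOneSpectrum.prime_asIdeal Q) hI0
    obtain ⟨c, hc, hndvd⟩ := hfin.exists_eq_pow_mul_and_not_dvd
    have hc0 : c ≠ 0 := by
      rintro rfl; rw [mul_zero] at hc; exact hI0 hc
    refine ⟨(multiplicity Q.asIdeal (I : Ideal (𝓞 K)),
      ⟨⟨c, mem_nonZeroDivisors_of_ne_zero hc0⟩, fun P hP ↦ ?_⟩), ?_⟩
    · have h1 := hI P (hc ▸ hP.mul_left _)
      rcases Finset.mem_insert.1 h1 with rfl | h
      · exact absurd hP hndvd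
      · exact h
    · exact Subtype.ext (Subtype.ext hc.symm)

lemma tsum_supportedIdeals (s : ℝ) (S : Finset (HeightOneSpectrum (𝓞 K))) :
    ∑' I : supportedIdeals S, ENNReal.ofReal (normPow s (I.1 : Ideal (𝓞 K))) =
      ∏ Q ∈ S, (1 - ENNReal.ofReal (normPow s Q.asIdeal))⁻¹ := by
  induction S using Finset.induction_on with
  | empty =>
    rw [supportedIdeals_empty, Finset.prod_empty]
    rw [tsum_singleton (1 : (Ideal (𝓞 K))⁰) fun I ↦ ENNReal.ofReal (normPow s (I : Ideal (𝓞 K)))]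
    simp [normPow]
  | insert Q S hQ ih =>
    rw [← (Equiv.ofBijective _ (insertMap_bijective hQ)).tsum_eq, ENNReal.tsum_prod',
      Finset.prod_insert hQ, ← ih, ← ENNReal.tsum_geometric, ← ENNReal.tsum_mul_right]
    refine tsum_congr fun k ↦ ?_
    rw [← ENNReal.tsum_mul_left]
    refine tsum_congr fun I ↦ ?_
    change ENNReal.ofReal (normPow s (Q.asIdeal ^ k * (I.1 : Ideal (𝓞 K)))) = _
    rw [normPow_mul, normPow_pow, ENNReal.ofReal_mul (pow_nonneg (normPow_nonneg _ _) _),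
      ENNReal.ofReal_pow (normPow_nonneg _ _)]

/-- Logarithm of the local Euler factor. -/
noncomputable def localLog (s : ℝ) (Q : HeightOneSpectrum (𝓞 K)) : ℝ :=
  -Real.log (1 - normPow s Q.asIdeal)

lemma localLog_nonneg {s : ℝ} (hs : 0 < s) (Q : HeightOneSpectrum (𝓞 K)) : 0 ≤ localLog s Q := by
  rw [localLog, neg_nonneg]
  exact Real.log_nonpos (by linarith [normPow_lt_one hs Q])
    (by linarith [normPow_nonneg s Q.asIdeal])

lemma tsum_supportedIdeals_eq_exp {s : ℝ} (hs : 0 < s) (S : Finset (HeightOneSpectrum (𝓞 K))) :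
    ∑' I : supportedIdeals S, ENNReal.ofReal (normPow s (I.1 : Ideal (𝓞 K))) =
      ENNReal.ofReal (Real.exp (∑ Q ∈ S, localLog s Q)) := by
  rw [tsum_supportedIdeals, Real.exp_sum, ENNReal.ofReal_prod_of_nonneg fun _ _ ↦ Real.exp_nonneg _]
  refine Finset.prod_congr rfl fun Q _ ↦ ?_
  have h := normPow_lt_one hs Q
  rw [localLog, Real.exp_neg, Real.exp_log (by linarith), ENNReal.ofReal_inv_of_pos (by linarith),
    ENNReal.ofReal_sub _ (normPow_nonneg _ _), ENNReal.ofReal_one]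

lemma ofReal_zr {s : ℝ} (hs : 1 < s) : ENNReal.ofReal (zr K s) =
    ∑' I : (Ideal (𝓞 K))⁰, ENNReal.ofReal (normPow s (I : Ideal (𝓞 K))) := by
  change ENNReal.ofReal (∑' I : (Ideal (𝓞 K))⁰, normPow s (I : Ideal (𝓞 K))) = _
  rw [ENNReal.ofReal_tsum_of_nonneg (fun I ↦ normPow_nonneg s _) (summable_zr K hs)]

lemma one_le_zr {s : ℝ} (hs : 1 < s) : 1 ≤ zr K s := by
  have := (summable_zr K hs).le_tsum 1 fun I _ ↦ normPow_nonneg s (I : Ideal (𝓞 K))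
  simpa using! this

lemma sum_localLog_le {s : ℝ} (hs : 1 < s) (S : Finset (HeightOneSpectrum (𝓞 K))) :
    ∑ Q ∈ S, localLog s Q ≤ Real.log (zr K s) := by
  have hz := one_le_zr (K := K) hs
  rw [Real.le_log_iff_exp_le (by linarith), ← ENNReal.ofReal_le_ofReal_iff (by linarith),
    ofReal_zr hs, ← tsum_supportedIdeals_eq_exp (by linarith)]
  exact ENNReal.tsum_comp_le_tsum_of_injective Subtype.val_injective
    (fun I : (Ideal (𝓞 K))⁰ ↦ ENNReal.ofReal (normPow s (I : Ideal (𝓞 K))))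

lemma summable_localLog {s : ℝ} (hs : 1 < s) :
    Summable (localLog s : HeightOneSpectrum (𝓞 K) → ℝ) :=
  summable_of_sum_le (fun Q ↦ localLog_nonneg (by linarith) Q) (sum_localLog_le hs)

theorem tsum_localLog {s : ℝ} (hs : 1 < s) :
    ∑' Q : HeightOneSpectrum (𝓞 K), localLog s Q = Real.log (zr K s) := by
  have hz := one_le_zr (K := K) hs
  refine le_antisymm (Real.tsum_le_of_sum_le (fun Q ↦ localLog_nonneg (by linarith) Q)
    (sum_localLog_le hs)) ?_
  rw [Real.log_le_iff_le_exp (by linarith), zr]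
  refine Real.tsum_le_of_sum_le (fun I ↦ normPow_nonneg s _) fun T ↦ ?_
  change ∑ I ∈ T, normPow s (I : Ideal (𝓞 K)) ≤ _
  have hfin : ∀ I : (Ideal (𝓞 K))⁰,
      {Q : HeightOneSpectrum (𝓞 K) | Q.asIdeal ∣ (I : Ideal (𝓞 K))}.Finite :=
    fun I ↦ Ideal.finite_factors (nonZeroDivisors.coe_ne_zero I)
  set S : Finset (HeightOneSpectrum (𝓞 K)) := T.biUnion fun I ↦ (hfin I).toFinset with hS
  have hsub : ∀ I ∈ T, I ∈ supportedIdeals S := fun I hI Q hQ ↦ by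
    rw [hS, Finset.mem_biUnion]
    exact ⟨I, hI, by simpa using hQ⟩
  have h1 : Real.exp (∑ Q ∈ S, localLog s Q) ≤
      Real.exp (∑' Q : HeightOneSpectrum (𝓞 K), localLog s Q) :=
    Real.exp_le_exp.2 ((summable_localLog hs).sum_le_tsum S fun Q _ ↦
      localLog_nonneg (by linarith) Q)
  refine le_trans ?_ h1
  rw [← ENNReal.ofReal_le_ofReal_iff (Real.exp_nonneg _),
    ← tsum_supportedIdeals_eq_exp (by linarith),
    ENNReal.ofReal_sum_of_nonneg (f := fun I : (Ideal (𝓞 K))⁰ ↦ normPow s (I : Ideal (𝓞 K)))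
      fun I _ ↦ normPow_nonneg s _,
    tsum_subtype (supportedIdeals S) fun I ↦ ENNReal.ofReal (normPow s (I : Ideal (𝓞 K)))]
  refine le_trans (Finset.sum_le_sum fun I hI ↦ ?_) (ENNReal.sum_le_tsum T)
  rw [Set.indicator_of_mem (hsub I hI)]

end EulerProduct

section Fibers

variable (F : Type*) [Field F] [NumberField F] {K : Type*} [Field K] [NumberField K] [Algebra F K]

/-- The primes of `K` above `𝔭`, as a fibre. -/
abbrev PrimesAbove (K : Type*) [Field K] [NumberField K] [Algebra F K]
    (𝔭 : HeightOneSpectrum (𝓞 F)) : Type _ :=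
  {Q : HeightOneSpectrum (𝓞 K) // Q.under (𝓞 F) = 𝔭}

variable {F}

/-- Primes above `𝔭` as height one primes and as ideals. -/
noncomputable def primesAboveEquiv (𝔭 : HeightOneSpectrum (𝓞 F)) :
    PrimesAbove F K 𝔭 ≃ 𝔭.asIdeal.primesOver (𝓞 K) where
  toFun Q := ⟨Q.1.asIdeal, Q.1.isPrime, ⟨congr_arg HeightOneSpectrum.asIdeal Q.2.symm⟩⟩
  invFun P := ⟨⟨P.1, P.2.1, fun h ↦ Ideal.ne_bot_of_mem_primesOver 𝔭.ne_bot P.2 h⟩,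
    HeightOneSpectrum.ext P.2.2.over.symm⟩
  left_inv _ := rfl
  right_inv _ := rfl

instance (𝔭 : HeightOneSpectrum (𝓞 F)) : Finite (PrimesAbove F K 𝔭) := by
  have := 𝔭.isMaximal
  have := (IsDedekindDomain.primesOver_finite 𝔭.asIdeal (𝓞 K)).to_subtype
  exact Finite.of_equiv _ (primesAboveEquiv 𝔭).symm

lemma liesOver_of_primesAbove {𝔭 : HeightOneSpectrum (𝓞 F)} (Q : PrimesAbove F K 𝔭) :
    Q.1.asIdeal.LiesOver 𝔭.asIdeal := ⟨congr_arg HeightOneSpectrum.asIdeal Q.2.symm⟩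

lemma natCard_primesAbove (𝔭 : HeightOneSpectrum (𝓞 F)) :
    Nat.card (PrimesAbove F K 𝔭) = (𝔭.asIdeal.primesOver (𝓞 K)).ncard := by
  rw [Nat.card_congr (primesAboveEquiv 𝔭)]; rfl

lemma natCard_primesAbove_le (𝔭 : HeightOneSpectrum (𝓞 F)) :
    Nat.card (PrimesAbove F K 𝔭) ≤ finrank F K := by
  have := 𝔭.isMaximal
  have : NoZeroSMulDivisors (𝓞 F) (𝓞 K) := ⟨fun h ↦ smul_eq_zero.1 h⟩
  rw [natCard_primesAbove, ← IsDedekindDomain.coe_primesOverFinset 𝔭.ne_bot, Set.ncard_coe_finset]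
  exact Ideal.card_primesOverFinset_le_finrank (𝓞 K) F K 𝔭.ne_bot

lemma absNorm_primesAbove {𝔭 : HeightOneSpectrum (𝓞 F)} (Q : PrimesAbove F K 𝔭) :
    Ideal.absNorm Q.1.asIdeal =
      Ideal.absNorm 𝔭.asIdeal ^ (𝔭.asIdeal.inertiaDeg' Q.1.asIdeal) :=
  have := liesOver_of_primesAbove Q
  Ideal.absNorm_eq_pow_inertiaDeg'_of_liesOver _ _ 𝔭.isPrime 𝔭.ne_bot

lemma normPow_primesAbove {𝔭 : HeightOneSpectrum (𝓞 F)} (s : ℝ) (Q : PrimesAbove F K 𝔭) :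
    normPow s Q.1.asIdeal = normPow s 𝔭.asIdeal ^ (𝔭.asIdeal.inertiaDeg' Q.1.asIdeal) := by
  rw [normPow, absNorm_primesAbove, normPow, Nat.cast_pow, ← Real.rpow_natCast, ← Real.rpow_natCast,
    ← Real.rpow_mul (Nat.cast_nonneg _), ← Real.rpow_mul (Nat.cast_nonneg _), mul_comm]

lemma localLog_primesAbove_le {𝔭 : HeightOneSpectrum (𝓞 F)} {s : ℝ} (hs : 0 < s)
    (Q : PrimesAbove F K 𝔭) : localLog s Q.1 ≤ localLog s 𝔭 := by
  have := liesOver_of_primesAbove Q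
  have := 𝔭.isMaximal
  have h1 := normPow_lt_one hs 𝔭
  have h2 : normPow s Q.1.asIdeal ≤ normPow s 𝔭.asIdeal := by
    rw [normPow_primesAbove]
    exact pow_le_of_le_one (normPow_nonneg _ _) h1.le (Ideal.inertiaDeg'_ne_zero _ _)
  rw [localLog, localLog, neg_le_neg_iff]
  exact Real.log_le_log (by linarith) (by linarith)

/-- Sum of the local terms over the primes above `𝔭`. -/
noncomputable def fiberLog (K : Type*) [Field K] [NumberField K] [Algebra F K] (s : ℝ)
    (𝔭 : HeightOneSpectrum (𝓞 F)) : ℝ :=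
  ∑' Q : PrimesAbove F K 𝔭, localLog s Q.1

lemma fiberLog_le {s : ℝ} (hs : 0 < s) (𝔭 : HeightOneSpectrum (𝓞 F)) :
    fiberLog K s 𝔭 ≤ finrank F K * localLog s 𝔭 := by
  have := Fintype.ofFinite (PrimesAbove F K 𝔭)
  rw [fiberLog, tsum_fintype]
  calc _ ≤ ∑ Q : PrimesAbove F K 𝔭, localLog s 𝔭 :=
        Finset.sum_le_sum fun Q _ ↦ localLog_primesAbove_le hs Q
    _ = Nat.card (PrimesAbove F K 𝔭) * localLog s 𝔭 := by simp
    _ ≤ _ := by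
      gcongr
      · exact localLog_nonneg hs 𝔭
      · exact natCard_primesAbove_le 𝔭

variable (F K)

lemma hasSum_fiberLog {s : ℝ} (hs : 1 < s) :
    HasSum (fiberLog K s : HeightOneSpectrum (𝓞 F) → ℝ) (Real.log (zr K s)) := by
  have h0 := (summable_localLog (K := K) hs).hasSum
  rw [tsum_localLog hs] at h0
  have h := (Equiv.sigmaFiberEquiv
    (fun Q : HeightOneSpectrum (𝓞 K) ↦ Q.under (𝓞 F))).hasSum_iff.2 h0
  exact h.sigma fun 𝔭 ↦ (h.summable.sigma_factor 𝔭).hasSum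

lemma log_zr_le {s : ℝ} (hs : 1 < s) :
    Real.log (zr K s) ≤ finrank F K * Real.log (zr F s) := by
  have h1 := hasSum_fiberLog F K hs
  have h2 := (summable_localLog (K := F) hs).hasSum.mul_left (finrank F K : ℝ)
  rw [tsum_localLog hs] at h2
  exact hasSum_le (fun 𝔭 ↦ fiberLog_le (by linarith) 𝔭) h1 h2

lemma zr_le_zr_pow {s : ℝ} (hs : 1 < s) : zr K s ≤ zr F s ^ finrank F K := by
  have hK := one_le_zr (K := K) hs
  have hF := one_le_zr (K := F) hs
  rw [← Real.log_le_log_iff (by linarith) (by positivity), Real.log_pow]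
  exact log_zr_le F K hs

end Fibers

section ResidueBounds

variable {K : Type*} [Field K] [NumberField K]

lemma two_le_errConst : 2 ≤ errConst K := by
  have h : (1 : ℝ) ≤ cellConst K := (one_le_absDisc K).trans absDisc_le_cellConst
  have : (1 : ℝ) ≤ (1 + cellConst K) ^ finrank ℚ K := one_le_pow₀ (by linarith)
  unfold errConst; linarith

lemma exp_one_le_errConst : Real.exp 1 ≤ errConst K := by
  have h : (1 : ℝ) ≤ cellConst K := (one_le_absDisc K).trans absDisc_le_cellConst
  have h1 : (1 + 1 : ℝ) ^ 1 ≤ (1 + cellConst K) ^ finrank ℚ K :=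
    (pow_le_pow_left₀ (by norm_num) (by linarith) 1).trans
      (pow_le_pow_right₀ (by linarith) finrank_pos)
  have := Real.exp_one_lt_d9
  unfold errConst; linarith

lemma rank_le_finrank : Units.rank K ≤ finrank ℚ K := by
  classical
  have := InfinitePlace.card_add_two_mul_card_eq_rank K
  have h2 := InfinitePlace.card_eq_nrRealPlaces_add_nrComplexPlaces K
  rw [Units.rank]
  omega

/-! ### Upper bound for the residue -/

lemma truncPow_le {r : ℕ} {δ : ℝ} (hδ : 0 < δ) (t : ℝ) :
    truncPow r t ≤ r.factorial / δ ^ r * Real.exp ((1 + δ) * t) := by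
  unfold truncPow
  split_ifs with ht
  · have h1 := Real.pow_div_factorial_le_exp (δ * t) (by positivity) r
    rw [div_le_iff₀ (by positivity), mul_pow] at h1
    have h2 : Real.exp (δ * t) ≤ Real.exp ((1 + δ) * t) := Real.exp_le_exp.2 (by linarith)
    rw [div_mul_eq_mul_div, le_div_iff₀ (by positivity)]
    calc t ^ r * δ ^ r = δ ^ r * t ^ r := mul_comm _ _
      _ ≤ _ := h1
      _ ≤ _ := by rw [mul_comm]; gcongr
  · positivity

lemma idealSum_le {δ : ℝ} (hδ : 0 < δ) (y : ℝ) : idealSum K y ≤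
    (Units.rank K).factorial / δ ^ Units.rank K * Real.exp ((1 + δ) * y) * zr K (1 + δ) := by
  rw [idealSum, zr, ← tsum_mul_left]
  refine (summable_truncPow K y).tsum_le_tsum (fun I ↦ ?_)
    ((summable_zr K (by linarith)).mul_left _)
  refine (truncPow_le hδ _).trans (le_of_eq ?_)
  rw [rpow_neg_absNorm, mul_assoc, ← Real.exp_add]
  ring_nf

lemma zetaRes_le {δ : ℝ} (hδ : 0 < δ) : zetaRes K ≤
    2 * (1 / δ ^ Units.rank K) * (2 * errConst K) ^ (finrank ℚ K * δ) * zr K (1 + δ) := by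
  have hE := two_le_errConst (K := K)
  have hn := one_le_finrank_real (K := K)
  have hn0 : (finrank ℚ K : ℝ) ≠ 0 := by positivity
  set y := finrank ℚ K * Real.log (2 * errConst K) with hy
  have hl : 0 ≤ Real.log (2 * errConst K) := Real.log_nonneg (by linarith)
  have hy0 : 0 ≤ y := by positivity
  have h1 := abs_le.1 (abs_idealSum_sub_le (K := K) hy0)
  have h2 : errConst K * Real.exp ((1 - 1 / finrank ℚ K) * y) = Real.exp y / 2 := by
    have : (1 - 1 / finrank ℚ K) * y = y - Real.log (2 * errConst K) := by
      rw [hy]; field_simp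
    rw [this, Real.exp_sub, Real.exp_log (by linarith)]
    field_simp
  have h3 := idealSum_le (K := K) hδ y
  have h4 : Real.exp ((1 + δ) * y) = Real.exp y * (2 * errConst K) ^ (finrank ℚ K * δ) := by
    rw [Real.rpow_def_of_pos (by linarith), ← Real.exp_add, hy]
    ring_nf
  rw [mul_assoc, h2] at h1
  rw [h4] at h3
  have h5 := h1.1
  rw [zetaRes, div_le_iff₀ (by positivity)]
  refine le_of_mul_le_mul_right ?_ (Real.exp_pos y)
  calc idealDensity K * Real.exp y ≤ 2 * idealSum K y := by linarith
    _ ≤ _ := mul_le_mul_of_nonneg_left h3 (by norm_num)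
    _ = _ := by ring

/-- The residue grows more slowly than any power of the discriminant, in bounded degree. -/
theorem exists_zetaRes_le (n : ℕ) {ε : ℝ} (hε : 0 < ε) : ∃ C : ℝ, 0 < C ∧
    ∀ (K : Type) [Field K] [NumberField K], finrank ℚ K = n →
      zetaRes K ≤ C * absDisc K ^ ε := by
  set A : ℝ := ((n + 1) * n : ℕ) * n with hA
  set δ : ℝ := min 1 (ε / (A + 1)) with hδ
  have hA0 : 0 ≤ A := by positivity
  have hδ0 : 0 < δ := lt_min one_pos (by positivity)
  have hδ1 : δ ≤ 1 := min_le_left _ _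
  have hAδ : A * δ ≤ ε := by
    have : δ ≤ ε / (A + 1) := min_le_right _ _
    rw [le_div_iff₀ (by linarith)] at this
    nlinarith
  have hE0 : 0 ≤ errBase n := by unfold errBase; positivity
  have hz := one_le_zr (K := ℚ) (s := 1 + δ) (by linarith)
  refine ⟨2 * (1 / δ ^ n) * (2 * errBase n + 1) ^ (n * δ) * zr ℚ (1 + δ) ^ n, by positivity, ?_⟩
  intro K _ _ hn
  have hd := one_le_absDisc K
  have hE := two_le_errConst (K := K)
  have h1 : 2 * errConst K ≤ (2 * errBase n + 1) * absDisc K ^ ((n + 1) * n) := by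
    have := errConst_le (K := K)
    rw [hn] at this
    have h3 : 0 ≤ absDisc K ^ ((n + 1) * n) := by positivity
    linarith
  have h2 : (2 * errConst K) ^ (n * δ) ≤ (2 * errBase n + 1) ^ (n * δ) * absDisc K ^ ε := by
    refine (Real.rpow_le_rpow (by linarith) h1 (by positivity)).trans ?_
    rw [Real.mul_rpow (by positivity) (by positivity), ← Real.rpow_natCast, ← Real.rpow_mul
      (by positivity)]
    gcongr
    refine le_trans (le_of_eq ?_) hAδ
    rw [hA]; ring
  have h3 : 1 / δ ^ Units.rank K ≤ 1 / δ ^ n := by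
    refine one_div_le_one_div_of_le (by positivity) ?_
    exact pow_le_pow_of_le_one hδ0.le hδ1 (hn ▸ rank_le_finrank)
  have h4 := zr_le_zr_pow ℚ K (s := 1 + δ) (by linarith)
  have h5 := one_le_zr (K := K) (s := 1 + δ) (by linarith)
  have h6 := zetaRes_le (K := K) hδ0
  rw [hn] at h4 h6
  refine h6.trans ?_
  calc _ ≤ 2 * (1 / δ ^ n) * ((2 * errBase n + 1) ^ (n * δ) * absDisc K ^ ε) * zr ℚ (1 + δ) ^ n := by
        gcongr
    _ = _ := by ring

/-! ### Lower bound for the residue from a sign of the zeta function -/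

lemma min_exp_le {B y a θ : ℝ} (hB : 0 < B) (hθ0 : 0 ≤ θ) (hθ1 : θ ≤ 1) :
    min (Real.exp y) (B * Real.exp ((1 - a) * y)) ≤ B ^ θ * Real.exp ((1 - a * θ) * y) := by
  have h : B ^ θ * Real.exp ((1 - a * θ) * y) =
      Real.exp y * Real.exp (θ * (Real.log B - a * y)) := by
    rw [Real.rpow_def_of_pos hB, ← Real.exp_add, ← Real.exp_add]; ring_nf
  have h2 : B * Real.exp ((1 - a) * y) = Real.exp y * Real.exp (Real.log B - a * y) := by
    nth_rewrite 1 [← Real.exp_log hB]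
    rw [← Real.exp_add, ← Real.exp_add]; ring_nf
  rw [h, h2]
  rcases le_total 0 (Real.log B - a * y) with h0 | h0
  · refine (min_le_left _ _).trans (le_mul_of_one_le_right (Real.exp_nonneg _) ?_)
    exact Real.one_le_exp (by positivity)
  · refine (min_le_right _ _).trans ?_
    gcongr
    nlinarith

lemma pow_rank_le_idealSum {y : ℝ} (hy : 0 ≤ y) : y ^ Units.rank K ≤ idealSum K y := by
  have := (summable_truncPow K y).le_tsum 1 fun I _ ↦ truncPow_nonneg _ _
  simpa [idealSum, truncPow, hy] using! this

lemma le_idealErr {θ y : ℝ} (hθ0 : 0 ≤ θ) (hθ1 : θ ≤ 1) (hy : 0 < y) :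
    (Ioc (0 : ℝ) 1).indicator (fun y ↦ y ^ Units.rank K) y -
      idealDensity K * errConst K ^ θ * Real.exp ((1 - 1 / finrank ℚ K * θ) * y) ≤ idealErr K y := by
  have hE := two_le_errConst (K := K)
  have hκ := idealDensity_pos (K := K)
  have hm := min_exp_le (B := errConst K) (y := y) (a := 1 / finrank ℚ K) (by linarith) hθ0 hθ1
  have hn := one_le_finrank_real (K := K)
  by_cases h : y ≤ 1
  · rw [indicator_of_mem (show y ∈ Ioc (0 : ℝ) 1 from ⟨hy, h⟩)]
    have h1 : Real.exp y ≤ errConst K * Real.exp ((1 - 1 / finrank ℚ K) * y) := by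
      have h2 : Real.exp y = Real.exp (1 / finrank ℚ K * y) *
          Real.exp ((1 - 1 / finrank ℚ K) * y) := by
        rw [← Real.exp_add]; ring_nf
      rw [h2]
      gcongr
      refine le_trans (Real.exp_le_exp.2 ?_) exp_one_le_errConst
      have : 1 / (finrank ℚ K : ℝ) ≤ 1 := by rw [div_le_one (by linarith)]; exact hn
      nlinarith
    rw [min_eq_left h1] at hm
    have h3 := pow_rank_le_idealSum (K := K) hy.le
    have := mul_le_mul_of_nonneg_left hm hκ.le
    rw [idealErr, mul_assoc]
    linarith
  · rw [indicator_of_notMem (fun h' ↦ h h'.2)]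
    have h1 := (abs_le.1 (abs_idealErr_le K hy)).1
    have h2 := idealSum_nonneg (K := K) y
    have h3 : -(idealDensity K * Real.exp y) ≤ idealErr K y := by rw [idealErr]; linarith
    have := mul_le_mul_of_nonneg_left hm hκ.le
    rw [mul_min_of_nonneg _ _ hκ.le, min_le_iff] at this
    rcases this with h | h <;> linarith

lemma le_integral_indicator (r : ℕ) {β : ℝ} (hβ : β ≤ 1) :
    Real.exp (-1) / (r + 1) ≤
      ∫ y in Ioi (0 : ℝ), Real.exp (-β * y) * (Ioc (0 : ℝ) 1).indicator (fun y ↦ y ^ r) y := by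
  have h1 : (fun y ↦ Real.exp (-β * y) * (Ioc (0 : ℝ) 1).indicator (fun y ↦ y ^ r) y) =
      (Ioc (0 : ℝ) 1).indicator (fun y ↦ Real.exp (-β * y) * y ^ r) := by
    funext y; by_cases h : y ∈ Ioc (0 : ℝ) 1 <;> simp [h]
  have h2 : Real.exp (-1) / (r + 1) = ∫ y in Ioc (0 : ℝ) 1, Real.exp (-1) * y ^ r := by
    rw [← intervalIntegral.integral_of_le zero_le_one, intervalIntegral.integral_const_mul,
      integral_pow]
    simp [div_eq_mul_inv]
  rw [h1, setIntegral_indicator measurableSet_Ioc, inter_eq_self_of_subset_right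
    Ioc_subset_Ioi_self, h2]
  have hi : ∀ f : ℝ → ℝ, Continuous f → IntegrableOn f (Ioc 0 1) := fun f hf ↦
    (hf.integrableOn_Icc).mono_set Ioc_subset_Icc_self
  refine setIntegral_mono_on (hi _ (by fun_prop)) (hi _ (by fun_prop)) measurableSet_Ioc
    fun y hy ↦ ?_
  have := hy.1.le
  gcongr
  nlinarith [hy.1, hy.2]

/-- If `ζ_K(β) ≤ 0` with `β` near `1` then the residue at `1` is not too small. -/
theorem le_zetaRes_of_zetaW_nonneg {β : ℝ} (h1 : 1 - 1 / (2 * finrank ℚ K) ≤ β) (h2 : β < 1)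
    (hW : 0 ≤ zetaW K β) :
    (1 - β) * (Real.exp (-1) / (Units.rank K + 1)) ≤ 2 * (Units.rank K).factorial * zetaRes K *
      errConst K ^ (2 * finrank ℚ K * (1 - β)) := by
  have hE := two_le_errConst (K := K)
  have hκ := idealDensity_pos (K := K)
  have hn := one_le_finrank_real (K := K)
  set n : ℝ := (finrank ℚ K : ℝ) with hndef
  set θ : ℝ := 2 * n * (1 - β) with hθ
  have hβ0 : 0 < β := by
    have : 1 / (2 * n) ≤ 1 / 2 := one_div_le_one_div_of_le (by norm_num) (by linarith)
    linarith
  have hθ0 : 0 ≤ θ := mul_nonneg (by positivity) (by linarith)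
  have hθ1 : θ ≤ 1 := by
    have : 1 - β ≤ 1 / (2 * n) := by linarith
    rw [le_div_iff₀ (by positivity)] at this
    linarith
  have hW' : 0 ≤ (β - 1) * laplace (idealErr K) β + idealDensity K := by
    rw [zetaW, mul_div_assoc] at hW
    have := nonneg_of_mul_nonneg_right hW (by positivity)
    rcases div_nonneg_iff.1 this with h | h
    · exact h.1
    · exact absurd h.2 (not_le.2 (by positivity))
  have hθn : 1 / n * θ = 2 * (1 - β) := by rw [hθ]; field_simp
  have hlow : Real.exp (-1) / (Units.rank K + 1) - idealDensity K * errConst K ^ θ * (1 - β)⁻¹ ≤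
      laplace (idealErr K) β := by
    have hi1 : IntegrableOn (fun y ↦ Real.exp (-β * y) *
        (Ioc (0 : ℝ) 1).indicator (fun y ↦ y ^ Units.rank K) y) (Ioi 0) := by
      refine integrableOn_laplace (C := 1) (θ := 0)
        ((measurable_id.pow_const _).indicator measurableSet_Ioc) (fun y hy ↦ ?_) hβ0
      by_cases h : y ∈ Ioc (0 : ℝ) 1
      · rw [indicator_of_mem h, id, abs_of_nonneg (pow_nonneg hy.le _)]
        simpa using pow_le_one₀ hy.le h.2
      · rw [indicator_of_notMem h]; simp
    have hi2 := (integrableOn_exp_neg_mul (a := 1 - β) (by linarith)).const_mul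
      (idealDensity K * errConst K ^ θ)
    have hlt : 1 - 1 / n < β := by
      have : 1 / (2 * n) < 1 / n := one_div_lt_one_div_of_lt (by positivity) (by linarith)
      linarith
    have hi3 := integrableOn_laplace (measurable_idealErr K) (fun y hy ↦ abs_idealErr_le K hy) hlt
    have := setIntegral_mono_on (hi1.sub hi2) hi3 measurableSet_Ioi fun y hy ↦ by
      have h := mul_le_mul_of_nonneg_left (le_idealErr (K := K) hθ0 hθ1 hy)
        (Real.exp_nonneg (-β * y))
      refine le_trans (le_of_eq ?_) h
      have h5 : Real.exp (-(1 - β) * y) = Real.exp (-β * y) * Real.exp ((1 - 1 / n * θ) * y) := by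
        rw [← Real.exp_add, hθn]; ring_nf
      simp only [Pi.sub_apply]
      rw [h5]; ring
    rw [integral_sub' hi1 hi2, integral_const_mul, integral_exp_neg_mul (by linarith)] at this
    refine le_trans ?_ this
    have := le_integral_indicator (Units.rank K) h2.le
    linarith
  have hpos : 0 < 1 - β := by linarith
  have h3 := mul_le_mul_of_nonneg_left hlow hpos.le
  have h4 : (1 - β) * (idealDensity K * errConst K ^ θ * (1 - β)⁻¹) =
      idealDensity K * errConst K ^ θ := by field_simp
  rw [mul_sub, h4] at h3
  have h5 : 1 ≤ errConst K ^ θ := Real.one_le_rpow (by linarith) hθ0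
  have h6 : (Units.rank K).factorial * zetaRes K = idealDensity K := by
    rw [zetaRes]; field_simp
  rw [mul_assoc 2, h6]
  nlinarith

end ResidueBounds

open Filter Topology

section Residue

/-- Uniform lower bound for the residue when `ζ_K(β) ≤ 0`. -/
theorem exists_le_zetaRes_of_zetaW_nonneg (n : ℕ) (hn0 : 0 < n) {β : ℝ} (h1 : 1 - 1 / (2 * n) ≤ β)
    (h2 : β < 1) : ∃ c : ℝ, 0 < c ∧ ∀ (K : Type) [Field K] [NumberField K], finrank ℚ K = n →
      0 ≤ zetaW K β →
      c ≤ zetaRes K * absDisc K ^ (2 * n * ((n + 1) * n : ℕ) * (1 - β)) := by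
  have hβ : 0 < 1 - β := by linarith
  have hE0 : 0 < errBase n := by unfold errBase; positivity
  refine ⟨(1 - β) * (Real.exp (-1) / (n + 1)) / (2 * n.factorial) /
    errBase n ^ (2 * n * (1 - β)), by positivity, ?_⟩
  intro K _ _ hn hW
  have hd := one_le_absDisc K
  have hE := two_le_errConst (K := K)
  have hκ := zetaRes_pos K
  have h3 := le_zetaRes_of_zetaW_nonneg (K := K) (by rw [hn]; exact h1) h2 hW
  rw [hn] at h3
  have hr : Units.rank K ≤ n := hn ▸ rank_le_finrank
  have h4 : (1 - β) * (Real.exp (-1) / (n + 1)) ≤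
      (1 - β) * (Real.exp (-1) / (Units.rank K + 1)) := by
    gcongr
  have h5 : ((Units.rank K).factorial : ℝ) ≤ n.factorial := by
    exact_mod_cast Nat.factorial_le hr
  have h6 : errConst K ^ (2 * n * (1 - β)) ≤ errBase n ^ (2 * n * (1 - β)) *
      absDisc K ^ (2 * n * ((n + 1) * n : ℕ) * (1 - β)) := by
    have := errConst_le (K := K)
    rw [hn] at this
    refine (Real.rpow_le_rpow (by linarith) this (by positivity)).trans (le_of_eq ?_)
    rw [Real.mul_rpow hE0.le (by positivity), ← Real.rpow_natCast, ← Real.rpow_mul (by linarith)]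
    ring_nf
  rw [div_le_iff₀ (by positivity), div_le_iff₀ (by positivity)]
  calc _ ≤ _ := h4
    _ ≤ _ := h3
    _ ≤ 2 * n.factorial * zetaRes K * (errBase n ^ (2 * n * (1 - β)) *
      absDisc K ^ (2 * n * ((n + 1) * n : ℕ) * (1 - β))) := by gcongr
    _ = _ := by ring

variable (K : Type*) [Field K] [NumberField K]

lemma hasSum_card_absNorm {s : ℝ} (hs : 1 < s) :
    HasSum (fun n : ℕ ↦ (Nat.card {I : (Ideal (𝓞 K))⁰ // Ideal.absNorm (I : Ideal (𝓞 K)) = n} : ℝ) *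
      (n : ℝ) ^ (-s)) (zr K s) := by
  have h0 := (summable_zr K hs).hasSum
  have h := (Equiv.sigmaFiberEquiv
    (fun I : (Ideal (𝓞 K))⁰ ↦ Ideal.absNorm (I : Ideal (𝓞 K)))).hasSum_iff.2 h0
  refine h.sigma fun n ↦ ?_
  have hfin : Finite {I : (Ideal (𝓞 K))⁰ // Ideal.absNorm (I : Ideal (𝓞 K)) = n} := by
    have := (Ideal.finite_setOfPred_absNorm_le (S := 𝓞 K) n).to_subtype
    refine Finite.of_injective (β := {I : Ideal (𝓞 K) | Ideal.absNorm I ≤ n})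
      (fun I : {I : (Ideal (𝓞 K))⁰ // Ideal.absNorm (I : Ideal (𝓞 K)) = n} ↦ ⟨I.1.1, I.2.le⟩) ?_
    intro I J h
    exact Subtype.ext (Subtype.ext (congr_arg (fun x ↦ x.1) h))
  have := Fintype.ofFinite {I : (Ideal (𝓞 K))⁰ // Ideal.absNorm (I : Ideal (𝓞 K)) = n}
  convert hasSum_fintype _ using 1
  rw [Nat.card_eq_fintype_card, ← nsmul_eq_mul, ← Finset.card_univ]
  refine (Finset.sum_eq_card_nsmul fun I _ ↦ ?_).symm
  have h := I.2
  change (Ideal.absNorm (I.1 : Ideal (𝓞 K)) : ℝ) ^ (-s) = _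
  rw [h]

lemma natCard_absNorm_eq {n : ℕ} (hn : n ≠ 0) :
    Nat.card {I : (Ideal (𝓞 K))⁰ // Ideal.absNorm (I : Ideal (𝓞 K)) = n} =
      Nat.card {I : Ideal (𝓞 K) // Ideal.absNorm I = n} := by
  refine Nat.card_congr ⟨fun I ↦ ⟨I.1, I.2⟩, fun I ↦ ⟨⟨I.1, ?_⟩, I.2⟩, fun _ ↦ rfl, fun _ ↦ rfl⟩
  refine mem_nonZeroDivisors_of_ne_zero fun h ↦ hn ?_
  rw [← I.2, h]; simp

lemma dedekindZeta_eq_zr {s : ℝ} (hs : 1 < s) : dedekindZeta K (s : ℂ) = (zr K s : ℂ) := by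
  rw [dedekindZeta, LSeries]
  refine (HasSum.tsum_eq ?_)
  have h := (hasSum_card_absNorm K hs).mapL Complex.ofRealCLM
  change HasSum _ (Complex.ofRealCLM (zr K s))
  convert h using 2 with n
  rcases eq_or_ne n 0 with rfl | hn
  · rw [LSeries.term_zero]
    simp [Real.zero_rpow (show -s ≠ 0 by linarith)]
  · rw [LSeries.term_of_ne_zero hn, natCard_absNorm_eq K hn]
    simp only [Complex.ofRealCLM_apply, Complex.ofReal_mul, Complex.ofReal_natCast]
    rw [Complex.ofReal_cpow (Nat.cast_nonneg _), div_eq_mul_inv, Complex.ofReal_neg,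
      Complex.cpow_neg, Complex.ofReal_natCast]

theorem zetaRes_eq : zetaRes K = dedekindZeta_residue K := by
  have h1 := tendsto_sub_one_mul_dedekindZeta_nhdsGT K
  have h2 : Tendsto (fun s : ℝ ↦ ((zetaW K s : ℝ) : ℂ)) (𝓝[>] 1) (𝓝 (zetaRes K : ℂ)) := by
    have h := (analyticOnNhd_zetaW K 1 (sub_finrank_lt_one K)).continuousAt
    rw [ContinuousAt, zetaW_one] at h
    exact (Complex.continuous_ofReal.tendsto _).comp (h.mono_left nhdsWithin_le_nhds)
  have h3 : Tendsto (fun s : ℝ ↦ ((zetaW K s : ℝ) : ℂ)) (𝓝[>] 1)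
      (𝓝 (dedekindZeta_residue K : ℂ)) := by
    refine h1.congr' ?_
    filter_upwards [self_mem_nhdsWithin] with s hs
    rw [zetaW_eq K hs, dedekindZeta_eq_zr K hs]
    push_cast; rfl
  exact_mod_cast tendsto_nhds_unique h2 h3

end Residue

section Klein

lemma klein_index_cases {a b g f : ℕ} (ha : a ≤ 1) (hb : b ≤ 1) (h : g * (1 + a) * f = 2)
    (h' : 1 + b = (1 + a) * f) :
    (a = 0 ∧ b = 0 ∧ f = 1 ∧ g = 2) ∨ (a = 0 ∧ b = 1 ∧ f = 2 ∧ g = 1) ∨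
      (a = 1 ∧ b = 1 ∧ f = 1 ∧ g = 1) := by
  rw [mul_assoc, ← h'] at h
  interval_cases a <;> interval_cases b <;> omega

lemma klein_sum (L : ℕ → ℝ) {g f g₁ f₁ g₁' f₁' a₁ b₁ g₂ f₂ g₂' f₂' a₂ b₂ g₃ f₃ g₃' f₃' a₃ b₃ : ℕ}
    (hf : f ≤ 2) (h : g * (1 + a₁ + a₂ + a₃) * f = 4)
    (h' : 1 + b₁ + b₂ + b₃ = (1 + a₁ + a₂ + a₃) * f)
    (ha₁ : a₁ ≤ 1) (hb₁ : b₁ ≤ 1) (hg₁ : g₁ * g₁' = g) (hf₁ : f₁ * f₁' = f)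
    (h₁ : g₁' * (1 + a₁) * f₁' = 2) (h₁' : 1 + b₁ = (1 + a₁) * f₁')
    (ha₂ : a₂ ≤ 1) (hb₂ : b₂ ≤ 1) (hg₂ : g₂ * g₂' = g) (hf₂ : f₂ * f₂' = f)
    (h₂ : g₂' * (1 + a₂) * f₂' = 2) (h₂' : 1 + b₂ = (1 + a₂) * f₂')
    (ha₃ : a₃ ≤ 1) (hb₃ : b₃ ≤ 1) (hg₃ : g₃ * g₃' = g) (hf₃ : f₃ * f₃' = f)
    (h₃ : g₃' * (1 + a₃) * f₃' = 2) (h₃' : 1 + b₃ = (1 + a₃) * f₃') :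
    g * L f + 2 * L 1 = g₁ * L f₁ + g₂ * L f₂ + g₃ * L f₃ := by
  rcases klein_index_cases ha₁ hb₁ h₁ h₁' with ⟨rfl, rfl, rfl, rfl⟩ | ⟨rfl, rfl, rfl, rfl⟩ |
      ⟨rfl, rfl, rfl, rfl⟩ <;>
    rcases klein_index_cases ha₂ hb₂ h₂ h₂' with ⟨rfl, rfl, rfl, rfl⟩ | ⟨rfl, rfl, rfl, rfl⟩ |
      ⟨rfl, rfl, rfl, rfl⟩ <;>
    rcases klein_index_cases ha₃ hb₃ h₃ h₃' with ⟨rfl, rfl, rfl, rfl⟩ | ⟨rfl, rfl, rfl, rfl⟩ |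
      ⟨rfl, rfl, rfl, rfl⟩ <;>
    interval_cases f <;>
    first
    | (exfalso; omega)
    | (obtain ⟨k, hk⟩ : ∃ k, k = g := ⟨_, rfl⟩
       have hk4 : k ≤ 4 := by omega
       have hg1 : g₁ ≤ k := by omega
       have hg2 : g₂ ≤ k := by omega
       have hg3 : g₃ ≤ k := by omega
       have hf1 : f₁ ≤ 2 := by omega
       have hf2 : f₂ ≤ 2 := by omega
       have hf3 : f₃ ≤ 2 := by omega
       interval_cases k <;> first
         | (exfalso; omega)
         | (subst hk
            interval_cases f₁ <;> first
            | (exfalso; omega)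
            | (interval_cases f₂ <;> first
               | (exfalso; omega)
               | (interval_cases f₃ <;> first
                  | (exfalso; omega)
                  | (interval_cases g₁ <;> first
                     | (exfalso; omega)
                     | (interval_cases g₂ <;> first
                        | (exfalso; omega)
                        | (interval_cases g₃ <;> first
                           | (exfalso; omega)
                           | (push_cast; ring))))))))

variable {G : Type*} [Group G]

open Classical in
lemma natCard_subgroupOf_zpowers {σ : G} (h1 : σ ≠ 1) (h2 : σ * σ = 1) (S : Subgroup G) :
    Nat.card (S.subgroupOf (Subgroup.zpowers σ)) = 1 + if σ ∈ S then 1 else 0 := by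
  have h3 : Nat.card (Subgroup.zpowers σ) = 2 := by
    rw [Nat.card_zpowers]
    exact orderOf_eq_prime (by rw [sq, h2]) h1
  split_ifs with h
  · rw [Subgroup.subgroupOf_eq_top.2 (by simpa using h), Subgroup.card_top, h3]
  · have hfin : Finite (Subgroup.zpowers σ) := Nat.finite_of_card_ne_zero (by omega)
    have h4 := Subgroup.card_subgroup_dvd_card (S.subgroupOf (Subgroup.zpowers σ))
    rw [h3, Nat.dvd_prime Nat.prime_two] at h4
    rcases h4 with h4 | h4
    · exact h4
    · rw [← h3, Subgroup.card_eq_iff_eq_top, Subgroup.subgroupOf_eq_top] at h4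
      exact absurd (h4 (Subgroup.mem_zpowers σ)) h

open Classical in
lemma natCard_subgroup_klein {σ₁ σ₂ σ₃ : G} (h01 : σ₁ ≠ 1) (h02 : σ₂ ≠ 1) (h03 : σ₃ ≠ 1)
    (h12 : σ₁ ≠ σ₂) (h13 : σ₁ ≠ σ₃) (h23 : σ₂ ≠ σ₃)
    (hall : ∀ g : G, g = 1 ∨ g = σ₁ ∨ g = σ₂ ∨ g = σ₃) (S : Subgroup G) :
    Nat.card S = 1 + (if σ₁ ∈ S then 1 else 0) + (if σ₂ ∈ S then 1 else 0) +
      (if σ₃ ∈ S then 1 else 0) := by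
  have h : (S : Set G) = ↑(({1, σ₁, σ₂, σ₃} : Finset G).filter (· ∈ S)) := by
    ext g
    have := hall g
    simp only [SetLike.mem_coe, Finset.coe_filter, Finset.mem_insert, Finset.mem_singleton,
      Set.mem_ofPred_eq]
    tauto
  change Nat.card (S : Set G) = _
  rw [h, Nat.card_coe_set_eq, Set.ncard_coe_finset, Finset.card_filter]
  rw [Finset.sum_insert (by simp [h01.symm, h02.symm, h03.symm]),
    Finset.sum_insert (by simp [h12, h13]), Finset.sum_insert (by simp [h23]),
    Finset.sum_singleton]
  simp [S.one_mem, add_assoc]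

end Klein

section Frobenius

variable {F B : Type*} [Field F] [NumberField F] [Field B] [NumberField B] [Algebra F B]

lemma fiberLog_eq {K : Type*} [Field K] [NumberField K] [Algebra F K] [IsGalois F K] (s : ℝ)
    (𝔭 : HeightOneSpectrum (𝓞 F)) (P : Ideal (𝓞 K)) [P.IsPrime] [P.LiesOver 𝔭.asIdeal] :
    fiberLog K s 𝔭 = (𝔭.asIdeal.primesOver (𝓞 K)).ncard *
      -Real.log (1 - normPow s 𝔭.asIdeal ^ (P.inertiaDeg (𝓞 F))) := by
  have := Fintype.ofFinite (PrimesAbove F K 𝔭)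
  rw [fiberLog, tsum_fintype, ← natCard_primesAbove, Nat.card_eq_fintype_card, ← nsmul_eq_mul,
    ← Finset.card_univ]
  apply Finset.sum_eq_card_nsmul
  intro Q _
  have := liesOver_of_primesAbove Q
  have := 𝔭.isMaximal
  have := Q.1.isMaximal
  rw [localLog, normPow_primesAbove, Ideal.inertiaDeg'_eq_inertiaDeg,
    Ideal.inertiaDeg_eq_of_isGaloisGroup 𝔭.asIdeal Q.1.asIdeal P Gal(K/F)]

lemma inertiaDeg_le_two [IsGalois F B] (h2 : ∀ σ : Gal(B/F), σ * σ = 1)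
    (𝔭 : HeightOneSpectrum (𝓞 F)) (Q : Ideal (𝓞 B)) [Q.IsMaximal] [Q.LiesOver 𝔭.asIdeal] :
    Q.inertiaDeg (𝓞 F) ≤ 2 := by
  have := 𝔭.isMaximal
  have hQ0 : Q ≠ ⊥ := Ideal.ne_bot_of_liesOver_of_ne_bot 𝔭.ne_bot Q
  have : Finite (𝓞 B ⧸ Q) := Ideal.finiteQuotientOfFreeOfNeBot Q hQ0
  obtain ⟨σ, hσ⟩ := IsArithFrobAt.exists_of_isInvariant (𝓞 F) Gal(B/F) Q
  let := Ideal.Quotient.field Q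
  set q := Nat.card (𝓞 F ⧸ 𝔭.asIdeal) with hq
  have hunder : Q.under (𝓞 F) = 𝔭.asIdeal := (Ideal.LiesOver.over (P := Q) (p := 𝔭.asIdeal)).symm
  have hfr : ∀ x : 𝓞 B ⧸ Q, x ^ (q ^ 2) = x := by
    intro x
    obtain ⟨x, rfl⟩ := Ideal.Quotient.mk_surjective x
    have h3 := hσ.mk_apply x
    have h4 := hσ.mk_apply (σ • x)
    rw [hunder, ← hq] at h3 h4
    simp only [MulSemiringAction.toAlgHom_apply, smul_smul, h2, one_smul] at h3 h4
    rw [h3, ← pow_mul, ← sq] at h4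
    exact h4.symm
  have hcard : Nat.card (𝓞 B ⧸ Q) = q ^ Q.inertiaDeg (𝓞 F) := by
    have := Ideal.absNorm_eq_pow_inertiaDeg'_of_liesOver Q 𝔭.asIdeal 𝔭.isPrime 𝔭.ne_bot
    rw [Ideal.inertiaDeg'_eq_inertiaDeg] at this
    exact this
  have hq2 : 2 ≤ q := mod_cast two_le_absNorm 𝔭
  obtain ⟨u, hu⟩ := IsCyclic.exists_generator (α := (𝓞 B ⧸ Q)ˣ)
  have h5 := orderOf_eq_card_of_forall_mem_zpowers hu
  rw [Nat.card_units, hcard] at h5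
  have h6 : u ^ (q ^ 2 - 1) = 1 := by
    have : u ^ (q ^ 2) = u := Units.ext (by simpa using hfr u)
    have h7 : u ^ (q ^ 2 - 1) * u = u := by
      rw [← pow_succ, Nat.sub_add_cancel (Nat.one_le_pow _ _ (by omega)), this]
    simpa using h7
  have h8 := orderOf_dvd_of_pow_eq_one h6
  rw [h5] at h8
  have h9 := Nat.le_of_dvd (by have : 2 ^ 2 ≤ q ^ 2 := Nat.pow_le_pow_left hq2 2
                               omega) h8
  by_contra! h
  have : q ^ 2 < q ^ Q.inertiaDeg (𝓞 F) := Nat.pow_lt_pow_right (by omega) h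
  have : 1 ≤ q ^ 2 := Nat.one_le_pow _ _ (by omega)
  omega

open Classical in
lemma exists_fiberLog_eq {K : Type*} [Field K] [NumberField K] [Algebra F K] [Algebra K B]
    [IsScalarTower F K B] [IsGalois F B] [IsGalois F K] {σ : Gal(B/F)} (h1 : σ ≠ 1)
    (h2 : σ * σ = 1) [IsGaloisGroup (Subgroup.zpowers σ) K B] (s : ℝ)
    (𝔭 : HeightOneSpectrum (𝓞 F)) (Q : Ideal (𝓞 B)) [Q.IsMaximal] [Q.LiesOver 𝔭.asIdeal] :
    ∃ g f g' f' : ℕ, fiberLog K s 𝔭 = g * -Real.log (1 - normPow s 𝔭.asIdeal ^ f) ∧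
      g * g' = (𝔭.asIdeal.primesOver (𝓞 B)).ncard ∧ f * f' = Q.inertiaDeg (𝓞 F) ∧
      g' * (1 + if σ ∈ Q.inertia Gal(B/F) then 1 else 0) * f' = 2 ∧
      (1 + if σ ∈ MulAction.stabilizer Gal(B/F) Q then 1 else 0) =
        (1 + if σ ∈ Q.inertia Gal(B/F) then 1 else 0) * f' := by
  have := 𝔭.isMaximal
  set P : Ideal (𝓞 K) := Q.under (𝓞 K) with hP
  have hPQ : Q.LiesOver P := ⟨rfl⟩
  have hP𝔭 : P.LiesOver 𝔭.asIdeal := Ideal.LiesOver.tower_bot Q P 𝔭.asIdeal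
  have hPm : P.IsMaximal := Ideal.isMaximal_comap_of_isIntegral_of_isMaximal Q
  have hQ0 : Q ≠ ⊥ := Ideal.ne_bot_of_liesOver_of_ne_bot 𝔭.ne_bot Q
  have hP0 : P ≠ ⊥ := Ideal.ne_bot_of_liesOver_of_ne_bot 𝔭.ne_bot P
  have : Nonempty (P.primesOver (𝓞 B)) := ⟨⟨Q, inferInstance, hPQ⟩⟩
  have : SMulDistribClass (Subgroup.zpowers σ) (𝓞 B) B :=
    ⟨fun g x y ↦ SMulDistribClass.smul_distrib_smul g.1 x y⟩
  have : IsGaloisGroup (Subgroup.zpowers σ) (𝓞 K) (𝓞 B) :=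
    IsGaloisGroup.of_isFractionRing _ (𝓞 K) (𝓞 B) K B
  have : Finite (𝓞 K ⧸ P) := Ideal.finiteQuotientOfFreeOfNeBot P hP0
  have : Finite P.ResidueField :=
    Finite.of_surjective _ (Ideal.bijective_algebraMap_quotient_residueField P).2
  have hin : Nat.card (Q.inertia (Subgroup.zpowers σ)) =
      1 + if σ ∈ Q.inertia Gal(B/F) then 1 else 0 :=
    natCard_subgroupOf_zpowers h1 h2 (Q.inertia Gal(B/F))
  have hst : Nat.card (MulAction.stabilizer (Subgroup.zpowers σ) Q) =
      1 + if σ ∈ MulAction.stabilizer Gal(B/F) Q then 1 else 0 :=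
    natCard_subgroupOf_zpowers h1 h2 (MulAction.stabilizer Gal(B/F) Q)
  have hcd : Nat.card (Subgroup.zpowers σ) = 2 := by
    rw [Nat.card_zpowers]
    exact orderOf_eq_prime (by rw [sq, h2]) h1
  refine ⟨_, _, (P.primesOver (𝓞 B)).ncard, _, fiberLog_eq s 𝔭 P, ?_,
    (Ideal.inertiaDeg_tower P Q).symm, ?_, ?_⟩
  · exact Ideal.ncard_primesOver_mul_ncard_primesOver P Gal(K/F) (𝓞 B) Gal(B/F)
  · rw [← hin, ← hcd]
    exact Ideal.ncard_primesOver_mul_card_inertia_mul_finrank (G := Subgroup.zpowers σ) P Q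
  · rw [← hin, ← hst]
    exact Ideal.card_stabilizer_eq_card_inertia_mul_finrank (G := Subgroup.zpowers σ) P Q

lemma fiberLog_self (s : ℝ) (𝔭 : HeightOneSpectrum (𝓞 F)) :
    fiberLog F s 𝔭 = -Real.log (1 - normPow s 𝔭.asIdeal) := by
  have : Unique (PrimesAbove F F 𝔭) :=
    { default := ⟨𝔭, HeightOneSpectrum.ext rfl⟩
      uniq := fun Q ↦
        Subtype.ext (HeightOneSpectrum.ext (congr_arg HeightOneSpectrum.asIdeal Q.2)) }
  rw [fiberLog, tsum_eq_single ⟨𝔭, HeightOneSpectrum.ext rfl⟩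
    (fun Q hQ ↦ absurd (Subsingleton.elim _ _) hQ)]
  rfl

variable {K₁ K₂ K₃ : Type*} [Field K₁] [NumberField K₁] [Field K₂] [NumberField K₂]
  [Field K₃] [NumberField K₃] [Algebra F K₁] [Algebra F K₂] [Algebra F K₃]
  [Algebra K₁ B] [Algebra K₂ B] [Algebra K₃ B]
  [IsScalarTower F K₁ B] [IsScalarTower F K₂ B] [IsScalarTower F K₃ B]
  [IsGalois F B] [IsGalois F K₁] [IsGalois F K₂] [IsGalois F K₃]
  {σ₁ σ₂ σ₃ : Gal(B/F)} [IsGaloisGroup (Subgroup.zpowers σ₁) K₁ B]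
  [IsGaloisGroup (Subgroup.zpowers σ₂) K₂ B] [IsGaloisGroup (Subgroup.zpowers σ₃) K₃ B]

theorem fiberLog_klein (h2 : ∀ σ : Gal(B/F), σ * σ = 1)
    (h01 : σ₁ ≠ 1) (h02 : σ₂ ≠ 1) (h03 : σ₃ ≠ 1)
    (h12 : σ₁ ≠ σ₂) (h13 : σ₁ ≠ σ₃) (h23 : σ₂ ≠ σ₃)
    (hall : ∀ g : Gal(B/F), g = 1 ∨ g = σ₁ ∨ g = σ₂ ∨ g = σ₃) (s : ℝ)
    (𝔭 : HeightOneSpectrum (𝓞 F)) :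
    fiberLog B s 𝔭 + 2 * fiberLog F s 𝔭 =
      fiberLog K₁ s 𝔭 + fiberLog K₂ s 𝔭 + fiberLog K₃ s 𝔭 := by
  classical
  have := 𝔭.isMaximal
  obtain ⟨Q, hQ⟩ : Nonempty (𝔭.asIdeal.primesOver (𝓞 B)) := inferInstance
  have := hQ.1
  have := hQ.2
  have hQm : Q.IsMaximal := Ideal.IsMaximal.of_liesOver_isMaximal Q 𝔭.asIdeal
  have : Finite (𝓞 F ⧸ 𝔭.asIdeal) := Ideal.finiteQuotientOfFreeOfNeBot _ 𝔭.ne_bot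
  have : Finite 𝔭.asIdeal.ResidueField :=
    Finite.of_surjective _ (Ideal.bijective_algebraMap_quotient_residueField 𝔭.asIdeal).2
  have hG := natCard_subgroup_klein h01 h02 h03 h12 h13 h23 hall
  have hcard := hG ⊤
  rw [Subgroup.card_top] at hcard
  simp only [Subgroup.mem_top, if_true] at hcard
  have e1 := Ideal.ncard_primesOver_mul_card_inertia_mul_finrank (G := Gal(B/F)) 𝔭.asIdeal Q
  have e2 := Ideal.card_stabilizer_eq_card_inertia_mul_finrank (G := Gal(B/F)) 𝔭.asIdeal Q
  have e3 := inertiaDeg_le_two h2 𝔭 Q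
  rw [hcard, hG] at e1
  rw [hG, hG] at e2
  rw [fiberLog_eq s 𝔭 Q, fiberLog_self]
  obtain ⟨g₁, f₁, g₁', f₁', H1, a1, b1, c1, d1⟩ :=
    exists_fiberLog_eq (K := K₁) h01 (h2 σ₁) s 𝔭 Q
  obtain ⟨g₂, f₂, g₂', f₂', H2, a2, b2, c2, d2⟩ :=
    exists_fiberLog_eq (K := K₂) h02 (h2 σ₂) s 𝔭 Q
  obtain ⟨g₃, f₃, g₃', f₃', H3, a3, b3, c3, d3⟩ :=
    exists_fiberLog_eq (K := K₃) h03 (h2 σ₃) s 𝔭 Q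
  rw [H1, H2, H3]
  have key := klein_sum (fun f ↦ -Real.log (1 - normPow s 𝔭.asIdeal ^ f)) e3 e1 e2
    (by split_ifs <;> omega) (by split_ifs <;> omega) a1 b1 c1 d1
    (by split_ifs <;> omega) (by split_ifs <;> omega) a2 b2 c2 d2
    (by split_ifs <;> omega) (by split_ifs <;> omega) a3 b3 c3 d3
  simpa only [pow_one] using key

theorem log_zr_klein (h2 : ∀ σ : Gal(B/F), σ * σ = 1)
    (h01 : σ₁ ≠ 1) (h02 : σ₂ ≠ 1) (h03 : σ₃ ≠ 1)
    (h12 : σ₁ ≠ σ₂) (h13 : σ₁ ≠ σ₃) (h23 : σ₂ ≠ σ₃)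
    (hall : ∀ g : Gal(B/F), g = 1 ∨ g = σ₁ ∨ g = σ₂ ∨ g = σ₃) {s : ℝ} (hs : 1 < s) :
    Real.log (zr B s) + 2 * Real.log (zr F s) =
      Real.log (zr K₁ s) + Real.log (zr K₂ s) + Real.log (zr K₃ s) := by
  have hl := (hasSum_fiberLog F B hs).add ((hasSum_fiberLog F F hs).mul_left 2)
  have hr := ((hasSum_fiberLog F K₁ hs).add (hasSum_fiberLog F K₂ hs)).add
    (hasSum_fiberLog F K₃ hs)
  refine hl.unique ?_
  convert hr using 2 with 𝔭
  exact fiberLog_klein h2 h01 h02 h03 h12 h13 h23 hall s 𝔭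

theorem zr_klein (h2 : ∀ σ : Gal(B/F), σ * σ = 1)
    (h01 : σ₁ ≠ 1) (h02 : σ₂ ≠ 1) (h03 : σ₃ ≠ 1)
    (h12 : σ₁ ≠ σ₂) (h13 : σ₁ ≠ σ₃) (h23 : σ₂ ≠ σ₃)
    (hall : ∀ g : Gal(B/F), g = 1 ∨ g = σ₁ ∨ g = σ₂ ∨ g = σ₃) {s : ℝ} (hs : 1 < s) :
    zr B s * zr F s ^ 2 = zr K₁ s * zr K₂ s * zr K₃ s := by
  have h := log_zr_klein (K₁ := K₁) (K₂ := K₂) (K₃ := K₃) h2 h01 h02 h03 h12 h13 h23 hall hs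
  have hB := one_le_zr (K := B) hs
  have hF := one_le_zr (K := F) hs
  have hK1 := one_le_zr (K := K₁) hs
  have hK2 := one_le_zr (K := K₂) hs
  have hK3 := one_le_zr (K := K₃) hs
  apply Real.log_injOn_pos (by simp only [Set.mem_Ioi]; positivity)
    (by simp only [Set.mem_Ioi]; positivity)
  rw [Real.log_mul (by positivity) (by positivity), Real.log_mul (by positivity) (by positivity),
    Real.log_mul (by positivity) (by positivity), Real.log_pow]
  exact_mod_cast h

end Frobenius

open Polynomial

section Discriminant

lemma absDisc_eq_natAbs (K : Type*) [Field K] [NumberField K] :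
    absDisc K = ((discr K).natAbs : ℝ) := by
  rw [absDisc, Nat.cast_natAbs, Int.cast_abs]

lemma absDisc_pow_le (K B : Type*) [Field K] [NumberField K] [Field B] [NumberField B]
    [Algebra K B] : absDisc K ^ finrank K B ≤ absDisc B := by
  rw [absDisc_eq_natAbs, absDisc_eq_natAbs,
    natAbs_discr_eq_absNorm_differentIdeal_mul_natAbs_discr_pow K (𝓞 K) B (𝓞 B)]
  have h : (differentIdeal (𝓞 K) (𝓞 B)).absNorm ≠ 0 := by
    intro h
    have h1 := natAbs_discr_eq_absNorm_differentIdeal_mul_natAbs_discr_pow K (𝓞 K) B (𝓞 B)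
    rw [h, zero_mul, Int.natAbs_eq_zero] at h1
    exact discr_ne_zero B h1
  exact_mod_cast Nat.le_mul_of_pos_left _ (Nat.pos_of_ne_zero h)

lemma absDisc_le_of_algebra (K B : Type*) [Field K] [NumberField K] [Field B] [NumberField B]
    [Algebra K B] : absDisc K ≤ absDisc B :=
  (le_self_pow₀ (one_le_absDisc K) finrank_pos.ne').trans (absDisc_pow_le K B)

variable (F K₁ K₂ B : Type*) [Field F] [NumberField F] [Field K₁] [NumberField K₁] [Field K₂]
  [NumberField K₂] [Field B] [NumberField B] [Algebra F K₁] [Algebra F K₂] [Algebra K₁ B]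
  [Algebra K₂ B] [Algebra F B] [IsScalarTower F K₁ B] [IsScalarTower F K₂ B]

lemma absDisc_le_of_quadratic (h₁ : finrank K₁ B = 2) (h₂ : finrank K₂ B = 2) (α : 𝓞 K₁)
    (hα : (minpoly (𝓞 F) α).natDegree = 2)
    (hαK : algebraMap K₁ B α ∉ Set.range (algebraMap K₂ B)) :
    absDisc B ≤ (Ideal.absNorm (Ideal.span {aeval α (derivative (minpoly (𝓞 F) α))}) : ℝ) ^ 2 *
      absDisc K₂ ^ 2 := by
  set β : 𝓞 B := algebraMap (𝓞 K₁) (𝓞 B) α with hβ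
  have hβB : (β : B) = algebraMap K₁ B α := rfl
  have h_int : IsIntegral (𝓞 K₂) β := Algebra.IsIntegral.isIntegral β
  have hintF : IsIntegral (𝓞 F) α := Algebra.IsIntegral.isIntegral α
  have hadj : Algebra.adjoin K₂ {algebraMap (𝓞 B) B β} = ⊤ := by
    have := Subalgebra.isSimpleOrder_of_finrank h₂
    refine (eq_bot_or_eq_top _).resolve_left fun h ↦ hαK ?_
    rw [← hβB]
    exact Algebra.mem_bot.1 (h ▸ Algebra.subset_adjoin (Set.mem_singleton _))
  set p := (minpoly (𝓞 F) α).map (algebraMap (𝓞 F) (𝓞 K₂)) with hp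
  have hpm : p.Monic := (minpoly.monic hintF).map _
  have hp0 : aeval β p = 0 := by
    rw [hp, aeval_map_algebraMap, hβ, aeval_algebraMap_apply, minpoly.aeval, map_zero]
  have hmin : minpoly (𝓞 K₂) β = p := by
    have h2 : 2 ≤ (minpoly (𝓞 K₂) β).natDegree := by
      rw [minpoly.two_le_natDegree_iff h_int]
      rintro ⟨x, hx⟩
      exact hαK ⟨x, by rw [← hβB, ← hx]; rfl⟩
    refine (eq_of_monic_of_dvd_of_natDegree_le (minpoly.monic h_int) hpm
      (minpoly.isIntegrallyClosed_dvd h_int hp0) ?_).symm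
    rwa [hp, (minpoly.monic hintF).natDegree_map, hα]
  have hmem := aeval_derivative_mem_differentIdeal (𝓞 K₂) K₂ B β hadj
  rw [hmin, hp, derivative_map, aeval_map_algebraMap, hβ, aeval_algebraMap_apply] at hmem
  set δ := aeval α (derivative (minpoly (𝓞 F) α)) with hδ
  have hδ0 : δ ≠ 0 := by
    intro h
    have hd0 : derivative (minpoly (𝓞 F) α) ≠ 0 := fun h0 ↦ by
      have := natDegree_eq_zero_of_derivative_eq_zero h0
      omega
    have h3 := natDegree_le_of_dvd (minpoly.isIntegrallyClosed_dvd hintF h) hd0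
    have h4 := natDegree_derivative_lt (p := minpoly (𝓞 F) α) (by omega)
    omega
  have hle : (differentIdeal (𝓞 K₂) (𝓞 B)).absNorm ≤ Ideal.absNorm (Ideal.span {δ}) ^ 2 := by
    have hfr : finrank (𝓞 K₁) (𝓞 B) = 2 := by
      rw [← h₁, Algebra.IsAlgebraic.finrank_of_isFractionRing (𝓞 K₁) K₁ (𝓞 B) B]
    rw [← hfr, ← Ideal.absNorm_algebraMap, Ideal.map_span, Set.image_singleton]
    refine Nat.le_of_dvd (Nat.pos_of_ne_zero ?_) (Ideal.absNorm_dvd_absNorm_of_le ?_)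
    · rw [ne_eq, Ideal.absNorm_eq_zero_iff, Ideal.span_singleton_eq_bot]
      exact (map_ne_zero_iff _ (FaithfulSMul.algebraMap_injective (𝓞 K₁) (𝓞 B))).2 hδ0
    · rwa [Ideal.span_singleton_le_iff_mem]
  rw [absDisc_eq_natAbs, absDisc_eq_natAbs,
    natAbs_discr_eq_absNorm_differentIdeal_mul_natAbs_discr_pow K₂ (𝓞 K₂) B (𝓞 B), h₂]
  push_cast
  gcongr
  exact_mod_cast hle

end Discriminant

section KleinGroup

lemma exists_klein {G : Type*} [Group G] [Finite G] (H₁ H₂ : Subgroup G)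
    (c₁ : Nat.card G = 2 * Nat.card H₁) (c₂ : Nat.card G = 2 * Nat.card H₂) (hne : H₁ ≠ H₂)
    (hinf : H₁ ⊓ H₂ = ⊥) :
    ∃ σ₁ σ₂ σ₃ : G, H₁ = Subgroup.zpowers σ₁ ∧ H₂ = Subgroup.zpowers σ₂ ∧ σ₃ = σ₁ * σ₂ ∧
      (∀ σ : G, σ * σ = 1) ∧ σ₁ ≠ 1 ∧ σ₂ ≠ 1 ∧ σ₃ ≠ 1 ∧ σ₁ ≠ σ₂ ∧ σ₁ ≠ σ₃ ∧ σ₂ ≠ σ₃ ∧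
      (∀ g : G, g = 1 ∨ g = σ₁ ∨ g = σ₂ ∨ g = σ₃) ∧ Nat.card G = 4 := by
  classical
  have i₁ : H₁.index = 2 := by
    have h := H₁.card_mul_index
    rw [c₁, mul_comm] at h
    exact Nat.eq_of_mul_eq_mul_right Nat.card_pos h
  have i₂ : H₂.index = 2 := by
    have h := H₂.card_mul_index
    rw [c₂, mul_comm] at h
    exact Nat.eq_of_mul_eq_mul_right Nat.card_pos h
  have hle : Nat.card G ≤ 4 := by
    have h := Subgroup.index_inf_le (H := H₁) (K := H₂)
    rwa [hinf, Subgroup.index_bot, i₁, i₂] at h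
  have hsq : ∀ σ : G, σ * σ = 1 := fun σ ↦ by
    have h1 := Subgroup.sq_mem_of_index_two i₁ σ
    have h2 := Subgroup.sq_mem_of_index_two i₂ σ
    rw [← sq, ← Subgroup.mem_bot, ← hinf]
    exact ⟨h1, h2⟩
  have hcard : Nat.card H₁ = 2 := by
    have : 0 < Nat.card H₁ := Nat.card_pos
    have h1 : Nat.card H₁ ≠ 1 := fun h ↦ hne <| by
      rw [Subgroup.card_eq_one.1 h, Subgroup.card_eq_one.1 (show Nat.card H₂ = 1 by omega)]
    omega
  have hcard2 : Nat.card H₂ = 2 := by omega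
  have hgen : ∀ H : Subgroup G, Nat.card H = 2 → ∃ σ, H = Subgroup.zpowers σ ∧ σ ≠ 1 := by
    intro H hH
    obtain ⟨x, hx, hx1⟩ := (Subgroup.one_lt_card_iff_ne_bot H).1 (by omega) |>
      (Subgroup.ne_bot_iff_exists_ne_one).1 |> fun ⟨a, ha⟩ ↦
        (⟨a.1, a.2, fun h ↦ ha (Subtype.ext h)⟩ : ∃ x, x ∈ H ∧ x ≠ 1)
    refine ⟨x, ?_, hx1⟩
    symm
    apply Subgroup.eq_of_le_of_card_ge
    · simpa using hx
    · rw [hH, Nat.card_zpowers, orderOf_eq_prime (by rw [sq, hsq]) hx1]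
  obtain ⟨σ₁, e₁, n₁⟩ := hgen H₁ hcard
  obtain ⟨σ₂, e₂, n₂⟩ := hgen H₂ hcard2
  have n12 : σ₁ ≠ σ₂ := by rintro rfl; exact hne (e₁.trans e₂.symm)
  have n3 : σ₁ * σ₂ ≠ 1 := fun h ↦ n12 <| by
    rw [← mul_left_inj σ₂, h, hsq]
  have n13 : σ₁ ≠ σ₁ * σ₂ := fun h ↦ n₂ (by simpa using h.symm)
  have n23 : σ₂ ≠ σ₁ * σ₂ := fun h ↦ n₁ (by simpa using h.symm)
  refine ⟨σ₁, σ₂, σ₁ * σ₂, e₁, e₂, rfl, hsq, n₁, n₂, n3, n12, n13, n23, ?_, by omega⟩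
  have := Fintype.ofFinite G
  have hu : ({1, σ₁, σ₂, σ₁ * σ₂} : Finset G) = Finset.univ := by
    apply Finset.eq_univ_of_card
    rw [← Nat.card_eq_fintype_card,
      Finset.card_insert_of_notMem (by simp [n₁.symm, n₂.symm, n3.symm]),
      Finset.card_insert_of_notMem (by simp [n12, n13, -left_eq_mul]),
      Finset.card_insert_of_notMem (by simp [n23, -right_eq_mul]),
      Finset.card_singleton]
    omega
  intro g
  have hg := Finset.mem_univ g
  rw [← hu] at hg
  simpa using hg

end KleinGroup

section Identity

open Set

lemma eqOn_of_eqOn_Ioi_one {f g : ℝ → ℝ} {c : ℝ} (hc : c < 1) (hf : AnalyticOnNhd ℝ f (Ioi c))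
    (hg : AnalyticOnNhd ℝ g (Ioi c)) (h : EqOn f g (Ioi 1)) : EqOn f g (Ioi c) := by
  refine hf.eqOn_of_preconnected_of_eventuallyEq hg isPreconnected_Ioi (z₀ := 2)
    (by simp only [mem_Ioi]; linarith) ?_
  filter_upwards [Ioi_mem_nhds (show (1 : ℝ) < 2 by norm_num)] with x hx using h hx

lemma sub_finrank_mono (F B : Type*) [Field F] [NumberField F] [Field B] [NumberField B]
    [Algebra F B] : 1 - 1 / (finrank ℚ F : ℝ) ≤ 1 - 1 / (finrank ℚ B : ℝ) := by
  have h : finrank ℚ F ≤ finrank ℚ B := by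
    rw [← finrank_mul_finrank ℚ F B]
    exact Nat.le_mul_of_pos_right _ finrank_pos
  have h0 : (0 : ℝ) < finrank ℚ F := by exact_mod_cast finrank_pos
  gcongr

lemma analyticOnNhd_zetaW_of_algebra (F B : Type*) [Field F] [NumberField F] [Field B]
    [NumberField B] [Algebra F B] :
    AnalyticOnNhd ℝ (zetaW F) (Ioi (1 - 1 / finrank ℚ B : ℝ)) :=
  (analyticOnNhd_zetaW F).mono (Ioi_subset_Ioi (sub_finrank_mono F B))

lemma zetaW_congr (K L : Type*) [Field K] [NumberField K] [Field L] [NumberField L]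
    (e : K ≃+* L) : EqOn (zetaW K) (zetaW L) (Ioi (1 - 1 / finrank ℚ K : ℝ)) := by
  let := e.toRingHom.toAlgebra
  have h1 : finrank K L = 1 := by
    rw [Algebra.finrank_eq_of_equiv_equiv (R₁ := L) (S₁ := L) e (RingEquiv.refl L) (by ext; rfl)]
    simp
  let := e.symm.toRingHom.toAlgebra
  have h2 : finrank L K = 1 := by
    rw [Algebra.finrank_eq_of_equiv_equiv (R₁ := K) (S₁ := K) e.symm (RingEquiv.refl K)
      (by ext; rfl)]
    simp
  refine eqOn_of_eqOn_Ioi_one (sub_finrank_lt_one K) (analyticOnNhd_zetaW K)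
    (analyticOnNhd_zetaW_of_algebra L K) fun s hs ↦ ?_
  have l1 := zr_le_zr_pow K L hs
  have l2 := zr_le_zr_pow L K hs
  rw [h1, pow_one] at l1
  rw [h2, pow_one] at l2
  rw [zetaW_eq K hs, zetaW_eq L hs, le_antisymm l2 l1]

lemma zetaRes_congr (K L : Type*) [Field K] [NumberField K] [Field L] [NumberField L]
    (e : K ≃+* L) : zetaRes K = zetaRes L := by
  rw [← zetaW_one, ← zetaW_one]
  exact zetaW_congr K L e (sub_finrank_lt_one K)

end Identity

section Quartic

lemma exists_int_generator (F K : Type*) [Field F] [NumberField F] [Field K] [NumberField K]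
    [Algebra F K] (h : finrank F K = 2) : ∃ α : 𝓞 K, (minpoly (𝓞 F) α).natDegree = 2 := by
  have hex : ∃ x : K, x ∉ Set.range (algebraMap F K) := by
    by_contra! hall
    have : finrank F K = 1 := by
      rw [finrank_eq_one_iff']
      refine ⟨1, one_ne_zero, fun w ↦ ?_⟩
      obtain ⟨c, hc⟩ := hall w
      exact ⟨c, by rw [Algebra.smul_def, hc, mul_one]⟩
    omega
  obtain ⟨x, hx⟩ := hex
  obtain ⟨y, hy0, hy⟩ := ((IsFractionRing.isAlgebraic_iff ℤ ℚ K).2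
    (Algebra.IsAlgebraic.isAlgebraic (R := ℚ) x)).exists_integral_multiple
  let α : 𝓞 K := ⟨y • x, hy⟩
  have hα : IsIntegral (𝓞 F) α := (RingOfIntegers.isIntegral α).tower_top
  refine ⟨α, le_antisymm ?_ ?_⟩
  · have : NoZeroSMulDivisors (𝓞 F) (𝓞 K) := ⟨fun h ↦ smul_eq_zero.1 h⟩
    have hm := minpoly.natDegree_le (A := F) (algebraMap (𝓞 K) K α)
    rw [minpoly.isIntegrallyClosed_eq_field_fractions F K hα,
      (minpoly.monic hα).natDegree_map] at hm
    omega
  · rw [minpoly.two_le_natDegree_iff hα]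
    rintro ⟨c, hc⟩
    refine hx ⟨(y : F)⁻¹ * algebraMap (𝓞 F) F c, ?_⟩
    have h1 : algebraMap F K (algebraMap (𝓞 F) F c) = (y : K) * x := by
      rw [← IsScalarTower.algebraMap_apply, IsScalarTower.algebraMap_apply (𝓞 F) (𝓞 K) K, hc]
      simp [α]
    have hy1 : (y : K) ≠ 0 := by exact_mod_cast hy0
    rw [map_mul, h1, map_inv₀, map_intCast, inv_mul_cancel_left₀ hy1]

variable (F K₁ K₂ B : Type*) [Field F] [NumberField F] [Field K₁] [NumberField K₁]
  [Field K₂] [NumberField K₂] [Field B] [NumberField B]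
  [Algebra F K₁] [Algebra F K₂] [Algebra F B] [Algebra K₁ B] [Algebra K₂ B]
  [IsScalarTower F K₁ B] [IsScalarTower F K₂ B]

lemma isGalois_of_finrank_two (h : finrank F K₁ = 2) : IsGalois F K₁ :=
  have : Algebra.IsQuadraticExtension F K₁ := ⟨h⟩
  inferInstance

lemma exists_quartic_of_tower [IsGalois F B] (h₁ : finrank F K₁ = 2) (h₂ : finrank F K₂ = 2)
    (hgen : ∀ σ : Gal(B/F), (∀ x, σ (algebraMap K₁ B x) = algebraMap K₁ B x) →
      (∀ x, σ (algebraMap K₂ B x) = algebraMap K₂ B x) → σ = 1)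
    (hne : Set.range (algebraMap K₁ B) ≠ Set.range (algebraMap K₂ B))
    (α : 𝓞 K₁) (hα : (minpoly (𝓞 F) α).natDegree = 2) :
    finrank F B = 4 ∧
    (∃ (K₃ : IntermediateField F B) (_ : NumberField K₃), finrank F K₃ = 2 ∧
      Set.EqOn (fun s ↦ zetaW B s * zetaW F s ^ 2)
        (fun s ↦ zetaW K₁ s * zetaW K₂ s * zetaW K₃ s) (Set.Ioi (1 - 1 / finrank ℚ B : ℝ))) ∧
    absDisc B ≤
      (Ideal.absNorm (Ideal.span {aeval α (derivative (minpoly (𝓞 F) α))}) : ℝ) ^ 2 *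
        absDisc K₂ ^ 2 := by
  have := isGalois_of_finrank_two F K₁ h₁
  have := isGalois_of_finrank_two F K₂ h₂
  have g₁ := IsGaloisGroup.of_isScalarTower Gal(B/F) F B K₁
  have g₂ := IsGaloisGroup.of_isScalarTower Gal(B/F) F B K₂
  set H₁ := fixingSubgroup Gal(B/F) (Set.range (algebraMap K₁ B)) with hH₁
  set H₂ := fixingSubgroup Gal(B/F) (Set.range (algebraMap K₂ B)) with hH₂
  have cG : Nat.card Gal(B/F) = finrank F B := IsGaloisGroup.card_eq_finrank _ _ _
  have c₁ : Nat.card Gal(B/F) = 2 * Nat.card H₁ := by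
    rw [cG, IsGaloisGroup.card_eq_finrank H₁ K₁ B, ← h₁, finrank_mul_finrank]
  have c₂ : Nat.card Gal(B/F) = 2 * Nat.card H₂ := by
    rw [cG, IsGaloisGroup.card_eq_finrank H₂ K₂ B, ← h₂, finrank_mul_finrank]
  have hH : H₁ ≠ H₂ := fun h ↦ hne <| by
    have e1 := IsGaloisGroup.fixedPoints_eq_range_algebraMap Gal(B/F) F B H₁ K₁
    have e2 := IsGaloisGroup.fixedPoints_eq_range_algebraMap Gal(B/F) F B H₂ K₂
    rw [← e1, ← e2, h]
  have hinf : H₁ ⊓ H₂ = ⊥ := by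
    rw [eq_bot_iff]
    rintro σ ⟨hs₁, hs₂⟩
    exact hgen σ (fun x ↦ (mem_fixingSubgroup_iff _).1 hs₁ _ ⟨x, rfl⟩)
      (fun x ↦ (mem_fixingSubgroup_iff _).1 hs₂ _ ⟨x, rfl⟩)
  obtain ⟨σ₁, σ₂, σ₃, e₁, e₂, e₃, hsq, n₁, n₂, n₃, n12, n13, n23, hall, h4⟩ :=
    exists_klein H₁ H₂ c₁ c₂ hH hinf
  have hB : finrank F B = 4 := by rw [← cG, h4]
  have hf₁ : finrank K₁ B = 2 := by rw [← IsGaloisGroup.card_eq_finrank H₁ K₁ B]; omega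
  have hf₂ : finrank K₂ B = 2 := by rw [← IsGaloisGroup.card_eq_finrank H₂ K₂ B]; omega
  refine ⟨hB, ?_, ?_⟩
  · let K₃ : IntermediateField F B := FixedPoints.intermediateField (Subgroup.zpowers σ₃)
    have hg₃ : IsGaloisGroup (Subgroup.zpowers σ₃) K₃ B := inferInstance
    have : NumberField K₃ := inferInstance
    have hf₃ : finrank F K₃ = 2 := by
      have h := finrank_mul_finrank F K₃ B
      rw [← IsGaloisGroup.card_eq_finrank (Subgroup.zpowers σ₃) K₃ B, hB, Nat.card_zpowers,
        orderOf_eq_prime (by rw [sq, hsq]) n₃] at h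
      omega
    have := isGalois_of_finrank_two F K₃ hf₃
    rw [e₁] at g₁
    rw [e₂] at g₂
    refine ⟨K₃, inferInstance, hf₃, eqOn_of_eqOn_Ioi_one (sub_finrank_lt_one B) ?_ ?_ ?_⟩
    · exact (analyticOnNhd_zetaW B).mul ((analyticOnNhd_zetaW_of_algebra F B).pow 2)
    · exact ((analyticOnNhd_zetaW_of_algebra K₁ B).mul (analyticOnNhd_zetaW_of_algebra K₂ B)).mul
        (analyticOnNhd_zetaW_of_algebra K₃ B)
    · intro s hs
      have h := zr_klein (K₁ := K₁) (K₂ := K₂) (K₃ := K₃) hsq n₁ n₂ n₃ n12 n13 n23 hall hs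
      simp only [zetaW_eq B hs, zetaW_eq F hs, zetaW_eq K₁ hs, zetaW_eq K₂ hs, zetaW_eq K₃ hs]
      linear_combination (s - 1) ^ 3 * h
  · refine absDisc_le_of_quadratic F K₁ K₂ B hf₁ hf₂ α hα ?_
    rintro ⟨y, hy⟩
    have s₁ : σ₁ (algebraMap K₁ B α) = algebraMap K₁ B α :=
      (mem_fixingSubgroup_iff _).1 (show σ₁ ∈ H₁ by simp [e₁]) _ ⟨_, rfl⟩
    have s₂ : σ₂ (algebraMap K₁ B α) = algebraMap K₁ B α :=
      (mem_fixingSubgroup_iff _).1 (show σ₂ ∈ H₂ by simp [e₂]) _ ⟨y, hy⟩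
    obtain ⟨c, hc⟩ := (IsGalois.mem_range_algebraMap_iff_fixed (F := F) (algebraMap K₁ B α)).2
      fun g ↦ by
        rcases hall g with rfl | rfl | rfl | rfl
        · simp
        · exact s₁
        · exact s₂
        · rw [e₃, AlgEquiv.mul_apply, s₂, s₁]
    rw [IsScalarTower.algebraMap_apply F K₁ B] at hc
    have hc' := (algebraMap K₁ B).injective hc
    have h_int : IsIntegral ℤ c := by
      rw [← isIntegral_algebraMap_iff (algebraMap F K₁).injective, hc']
      exact α.2
    refine ((minpoly.two_le_natDegree_iff
      (RingOfIntegers.isIntegral α).tower_top).1 hα.ge) ⟨⟨c, h_int⟩, ?_⟩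
    apply RingOfIntegers.ext
    rw [← hc']
    rfl

end Quartic

section QuarticExists

variable (F K₁ K₂ : Type) [Field F] [NumberField F] [Field K₁] [NumberField K₁]
  [Field K₂] [NumberField K₂] [Algebra F K₁] [Algebra F K₂]

lemma exists_quartic (h₁ : finrank F K₁ = 2) (h₂ : finrank F K₂ = 2)
    (hne : IsEmpty (K₁ ≃ₐ[F] K₂)) (α : 𝓞 K₁) (hα : (minpoly (𝓞 F) α).natDegree = 2) :
    ∃ (B : Type) (_ : Field B) (_ : NumberField B) (K₃ : Type) (_ : Field K₃) (_ : NumberField K₃),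
      finrank ℚ B = 4 * finrank ℚ F ∧ finrank ℚ K₃ = 2 * finrank ℚ F ∧
      Set.EqOn (fun s ↦ zetaW B s * zetaW F s ^ 2)
        (fun s ↦ zetaW K₁ s * zetaW K₂ s * zetaW K₃ s) (Set.Ioi (1 - 1 / finrank ℚ B : ℝ)) ∧
      absDisc K₃ ≤ absDisc B ∧
      absDisc B ≤
        (Ideal.absNorm (Ideal.span {aeval α (derivative (minpoly (𝓞 F) α))}) : ℝ) ^ 2 *
          absDisc K₂ ^ 2 := by
  have := isGalois_of_finrank_two F K₁ h₁
  have := isGalois_of_finrank_two F K₂ h₂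
  let i₁ : K₁ →ₐ[F] AlgebraicClosure F := IsAlgClosed.lift
  let i₂ : K₂ →ₐ[F] AlgebraicClosure F := IsAlgClosed.lift
  let e₁ : K₁ ≃ₐ[F] i₁.fieldRange := AlgEquiv.ofInjectiveField i₁
  let e₂ : K₂ ≃ₐ[F] i₂.fieldRange := AlgEquiv.ofInjectiveField i₂
  have : Normal F i₁.fieldRange := Normal.of_algEquiv e₁
  have : Normal F i₂.fieldRange := Normal.of_algEquiv e₂
  have : FiniteDimensional F i₁.fieldRange := e₁.toLinearEquiv.finiteDimensional
  have : FiniteDimensional F i₂.fieldRange := e₂.toLinearEquiv.finiteDimensional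
  let B := (i₁.fieldRange ⊔ i₂.fieldRange : IntermediateField F (AlgebraicClosure F))
  have : Normal F B := inferInstance
  have : FiniteDimensional F B := inferInstance
  have : NumberField B := NumberField.of_module_finite F B
  have : IsGalois F B := ⟨⟩
  let j₁ : K₁ →ₐ[F] B := (IntermediateField.inclusion le_sup_left).comp e₁.toAlgHom
  let j₂ : K₂ →ₐ[F] B := (IntermediateField.inclusion le_sup_right).comp e₂.toAlgHom
  have hj₁ : ∀ x, ((j₁ x : B) : AlgebraicClosure F) = i₁ x := fun x ↦ rfl
  have hj₂ : ∀ x, ((j₂ x : B) : AlgebraicClosure F) = i₂ x := fun x ↦ rfl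
  let := j₁.toRingHom.toAlgebra
  let := j₂.toRingHom.toAlgebra
  have : IsScalarTower F K₁ B := IsScalarTower.of_algebraMap_eq fun x ↦ (j₁.commutes x).symm
  have : IsScalarTower F K₂ B := IsScalarTower.of_algebraMap_eq fun x ↦ (j₂.commutes x).symm
  have hgen : ∀ σ : Gal(B/F), (∀ x, σ (algebraMap K₁ B x) = algebraMap K₁ B x) →
      (∀ x, σ (algebraMap K₂ B x) = algebraMap K₂ B x) → σ = 1 := by
    intro σ hσ₁ hσ₂
    let L : IntermediateField F B := IntermediateField.fixedField (Subgroup.zpowers σ)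
    have hL : ∀ x : B, σ x = x → x ∈ L := fun x hx ↦ by
      rw [IntermediateField.mem_fixedField_iff]
      intro f hf
      obtain ⟨n, rfl⟩ := Subgroup.mem_zpowers_iff.1 hf
      exact (zpow_mem (show σ ∈ MulAction.stabilizer Gal(B/F) x from hx) n)
    have hle : B ≤ IntermediateField.lift L := by
      refine sup_le ?_ ?_
      · rintro _ ⟨x, rfl⟩
        exact (IntermediateField.mem_lift (j₁ x)).2 (hL _ (hσ₁ x))
      · rintro _ ⟨x, rfl⟩
        exact (IntermediateField.mem_lift (j₂ x)).2 (hL _ (hσ₂ x))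
    ext1 x
    have hx := (IntermediateField.mem_lift x).1 (hle x.2)
    exact (IntermediateField.mem_fixedField_iff _ _).1 hx σ (Subgroup.mem_zpowers σ)
  have hr : Set.range (algebraMap K₁ B) ≠ Set.range (algebraMap K₂ B) := by
    intro hr
    have hrange : i₁.fieldRange = i₂.fieldRange := by
      apply SetLike.coe_injective
      have h1 : (i₁.fieldRange : Set (AlgebraicClosure F)) =
          Subtype.val '' Set.range (algebraMap K₁ B) := by
        rw [← Set.range_comp]; rfl
      have h2 : (i₂.fieldRange : Set (AlgebraicClosure F)) =
          Subtype.val '' Set.range (algebraMap K₂ B) := by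
        rw [← Set.range_comp]; rfl
      rw [h1, h2, hr]
    exact hne.false (e₁.trans ((IntermediateField.equivOfEq hrange).trans e₂.symm))
  obtain ⟨hB, ⟨K₃, hK₃, hf₃, heq⟩, hd⟩ := exists_quartic_of_tower F K₁ K₂ B h₁ h₂ hgen hr α hα
  refine ⟨B, inferInstance, inferInstance, K₃, inferInstance, hK₃, ?_, ?_, heq,
    absDisc_le_of_algebra K₃ B, hd⟩
  · rw [← finrank_mul_finrank ℚ F B, hB, mul_comm]
  · rw [← finrank_mul_finrank ℚ F K₃, hf₃, mul_comm]

end QuarticExists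

section Siegel

lemma exists_zetaW_eq_zero {K : Type*} [Field K] [NumberField K] {β : ℝ}
    (h1 : 1 - 1 / finrank ℚ K < β) (h2 : β < 1) (h : zetaW K β ≤ 0) :
    ∃ γ ∈ Ico β 1, zetaW K γ = 0 := by
  have hc : ContinuousOn (zetaW K) (Icc β 1) :=
    (analyticOnNhd_zetaW K).continuousOn.mono fun x hx ↦ h1.trans_le hx.1
  obtain ⟨γ, hγ, h0⟩ := intermediate_value_Icc h2.le hc ⟨h, by
    rw [zetaW_one]; exact (zetaRes_pos K).le⟩
  refine ⟨γ, ⟨hγ.1, hγ.2.lt_of_ne ?_⟩, h0⟩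
  rintro rfl
  rw [zetaW_one] at h0
  exact (zetaRes_pos K).ne' h0

lemma exists_zetaW_pos (F : Type*) [Field F] [NumberField F] :
    ∃ δ > 0, ∀ s ∈ Ioo (1 - δ) 1, 0 < zetaW F s := by
  have hc : ContinuousAt (zetaW F) 1 :=
    ((analyticOnNhd_zetaW F) 1 (sub_finrank_lt_one F)).continuousAt
  have h1 : 0 < zetaW F 1 := by rw [zetaW_one]; exact zetaRes_pos F
  obtain ⟨δ, hδ, h⟩ := Metric.eventually_nhds_iff.1 (hc.eventually (lt_mem_nhds h1))
  refine ⟨δ, hδ, fun s hs ↦ h ?_⟩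
  rw [Real.dist_eq, abs_lt]
  constructor <;> linarith [hs.1, hs.2]

variable (F : Type) [Field F] [NumberField F]

lemma exists_le_zetaRes_of_ne_zero {ε δ : ℝ} (hδ : 0 < δ)
    (hδ1 : δ ≤ 1 / (8 * finrank ℚ F))
    (hδε : 2 * (4 * finrank ℚ F : ℕ) * ((4 * finrank ℚ F + 1) * (4 * finrank ℚ F) : ℕ) * δ ≤ ε)
    (h : ∀ (K : Type) [Field K] [NumberField K] [Algebra F K], finrank F K = 2 →
      ∀ s ∈ Ioo (1 - δ) 1, zetaW K s ≠ 0) :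
    ∃ c, 0 < c ∧ ∀ (K : Type) [Field K] [NumberField K] [Algebra F K], finrank F K = 2 →
      c ≤ zetaRes K * absDisc K ^ ε := by
  have hm : 0 < finrank ℚ F := finrank_pos
  have hm' : (1 : ℝ) ≤ finrank ℚ F := by exact_mod_cast hm
  set m := finrank ℚ F
  have hδ2 : δ ≤ 1 / (2 * (2 * m : ℕ)) := by
    refine hδ1.trans (one_div_le_one_div_of_le (by positivity) ?_)
    push_cast
    linarith
  obtain ⟨c, hc, H⟩ := exists_le_zetaRes_of_zetaW_nonneg (2 * m) (by omega) (β := 1 - δ / 2)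
    (by linarith) (by linarith)
  refine ⟨c, hc, fun K _ _ _ hK ↦ ?_⟩
  have hn : finrank ℚ K = 2 * m := by rw [← finrank_mul_finrank ℚ F K, hK, mul_comm]
  refine (H K hn ?_).trans ?_
  · by_contra! hneg
    obtain ⟨γ, hγ, h0⟩ := exists_zetaW_eq_zero (K := K) (β := 1 - δ / 2) (by
      rw [hn]
      have : (1 : ℝ) / (2 * (2 * m : ℕ)) ≤ 1 / (2 * m : ℕ) := by
        gcongr
        push_cast
        linarith
      linarith) (by linarith) hneg.le
    exact h K hK γ ⟨by linarith [hγ.1], hγ.2⟩ h0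
  · refine mul_le_mul_of_nonneg_left ?_ (zetaRes_pos K).le
    refine Real.rpow_le_rpow_of_exponent_le (one_le_absDisc K) (le_trans ?_ hδε)
    rw [sub_sub_cancel]
    gcongr <;> linarith

lemma le_zetaRes_of_quartic {ε β c C D κF κB κ₁ κ₂ κ₃ dB d₂ d₃ : ℝ}
    (hκ : κB * κF ^ 2 = κ₁ * κ₂ * κ₃) (hc : c ≤ κB * dB ^ β) (hβ : β ≤ ε / 4)
    (hC : κ₃ ≤ C * d₃ ^ (ε / 4)) (h3 : d₃ ≤ dB) (hD : dB ≤ D * d₂ ^ 2) (hε : 0 < ε)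
    (h1 : 1 ≤ d₃) (h2 : 1 ≤ d₂) (hD0 : 0 < D) (hC0 : 0 < C) (hκ₁ : 0 < κ₁) (hκ₂ : 0 < κ₂)
    (hκB : 0 < κB) (hκF : 0 < κF) :
    c * κF ^ 2 / (κ₁ * C * D ^ (ε / 2)) ≤ κ₂ * d₂ ^ ε := by
  have hB : 1 ≤ dB := h1.trans h3
  have hB0 : 0 < dB := by linarith
  rw [div_le_iff₀ (by positivity)]
  calc c * κF ^ 2 ≤ (κB * dB ^ (ε / 4)) * κF ^ 2 := by
        gcongr
        exact hc.trans (by gcongr)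
    _ = κ₁ * κ₂ * κ₃ * dB ^ (ε / 4) := by rw [← hκ]; ring
    _ ≤ κ₁ * κ₂ * (C * dB ^ (ε / 4)) * dB ^ (ε / 4) := by
        gcongr
        exact hC.trans (by gcongr)
    _ = κ₁ * κ₂ * C * dB ^ (ε / 2) := by
        rw [show ε / 2 = ε / 4 + ε / 4 by ring, Real.rpow_add hB0]; ring
    _ ≤ κ₁ * κ₂ * C * (D * d₂ ^ 2) ^ (ε / 2) := by gcongr
    _ = κ₂ * d₂ ^ ε * (κ₁ * C * D ^ (ε / 2)) := by
        rw [Real.mul_rpow hD0.le (by positivity),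
          ← Real.rpow_natCast, ← Real.rpow_mul (by linarith)]
        rw [show ((2 : ℕ) : ℝ) * (ε / 2) = ε by push_cast; ring]
        ring

lemma absDisc_congr (K L : Type*) [Field K] [NumberField K] [Field L] [NumberField L]
    (e : K ≃+* L) : absDisc K = absDisc L := by
  rw [absDisc, absDisc, discr_eq_discr_of_ringEquiv K e]

lemma exists_le_zetaRes_of_eq_zero {ε δ : ℝ} (hε : 0 < ε)
    (hδ1 : δ ≤ 1 / (8 * finrank ℚ F))
    (hδε : 2 * (4 * finrank ℚ F : ℕ) * ((4 * finrank ℚ F + 1) * (4 * finrank ℚ F) : ℕ) * δ ≤ ε / 4)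
    (K₁ : Type) [Field K₁] [NumberField K₁] [Algebra F K₁] (hK₁ : finrank F K₁ = 2)
    {β : ℝ} (hβ : β ∈ Ioo (1 - δ) 1) (hF : 0 < zetaW F β) (h0 : zetaW K₁ β = 0) :
    ∃ c, 0 < c ∧ ∀ (K : Type) [Field K] [NumberField K] [Algebra F K], finrank F K = 2 →
      c ≤ zetaRes K * absDisc K ^ ε := by
  have hm : 0 < finrank ℚ F := finrank_pos
  have hm' : (1 : ℝ) ≤ finrank ℚ F := by exact_mod_cast hm
  set m := finrank ℚ F
  obtain ⟨c, hc, H⟩ := exists_le_zetaRes_of_zetaW_nonneg (4 * m) (by omega) (β := β) (by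
    have : (1 : ℝ) / (2 * (4 * m : ℕ)) = 1 / (8 * m) := by push_cast; ring
    linarith [hβ.1]) hβ.2
  obtain ⟨C, hC, HC⟩ := exists_zetaRes_le (2 * m) (ε := ε / 4) (by positivity)
  obtain ⟨α, hα⟩ := exists_int_generator F K₁ hK₁
  set N : ℝ := (Ideal.absNorm (Ideal.span {aeval α (derivative (minpoly (𝓞 F) α))}) : ℝ)
  have hκ₁ := zetaRes_pos K₁
  have hκF := zetaRes_pos F
  refine ⟨min (zetaRes K₁) (c * zetaRes F ^ 2 / (zetaRes K₁ * C * (N ^ 2 + 1) ^ (ε / 2))),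
    by positivity, fun K _ _ _ hK ↦ ?_⟩
  have hd : 1 ≤ absDisc K := one_le_absDisc K
  have hκ := zetaRes_pos K
  by_cases hne : IsEmpty (K₁ ≃ₐ[F] K)
  · refine (min_le_right _ _).trans ?_
    obtain ⟨B, _, _, K₃, _, _, hB, hK₃, heq, h3, hBD⟩ := exists_quartic F K₁ K hK₁ hK hne α hα
    have hz : zetaW B β = 0 := by
      have h := heq (show β ∈ Ioi (1 - 1 / finrank ℚ B : ℝ) by
        rw [hB, mem_Ioi]
        have : (1 : ℝ) / (8 * m) ≤ 1 / (4 * m : ℕ) := by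
          push_cast
          gcongr
          linarith
        linarith [hβ.1])
      simp only [h0, zero_mul] at h
      exact (mul_eq_zero.1 h).resolve_right (by positivity)
    have hres := heq (sub_finrank_lt_one B)
    simp only [zetaW_one] at hres
    refine le_zetaRes_of_quartic hres (H B hB hz.ge) ?_ (HC K₃ hK₃) h3 (D := N ^ 2 + 1) ?_ hε
      (one_le_absDisc K₃) hd (by positivity) hC hκ₁ hκ (zetaRes_pos B) hκF
    · refine le_trans ?_ hδε
      gcongr
      linarith [hβ.1]
    · refine hBD.trans ?_
      gcongr
      linarith
  · refine (min_le_left _ _).trans ?_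
    rw [not_isEmpty_iff] at hne
    obtain ⟨e⟩ := hne
    rw [zetaRes_congr K₁ K e.toRingEquiv]
    exact le_mul_of_one_le_right hκ.le (Real.one_le_rpow hd hε.le)

theorem exists_le_zetaRes {ε : ℝ} (hε : 0 < ε) :
    ∃ c, 0 < c ∧ ∀ (K : Type) [Field K] [NumberField K] [Algebra F K], finrank F K = 2 →
      c ≤ zetaRes K * absDisc K ^ ε := by
  have hm : (0 : ℝ) < finrank ℚ F := by exact_mod_cast finrank_pos
  obtain ⟨δ₀, hδ₀, hF⟩ := exists_zetaW_pos F
  set A : ℝ := 2 * (4 * finrank ℚ F : ℕ) * ((4 * finrank ℚ F + 1) * (4 * finrank ℚ F) : ℕ)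
    with hA
  have hA0 : 0 < A := by
    rw [hA]
    push_cast
    positivity
  obtain ⟨δ, hδ, h1, h2, h3⟩ : ∃ δ : ℝ, 0 < δ ∧ δ ≤ δ₀ ∧ δ ≤ 1 / (8 * finrank ℚ F) ∧
      A * δ ≤ ε / 4 :=
    ⟨min δ₀ (min (1 / (8 * finrank ℚ F)) (ε / 4 / A)), by positivity, min_le_left _ _,
      (min_le_right _ _).trans (min_le_left _ _), by
        rw [mul_comm, ← le_div_iff₀ hA0]
        exact (min_le_right _ _).trans (min_le_right _ _)⟩
  by_cases h : ∀ (K : Type) [Field K] [NumberField K] [Algebra F K], finrank F K = 2 →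
      ∀ s ∈ Ioo (1 - δ) 1, zetaW K s ≠ 0
  · exact exists_le_zetaRes_of_ne_zero F hδ h2 (h3.trans (by linarith)) h
  · push Not at h
    obtain ⟨K₁, _, _, _, hK₁, β, hβ, h0⟩ := h
    exact exists_le_zetaRes_of_eq_zero F hε h2 h3 K₁ hK₁ hβ
      (hF β ⟨by linarith [hβ.1], hβ.2⟩) h0

end Siegel

section ClassNumber

lemma torsionOrder_dvd_factorial (K : Type*) [Field K] [NumberField K] :
    torsionOrder K ∣ (2 * finrank ℚ K).factorial := by
  have hn : 0 < finrank ℚ K := finrank_pos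
  have htot : (torsionOrder K).totient ≤ finrank ℚ K := by
    obtain ⟨g, hg⟩ := IsCyclic.exists_generator (α := torsion K)
    have ho : orderOf g = torsionOrder K := orderOf_eq_card_of_forall_mem_zpowers hg
    have hp : IsPrimitiveRoot ((g : (𝓞 K)ˣ) : K) (torsionOrder K) := by
      rw [← ho, IsPrimitiveRoot.coe_coe_iff]
      exact (IsPrimitiveRoot.orderOf g).map_of_injective (f := (torsion K).subtype)
        Subtype.val_injective
    have hi : IsIntegral ℤ ((g : (𝓞 K)ˣ) : K) := (g : (𝓞 K)ˣ).val.isIntegral_coe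
    refine hp.totient_le_degree_minpoly.trans ?_
    have h := minpoly.isIntegrallyClosed_eq_field_fractions' ℚ hi
    have h2 := minpoly.natDegree_le (A := ℚ) ((g : (𝓞 K)ˣ) : K)
    rwa [h, (minpoly.monic hi).natDegree_map] at h2
  rw [Nat.dvd_iff_prime_pow_dvd_dvd]
  intro p k hp hk
  rcases Nat.eq_zero_or_pos k with rfl | hk0
  · simp
  apply Nat.dvd_factorial (pow_pos hp.pos k)
  have h1 : (p ^ k).totient ≤ finrank ℚ K :=
    (Nat.le_of_dvd (Nat.totient_pos.2 (torsionOrder_pos K)) (Nat.totient_dvd_of_dvd hk)).trans htot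
  rw [Nat.totient_prime_pow hp hk0] at h1
  have h2 : p ^ k = p ^ (k - 1) * p := by rw [← pow_succ, Nat.sub_add_cancel hk0]
  have h3 : p ≤ 2 * (p - 1) := by have := hp.two_le; omega
  calc p ^ k = p ^ (k - 1) * p := h2
    _ ≤ p ^ (k - 1) * (2 * (p - 1)) := by gcongr
    _ = 2 * (p ^ (k - 1) * (p - 1)) := by ring
    _ ≤ 2 * finrank ℚ K := by gcongr

lemma torsionOrder_le_factorial (K : Type*) [Field K] [NumberField K] :
    torsionOrder K ≤ (2 * finrank ℚ K).factorial :=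
  Nat.le_of_dvd (Nat.factorial_pos _) (torsionOrder_dvd_factorial K)

lemma torsionOrder_congr (K L : Type*) [Field K] [NumberField K] [Field L] [NumberField L]
    (e : K ≃+* L) : torsionOrder K = torsionOrder L := by
  let u : (𝓞 K)ˣ ≃* (𝓞 L)ˣ := Units.mapEquiv (RingOfIntegers.mapRingEquiv e).toMulEquiv
  refine Nat.card_congr (u.toEquiv.subtypeEquiv fun a ↦ ?_)
  simp only [torsion, CommGroup.mem_torsion]
  exact (Function.Injective.isOfFinOrder_iff (f := u.toMonoidHom) u.injective).symm

lemma classNumber_congr (K L : Type*) [Field K] [NumberField K] [Field L] [NumberField L]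
    (e : K ≃+* L) : classNumber K = classNumber L := by
  rw [classNumber, classNumber]
  exact Fintype.card_congr (ClassGroup.mulEquiv (RingOfIntegers.mapRingEquiv e)).toEquiv

lemma zetaRes_mul_eq (K : Type*) [Field K] [NumberField K] :
    zetaRes K * (torsionOrder K * √(absDisc K)) =
      2 ^ nrRealPlaces K * (2 * Real.pi) ^ nrComplexPlaces K * regulator K * classNumber K := by
  have h1 : (0 : ℝ) < torsionOrder K := by exact_mod_cast torsionOrder_pos K
  have h2 : 0 < √(absDisc K) := Real.sqrt_pos.2 (absDisc_pos K)
  rw [zetaRes_eq, dedekindZeta_residue_def, absDisc, div_mul_cancel₀]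
  rw [absDisc] at h2
  positivity

lemma regulator_congr (K L : Type*) [Field K] [NumberField K] [IsTotallyReal K]
    [Field L] [NumberField L] [IsTotallyReal L] (e : K ≃+* L) : regulator K = regulator L := by
  have hK := zetaRes_mul_eq K
  have hL := zetaRes_mul_eq L
  have hr : nrRealPlaces K = nrRealPlaces L := by
    rw [← IsTotallyReal.finrank, ← IsTotallyReal.finrank]
    exact (AlgEquiv.ofRingEquiv (f := e) (R := ℚ) fun r ↦ by simp).toLinearEquiv.finrank_eq
  rw [zetaRes_congr K L e, torsionOrder_congr K L e, absDisc_congr K L e, hL,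
    classNumber_congr K L e, hr, IsTotallyReal.nrComplexPlaces_eq_zero,
    IsTotallyReal.nrComplexPlaces_eq_zero] at hK
  have h1 : (classNumber L : ℝ) ≠ 0 := by exact_mod_cast classNumber_ne_zero L
  have h2 : (2 : ℝ) ^ nrRealPlaces L * (2 * Real.pi) ^ 0 ≠ 0 := by positivity
  exact (mul_left_cancel₀ h2 (mul_right_cancel₀ h1 hK)).symm

variable (F K : Type*) [Field F] [NumberField F] [IsTotallyReal F] [Field K] [NumberField K]
  [IsTotallyComplex K] [Algebra F K]

lemma regulator_bounds (h : finrank F K = 2) :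
    regulator F ≤ 2 * regulator K ∧ regulator K ≤ 2 ^ finrank ℚ K * regulator F := by
  have : Algebra.IsQuadraticExtension F K := ⟨h⟩
  have : IsCMField K := IsCMField.ofCMExtension F K
  have hc := regulator_congr F (maximalRealSubfield K) (CMExtension.equivMaximalRealSubfield F K)
  have hF : 0 < regulator F := regulator_pos F
  have hr := IsCMField.regulator_div_regulator_eq_two_pow_mul_indexRealUnits_inv K
  rw [← hc, div_eq_iff hF.ne'] at hr
  have h1 : (1 : ℝ) ≤ 2 ^ rank K := one_le_pow₀ one_le_two
  have h2 : (2 : ℝ) ^ rank K ≤ 2 ^ finrank ℚ K := pow_le_pow_right₀ one_le_two rank_le_finrank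
  rw [hr]
  rcases IsCMField.indexRealUnits_eq_one_or_two K with hi | hi <;> rw [hi]
  · simp only [Nat.cast_one, inv_one, mul_one]
    constructor <;> nlinarith
  · simp only [Nat.cast_ofNat]
    constructor <;> nlinarith

end ClassNumber

section Bounds

variable (F : Type) [Field F] [NumberField F] [IsTotallyReal F]

lemma le_classNumber_of_quadratic (K : Type) [Field K] [NumberField K] [IsTotallyComplex K]
    [Algebra F K] (h : finrank F K = 2) :
    zetaRes K * √(absDisc K) ≤
      (2 * Real.pi) ^ finrank ℚ F * (2 ^ (2 * finrank ℚ F) * regulator F) * classNumber K := by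
  have hn : finrank ℚ K = 2 * finrank ℚ F := by rw [← finrank_mul_finrank ℚ F K, h, mul_comm]
  have hc : nrComplexPlaces K = finrank ℚ F := by
    have := IsTotallyComplex.finrank (K := K)
    omega
  have hz := zetaRes_mul_eq K
  rw [IsTotallyComplex.nrRealPlaces_eq_zero, hc, pow_zero, one_mul] at hz
  have hw : (1 : ℝ) ≤ torsionOrder K := by exact_mod_cast torsionOrder_pos K
  have hκ := zetaRes_pos K
  have hR := (regulator_bounds F K h).2
  rw [hn] at hR
  calc zetaRes K * √(absDisc K) ≤ zetaRes K * (torsionOrder K * √(absDisc K)) := by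
        gcongr
        exact le_mul_of_one_le_left (Real.sqrt_nonneg _) hw
    _ ≤ _ := by
        rw [hz]
        gcongr

lemma classNumber_le_of_quadratic (K : Type) [Field K] [NumberField K] [IsTotallyComplex K]
    [Algebra F K] (h : finrank F K = 2) :
    regulator F / 2 * classNumber K ≤
      zetaRes K * ((4 * finrank ℚ F).factorial * √(absDisc K)) := by
  have hn : finrank ℚ K = 2 * finrank ℚ F := by rw [← finrank_mul_finrank ℚ F K, h, mul_comm]
  have hz := zetaRes_mul_eq K
  rw [IsTotallyComplex.nrRealPlaces_eq_zero, pow_zero, one_mul] at hz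
  have hw : (torsionOrder K : ℝ) ≤ (4 * finrank ℚ F).factorial := by
    have := torsionOrder_le_factorial K
    rw [hn, ← mul_assoc] at this
    exact_mod_cast this
  have hκ := zetaRes_pos K
  have hR := (regulator_bounds F K h).1
  have hRK : 0 < regulator K := regulator_pos K
  have hpi : (1 : ℝ) ≤ (2 * Real.pi) ^ nrComplexPlaces K :=
    one_le_pow₀ (by linarith [Real.two_le_pi])
  calc regulator F / 2 * classNumber K ≤ 1 * regulator K * classNumber K := by
        gcongr
        linarith
    _ ≤ (2 * Real.pi) ^ nrComplexPlaces K * regulator K * classNumber K := by gcongr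
    _ = zetaRes K * (torsionOrder K * √(absDisc K)) := hz.symm
    _ ≤ _ := by gcongr

theorem exists_le_classNumber {ε : ℝ} (hε : 0 < ε) :
    ∃ a, 0 < a ∧ ∀ (K : Type) [Field K] [NumberField K] [IsTotallyComplex K] [Algebra F K],
      finrank F K = 2 → a * absDisc K ^ (1 / 2 - ε) ≤ classNumber K := by
  obtain ⟨c, hc, H⟩ := exists_le_zetaRes F hε
  have hF := regulator_pos F
  refine ⟨c / ((2 * Real.pi) ^ finrank ℚ F * (2 ^ (2 * finrank ℚ F) * regulator F)),
    by positivity, fun K _ _ _ _ hK ↦ ?_⟩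
  have hd := absDisc_pos K
  rw [div_mul_eq_mul_div, div_le_iff₀' (by positivity)]
  refine le_trans ?_ (le_classNumber_of_quadratic F K hK)
  rw [Real.sqrt_eq_rpow]
  calc c * absDisc K ^ (1 / 2 - ε) ≤
        (zetaRes K * absDisc K ^ ε) * absDisc K ^ (1 / 2 - ε) := by
        gcongr
        exact H K hK
    _ = zetaRes K * absDisc K ^ (1 / 2 : ℝ) := by
        rw [mul_assoc, ← Real.rpow_add hd]
        congr 2
        ring

theorem exists_classNumber_le {ε : ℝ} (hε : 0 < ε) :
    ∃ b, 0 < b ∧ ∀ (K : Type) [Field K] [NumberField K] [IsTotallyComplex K] [Algebra F K],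
      finrank F K = 2 → classNumber K ≤ b * absDisc K ^ (1 / 2 + ε) := by
  obtain ⟨c, hc, H⟩ := exists_zetaRes_le (2 * finrank ℚ F) hε
  have hF := regulator_pos F
  refine ⟨c * (4 * finrank ℚ F).factorial / (regulator F / 2), by positivity,
    fun K _ _ _ _ hK ↦ ?_⟩
  have hn : finrank ℚ K = 2 * finrank ℚ F := by rw [← finrank_mul_finrank ℚ F K, hK, mul_comm]
  have hd := absDisc_pos K
  rw [div_mul_eq_mul_div, le_div_iff₀' (by positivity)]
  refine (classNumber_le_of_quadratic F K hK).trans ?_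
  rw [Real.sqrt_eq_rpow, add_comm, Real.rpow_add hd]
  calc zetaRes K * ((4 * finrank ℚ F).factorial * absDisc K ^ (1 / 2 : ℝ))
      ≤ (c * absDisc K ^ ε) * ((4 * finrank ℚ F).factorial * absDisc K ^ (1 / 2 : ℝ)) := by
        gcongr
        exact H K hn
    _ = _ := by ring

end Bounds

section Compositum

lemma _root_.IsTotallyRealField.isTotallyReal {K : Type*} [Field K] (h : IsTotallyRealField K) :
    IsTotallyReal K := ⟨fun v ↦ by
  rw [← InfinitePlace.mk_embedding v, InfinitePlace.isReal_mk_iff]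
  exact h _⟩

lemma _root_.IsTotallyImaginaryField.isTotallyComplex {K : Type*} [Field K]
    (h : IsTotallyImaginaryField K) : IsTotallyComplex K := ⟨fun v ↦ by
  rw [← InfinitePlace.not_isReal_iff_isComplex, ← InfinitePlace.mk_embedding v,
    InfinitePlace.isReal_mk_iff]
  exact h _⟩

lemma finrank_eq_one_of_isTotallyReal (F K : Type*) [Field F] [NumberField F] [IsTotallyReal F]
    [Field K] [NumberField K] [IsTotallyComplex K] [Algebra F K] : finrank F K ≠ 1 := by
  intro h
  obtain ⟨φ⟩ : Nonempty (K →+* ℂ) := inferInstance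
  have hsurj : Function.Surjective (algebraMap F K) := fun x ↦ by
    obtain ⟨c, hc⟩ := (finrank_eq_one_iff_of_nonzero' (1 : K) one_ne_zero).1 h x
    exact ⟨c, by rw [← hc, Algebra.smul_def, mul_one]⟩
  refine IsTotallyComplex.complexEmbedding_not_isReal φ (RingHom.ext fun x ↦ ?_)
  obtain ⟨c, rfl⟩ := hsurj x
  exact RingHom.congr_fun (IsTotallyReal.complexEmbedding_isReal (φ.comp (algebraMap F K))) c

lemma finrank_mul_finrank_of_field (k F K : Type*) [Field k] [Field F] [Field K] [Algebra k F]
    [Algebra F K] [Algebra k K] [IsScalarTower k F K] :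
    finrank k F * finrank F K = finrank k K :=
  finrank_mul_finrank k F K

lemma finrank_sup_mul_le {k L : Type*} [Field k] [Field L] [Algebra k L]
    (E M F : IntermediateField k L) [FiniteDimensional k M] [FiniteDimensional k F]
    (hM : E ≤ M) (hF : E ≤ F) :
    finrank k ↥(M ⊔ F) * finrank k E ≤ finrank k M * finrank k F := by
  let M' := IntermediateField.extendScalars hM
  let F' := IntermediateField.extendScalars hF
  have hfM : FiniteDimensional k M' := ‹FiniteDimensional k M›
  have hfF : FiniteDimensional k F' := ‹FiniteDimensional k F›
  have : FiniteDimensional k E :=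
    Module.Finite.of_injective (IntermediateField.inclusion hM).toLinearMap
      (IntermediateField.inclusion hM).injective
  have : FiniteDimensional E M' := FiniteDimensional.right k E M'
  have : FiniteDimensional E F' := FiniteDimensional.right k E F'
  have hle : M ⊔ F ≤ (M' ⊔ F').restrictScalars k :=
    sup_le (fun x hx ↦ (le_sup_left : M' ≤ M' ⊔ F') hx)
      (fun x hx ↦ (le_sup_right : F' ≤ M' ⊔ F') hx)
  have hfin : FiniteDimensional k ↥(M' ⊔ F') := FiniteDimensional.trans k E _
  have h1 : finrank k ↥(M ⊔ F) ≤ finrank k ↥(M' ⊔ F') :=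
    LinearMap.finrank_le_finrank_of_injective
      (f := (IntermediateField.inclusion hle).toLinearMap)
      (IntermediateField.inclusion hle).injective
  have h2 := IntermediateField.finrank_sup_le M' F'
  have h3 : finrank k E * finrank E M' = finrank k M := finrank_mul_finrank_of_field k E M'
  have h4 : finrank k E * finrank E F' = finrank k F := finrank_mul_finrank_of_field k E F'
  have h5 : finrank k E * finrank E ↥(M' ⊔ F') = finrank k ↥(M' ⊔ F') :=
    finrank_mul_finrank_of_field k E ↥(M' ⊔ F')
  rw [← h5] at h1
  rw [← h3, ← h4]
  calc finrank k ↥(M ⊔ F) * finrank k E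
      ≤ finrank k E * (finrank E M' * finrank E F') * finrank k E :=
        Nat.mul_le_mul_right _ (h1.trans (Nat.mul_le_mul_left _ h2))
    _ = _ := by ring

section Abstract

variable (E F M K : Type*) [Field E] [NumberField E] [Field F] [NumberField F] [Field M]
  [NumberField M] [Field K] [NumberField K]

lemma finrank_rat_mul_finrank [Algebra F K] : finrank ℚ F * finrank F K = finrank ℚ K :=
  finrank_mul_finrank_of_field ℚ F K

lemma finrank_eq_two_of_finrank_mul_le [Algebra F K] [IsTotallyReal F] [IsTotallyComplex K]
    (hM : finrank ℚ M = 2 * finrank ℚ E)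
    (hK : finrank ℚ K * finrank ℚ E ≤ finrank ℚ M * finrank ℚ F) : finrank F K = 2 := by
  have hE : 0 < finrank ℚ E := finrank_pos
  have hF : 0 < finrank ℚ F := finrank_pos
  rw [← finrank_rat_mul_finrank F K, hM] at hK
  have h1 : finrank F K ≤ 2 := by
    refine Nat.le_of_mul_le_mul_left ?_ (Nat.mul_pos hF hE)
    linarith
  have h2 := finrank_eq_one_of_isTotallyReal F K
  have h3 : 0 < finrank F K := finrank_pos
  omega

lemma absDisc_sq_le_of_finrank_lt [Algebra F K] [Algebra M K] (hFK : finrank F K = 2)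
    (hM : finrank ℚ M = 2 * finrank ℚ E) (hEF : finrank ℚ E < finrank ℚ F) :
    absDisc M ^ 2 ≤ absDisc K := by
  have h2 : 2 ≤ finrank M K := by
    have h := finrank_rat_mul_finrank M K
    rw [← finrank_rat_mul_finrank F K, hFK, hM] at h
    by_contra! h3
    interval_cases finrank M K <;> omega
  exact (pow_le_pow_right₀ (one_le_absDisc M) h2).trans (absDisc_pow_le M K)

end Abstract

variable {L : Type} [Field L] [CharZero L] {E F M : IntermediateField ℚ L}

lemma compositum_properties [NumberField E] [NumberField F] [NumberField M] [NumberField ↥(M ⊔ F)]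
    [IsTotallyReal F] [IsTotallyComplex M] (hEF : E ≤ F) (hne : E ≠ F) (hEM : E ≤ M)
    (hM : finrank ℚ M = 2 * finrank ℚ E) :
    (∃ _ : Algebra F ↥(M ⊔ F), finrank F ↥(M ⊔ F) = 2) ∧ IsTotallyComplex ↥(M ⊔ F) ∧
      (∃ _ : Algebra E M, finrank E M = 2) ∧ absDisc M ^ 2 ≤ absDisc ↥(M ⊔ F) := by
  let aF : Algebra F ↥(M ⊔ F) := (IntermediateField.inclusion le_sup_right).toRingHom.toAlgebra
  let aM : Algebra M ↥(M ⊔ F) := (IntermediateField.inclusion le_sup_left).toRingHom.toAlgebra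
  let aE : Algebra E M := (IntermediateField.inclusion hEM).toRingHom.toAlgebra
  have hC : IsTotallyComplex ↥(M ⊔ F) := isTotallyComplex_of_algebra M _
  have hFK := finrank_eq_two_of_finrank_mul_le E F M ↥(M ⊔ F) hM (finrank_sup_mul_le E M F hEM hEF)
  have hlt : finrank ℚ E < finrank ℚ F :=
    lt_of_not_ge fun h ↦ hne (IntermediateField.eq_of_le_of_finrank_le hEF h)
  refine ⟨⟨aF, hFK⟩, hC, ⟨aE, ?_⟩, absDisc_sq_le_of_finrank_lt E F M ↥(M ⊔ F) hFK hM hlt⟩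
  have h := finrank_rat_mul_finrank E M
  rw [hM, mul_comm 2] at h
  exact Nat.eq_of_mul_eq_mul_left finrank_pos h

end Compositum

lemma le_pow_of_rpow_bounds {a b C d D h₁ h₂ : ℝ} (ha : 0 < a) (hC : 0 < C)
    (hd : 1 ≤ d) (hD : d ^ 2 ≤ D) (h1 : h₁ ≤ b * d ^ (1 / 2 + 1 / 12 : ℝ))
    (h2 : a * D ^ (1 / 2 - 1 / 12 : ℝ) ≤ h₂) (h : h₂ ≤ C * h₁) : d ≤ (C * b / a) ^ 4 := by
  have hd0 : 0 < d := by linarith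
  have h3 : a * d ^ (5 / 6 : ℝ) ≤ C * b * d ^ (7 / 12 : ℝ) := by
    calc a * d ^ (5 / 6 : ℝ) = a * (d ^ 2) ^ (1 / 2 - 1 / 12 : ℝ) := by
          rw [← Real.rpow_natCast, ← Real.rpow_mul hd0.le]
          norm_num
      _ ≤ a * D ^ (1 / 2 - 1 / 12 : ℝ) := by
          gcongr
      _ ≤ C * (b * d ^ (1 / 2 + 1 / 12 : ℝ)) := h2.trans (h.trans (by gcongr))
      _ = C * b * d ^ (7 / 12 : ℝ) := by norm_num [mul_assoc]
  have h4 : d ^ (1 / 4 : ℝ) ≤ C * b / a := by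
    rw [le_div_iff₀ ha]
    refine le_of_mul_le_mul_right ?_ (Real.rpow_pos_of_pos hd0 (7 / 12 : ℝ))
    refine le_trans (le_of_eq ?_) h3
    rw [mul_right_comm, ← Real.rpow_add hd0, mul_comm]
    norm_num
  calc d = (d ^ (1 / 4 : ℝ)) ^ 4 := by
        rw [← Real.rpow_natCast, ← Real.rpow_mul hd0.le]
        norm_num
    _ ≤ _ := by gcongr

end BrauerSiegel

/-- Let `E ⊊ F` be totally real number fields inside a fixed algebraic closure `ℚ̄` of `ℚ`.
Then `h(M⬝F)/h(M) → ∞` as `M` ranges over CM quadratic extensions of `E` in `ℚ̄`: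
for every `C > 0` only finitely many totally imaginary quadratic extensions `M/E`
inside `ℚ̄` satisfy `h(M⬝F) ≤ C * h(M)`. -/
theorem finite_CM_ext_of_classNumber_compositum_le
    (E F : IntermediateField ℚ (AlgebraicClosure ℚ))
    [NumberField ↥E] [NumberField ↥F]
    (hEreal : IsTotallyRealField ↥E) (hFreal : IsTotallyRealField ↥F)
    (hEF : E ≤ F) (hne : E ≠ F)
    (C : ℝ) (hC : 0 < C) :
    {M : IntermediateField ℚ (AlgebraicClosure ℚ) |
      E ≤ M ∧ IsTotallyImaginaryField ↥M ∧
      finrank ℚ ↥M = 2 * finrank ℚ ↥E ∧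
      ∃ (h₁ : NumberField ↥M) (h₂ : NumberField ↥(M ⊔ F)),
        (@classNumber ↥(M ⊔ F) _ h₂ : ℝ) ≤ C * (@classNumber ↥M _ h₁ : ℝ)}.Finite := by
  have := hEreal.isTotallyReal
  have := hFreal.isTotallyReal
  obtain ⟨a, ha, Ha⟩ := BrauerSiegel.exists_le_classNumber F (ε := 1 / 12) (by norm_num)
  obtain ⟨b, hb, Hb⟩ := BrauerSiegel.exists_classNumber_le E (ε := 1 / 12) (by norm_num)
  refine ((finite_of_discr_bdd (AlgebraicClosure ℚ) ⌊(C * b / a) ^ 4⌋₊).image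
    Subtype.val).subset ?_
  rintro M ⟨hEM, hMim, hM, hMn, hKn, hle⟩
  have := hMim.isTotallyComplex
  obtain ⟨⟨_, hFK⟩, _, ⟨_, hEM2⟩, hd⟩ := BrauerSiegel.compositum_properties hEF hne hEM hM
  have hbound := BrauerSiegel.le_pow_of_rpow_bounds ha hC (BrauerSiegel.one_le_absDisc M) hd
    (Hb M hEM2) (Ha _ hFK) hle
  refine ⟨⟨M, hMn.2⟩, ?_, rfl⟩
  have h := Nat.le_floor (a := (C * b / a) ^ 4) (n := (discr M).natAbs) (by
    rwa [← BrauerSiegel.absDisc_eq_natAbs])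
  rw [Set.mem_ofPred_eq, Int.abs_eq_natAbs]
  exact_mod_cast h
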